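/- arXiv:2302.07211 — 2 statements merged into one kernel-verified Lean document; each statement's English description precedes it below -/
import Mathlib

section
/- There are constants c, C > 0 such that the following holds. For every odd prime q, every integer n ≥ 1, and every nonempty set A ⊆ 𝔽_q^n with |A| = α·q^n, the number of triples (a,b,c) ∈ A × A × A with a + c = 2b is at least c·q^{2n − C·(log(2/α))^9}. -/
open Finset

lemma km_lin {F α β : Type*} [Field F] [Fintype α] [Fintype β] (M : β → α → F)
    (h : Fintype.card β < Fintype.card α) :
    ∃ v : α → F, v ≠ 0 ∧ ∀ b, ∑ a, M b a * v a = 0 := by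
  have h1 : LinearMap.ker (Matrix.mulVecLin (Matrix.of M)) ≠ ⊥ :=
    LinearMap.ker_ne_bot_of_finrank_lt (by simpa using h)
  obtain ⟨v, hv, hv0⟩ := Submodule.exists_mem_ne_zero_of_ne_bot h1
  refine ⟨v, hv0, fun b => ?_⟩
  have := congrFun (LinearMap.mem_ker.1 hv) b
  simpa [Matrix.mulVec, dotProduct] using this

open Classical in
lemma km_support {F α ι : Type*} [Field F] [Fintype α] [Fintype ι] (f : ι → α → F) :
    ∃ h : α → F, (∀ i, ∑ a, f i a * h a = 0) ∧
      Fintype.card α ≤ Fintype.card {a // h a ≠ 0} + Fintype.card ι := by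
  by_contra hcon
  push Not at hcon
  have key : ∀ k : ℕ, ∃ h : α → F, (∀ i, ∑ a, f i a * h a = 0) ∧
      k ≤ Fintype.card {a // h a ≠ 0} := by
    intro k
    induction k with
    | zero => exact ⟨0, by simp, by simp⟩
    | succ k ih =>
      obtain ⟨h, h1, h2⟩ := ih
      have h3 := hcon h h1
      obtain ⟨g, g0, g1⟩ := km_lin (F := F) (α := α) (β := {a // h a ≠ 0} ⊕ ι)
        (fun b => Sum.elim (fun s => Pi.single s.1 1) f b) (by simpa using h3)
      have g2 : ∀ a, h a ≠ 0 → g a = 0 := by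
        intro a ha
        have := g1 (Sum.inl ⟨a, ha⟩)
        simpa [Pi.single_apply] using this
      refine ⟨h + g, fun i => ?_, ?_⟩
      · have := g1 (Sum.inr i)
        simp only [Sum.elim_inr] at this
        simp [mul_add, sum_add_distrib, h1 i, this]
      · refine lt_of_le_of_lt h2 ?_
        obtain ⟨a, ha⟩ := Function.ne_iff.1 g0
        rw [Fintype.card_subtype, Fintype.card_subtype]
        apply card_lt_card
        rw [Finset.ssubset_iff_of_subset]
        · refine ⟨a, ?_, ?_⟩
          · have : h a = 0 := by
              by_contra h'; exact ha (g2 a h')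
            simpa [this] using ha
          · simp only [mem_filter, mem_univ, true_and]
            intro h'; exact ha (g2 a h')
        · intro b hb
          simp only [mem_filter, mem_univ, true_and] at hb ⊢
          simpa [g2 b hb] using hb
  obtain ⟨h, h1, h2⟩ := key (Fintype.card α + 1)
  have := Fintype.card_subtype_le (fun a => h a ≠ 0)
  omega

open Classical in
lemma km_slice {F α ι : Type*} [Field F] [Fintype α] [Fintype ι] (f : ι → α → F)
    (g h k : ι → α → α → F)
    (H : ∀ x y z, (if x = y ∧ y = z then (1 : F) else 0) =
      ∑ i, f i x * g i y z + ∑ i, f i y * h i x z + ∑ i, f i z * k i x y) :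
    Fintype.card α ≤ 3 * Fintype.card ι := by
  obtain ⟨w, w1, w2⟩ := km_support f
  by_contra hcon
  obtain ⟨v, v0, v1⟩ := km_lin (F := F) (α := {a // w a ≠ 0}) (β := ι ⊕ ι)
    (fun b a => Sum.elim (fun i => f i a.1) (fun i => ∑ z, w z * g i a.1 z) b)
    (by simp only [Fintype.card_sum]; omega)
  apply v0
  funext x
  have e1 : ∀ y, (if x.1 = y then w y else 0) =
      ∑ i, f i x * (∑ z, w z * g i y z) + ∑ i, (∑ z, w z * h i x z) * f i y := by
    intro y
    have : (if x.1 = y then w y else 0) = 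
        ∑ z, w z * (if x.1 = y ∧ y = z then (1 : F) else 0) := by
      by_cases hxy : x.1 = y <;> simp [hxy]
    rw [this]
    simp_rw [H, mul_add, sum_add_distrib, mul_sum, sum_mul]
    have e3 : ∑ z, ∑ i, w z * (f i z * k i x y) = 0 := by
      rw [sum_comm]
      apply sum_eq_zero
      intro i _
      refine Eq.trans ?_ ((congrArg (· * k i x y) (w1 i)).trans (zero_mul _))
      simp only [sum_mul]
      exact sum_congr rfl fun z _ => by ring
    rw [e3, add_zero]
    congr 1
    · rw [sum_comm]
      exact sum_congr rfl fun i _ => sum_congr rfl fun z _ => by ring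
    · rw [sum_comm]
      exact sum_congr rfl fun i _ => sum_congr rfl fun z _ => by ring
  have e2 : ∑ y : {a // w a ≠ 0}, (if x.1 = y.1 then w y.1 else 0) * v y = w x.1 * v x := by
    rw [sum_eq_single x]
    · simp
    · intro b _ hb
      have : x.1 ≠ b.1 := fun h' => hb (Subtype.ext h'.symm)
      simp [this]
    · simp
  have e4 : w x.1 * v x = 0 := by
    rw [← e2]
    simp_rw [e1, add_mul, sum_add_distrib]
    have a1 : ∑ y : {a // w a ≠ 0}, (∑ i, f i x * (∑ z, w z * g i y z)) * v y = 0 := by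
      simp_rw [sum_mul _ _ (v _)]
      rw [sum_comm]
      apply sum_eq_zero
      intro i _
      have := v1 (Sum.inr i)
      simp only [Sum.elim_inr] at this
      refine Eq.trans ?_ ((congrArg (f i x * ·) this).trans (mul_zero _))
      refine Eq.trans ?_ (mul_sum _ _ (f i x)).symm
      exact sum_congr rfl fun z _ => mul_assoc _ _ _
    have a2 : ∑ y : {a // w a ≠ 0}, (∑ i, (∑ z, w z * h i x z) * f i y) * v y = 0 := by
      simp_rw [sum_mul _ _ (v _)]
      rw [sum_comm]
      apply sum_eq_zero
      intro i _
      have := v1 (Sum.inl i)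
      simp only [Sum.elim_inl] at this
      refine Eq.trans ?_ ((congrArg ((∑ z, w z * h i x z) * ·) this).trans (mul_zero _))
      simp only [mul_sum _ _ (∑ z, w z * h i x z)]
      exact sum_congr rfl fun z _ => by ring
    rw [a1, a2, add_zero]
  exact (mul_eq_zero.1 e4).resolve_left x.2

open Classical in
lemma km_slice' {F α I P : Type*} [Field F] [Fintype α] [Fintype I] [Fintype P]
    (low : I → Prop) (mon : I → α → F) (U V W : P → I) (c : P → F)
    (hc : ∀ p, c p ≠ 0 → low (U p) ∨ low (V p) ∨ low (W p))
    (H : ∀ x y z, (if x = y ∧ y = z then (1 : F) else 0) =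
      ∑ p, c p * mon (U p) x * mon (V p) y * mon (W p) z) :
    Fintype.card α ≤ 3 * Fintype.card {i // low i} := by
  have fib : ∀ (Q : P → I) (G : P → F), (∀ p, ¬ low (Q p) → G p = 0) →
      ∑ p, G p = ∑ i : {i // low i}, ∑ p, if Q p = i.1 then G p else 0 := by
    intro Q G hG
    rw [sum_comm]
    refine sum_congr rfl fun p _ => ?_
    by_cases hp : low (Q p)
    · rw [sum_eq_single ⟨Q p, hp⟩]
      · simp
      · intro b _ hb
        rw [if_neg]
        intro h'; exact hb (Subtype.ext h'.symm)
      · simp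
    · simp [hG p hp]
  refine km_slice (fun (i : {i // low i}) a => mon i.1 a)
    (fun i y z => ∑ p, if U p = i.1 then c p * mon (V p) y * mon (W p) z else 0)
    (fun i x z => ∑ p, if V p = i.1 then
      (if low (U p) then 0 else c p * mon (U p) x * mon (W p) z) else 0)
    (fun i x y => ∑ p, if W p = i.1 then
      (if low (U p) ∨ low (V p) then 0 else c p * mon (U p) x * mon (V p) y) else 0) ?_
  intro x y z
  rw [H]
  have s : ∀ p, c p * mon (U p) x * mon (V p) y * mon (W p) z =
      (if low (U p) then c p * mon (U p) x * mon (V p) y * mon (W p) z else 0) +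
      (if low (V p) then
        (if low (U p) then 0 else c p * mon (U p) x * mon (V p) y * mon (W p) z) else 0) +
      (if low (U p) ∨ low (V p) then 0 else c p * mon (U p) x * mon (V p) y * mon (W p) z) := by
    intro p
    by_cases h1 : low (U p) <;> by_cases h2 : low (V p) <;> simp [h1, h2]
  rw [sum_congr rfl fun p _ => s p, sum_add_distrib, sum_add_distrib]
  rw [fib U _ (fun p hp => by simp [hp]), fib V _ (fun p hp => by simp [hp]),
    fib W _ (fun p hp => by
      by_cases h0 : c p = 0
      · simp [h0]
      · have := hc p h0
        rw [if_pos]; tauto)]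
  congr 1
  · congr 1
    · refine sum_congr rfl fun i _ => ?_
      rw [mul_sum]
      refine sum_congr rfl fun p _ => ?_
      by_cases h1 : U p = i.1
      · simp only [h1, if_true, i.2]; ring
      · simp [h1]
    · refine sum_congr rfl fun i _ => ?_
      rw [mul_sum]
      refine sum_congr rfl fun p _ => ?_
      by_cases h1 : V p = i.1
      · simp only [h1, if_true, i.2]; split_ifs <;> ring
      · simp [h1]
  · refine sum_congr rfl fun i _ => ?_
    rw [mul_sum]
    refine sum_congr rfl fun p _ => ?_
    by_cases h1 : W p = i.1
    · simp only [h1, if_true]; split_ifs <;> ring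
    · simp [h1]

lemma km_one {q : ℕ} [Fact q.Prime] (x y z : ZMod q) :
    (if x + z = 2 * y then (1 : ZMod q) else 0) =
      ∑ t : Fin q × Fin q × Fin q, 
        ((if t = (⟨0, NeZero.pos q⟩, ⟨0, NeZero.pos q⟩, ⟨0, NeZero.pos q⟩) then 1 else 0) -
         (if t.1.1 + t.2.1.1 + t.2.2.1 = q - 1 then
          ((q-1).choose t.1.1 : ZMod q) * ((q - 1 - t.1.1).choose t.2.1.1 : ZMod q)
            * (-2) ^ t.2.1.1 else 0)) * x ^ t.1.1 * y ^ t.2.1.1 * z ^ t.2.2.1 := by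
  have hq : 0 < q := NeZero.pos q
  have hq1 : 1 < q := (Fact.out : q.Prime).one_lt
  have e1 : (if x + z = 2 * y then (1 : ZMod q) else 0) = 1 - (x + (-2 * y + z)) ^ (q - 1) := by
    by_cases h : x + z = 2 * y
    · have : x + (-2 * y + z) = 0 := by linear_combination h
      rw [this, if_pos h, zero_pow (by omega), sub_zero]
    · have : x + (-2 * y + z) ≠ 0 := fun h' => h (by linear_combination h')
      rw [if_neg h, ZMod.pow_card_sub_one_eq_one this, sub_self]
  rw [e1]
  simp_rw [sub_mul, sum_sub_distrib]
  congr 1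
  · rw [sum_eq_single (⟨0, NeZero.pos q⟩, ⟨0, NeZero.pos q⟩, ⟨0, NeZero.pos q⟩)]
    · simp
    · intro b _ hb; rw [if_neg hb]; simp only [zero_mul]
    · simp
  · rw [add_pow, Fintype.sum_prod_type, show q - 1 + 1 = q by omega, ← Fin.sum_univ_eq_sum_range (fun m => x ^ m * (-2 * y + z) ^ (q - 1 - m) * ((q-1).choose m : ZMod q))]
    refine sum_congr rfl fun a _ => ?_
    rw [add_pow, Fintype.sum_prod_type, mul_sum, sum_mul]
    have ha := a.2
    have : ∀ b : Fin q, ∑ c : Fin q, (if a.1 + b.1 + c.1 = q - 1 then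
          ((q-1).choose a.1 : ZMod q) * ((q - 1 - a.1).choose b.1 : ZMod q)
            * (-2) ^ b.1 else 0) * x ^ a.1 * y ^ b.1 * z ^ c.1 =
        if b.1 < q - 1 - a.1 + 1 then x ^ a.1 * ((-2 * y) ^ b.1 * z ^ (q - 1 - a.1 - b.1) * ((q - 1 - a.1).choose b.1 : ZMod q)) * ((q-1).choose a.1 : ZMod q) else 0 := by
      intro b
      split_ifs with hb
      · rw [sum_eq_single ⟨q - 1 - a.1 - b.1, by omega⟩]
        · rw [if_pos (by simp only; omega), mul_pow]; ring
        · intro c _ hc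
          rw [if_neg]
          · simp
          · intro h'; apply hc; ext; simp only; omega
        · simp
      · apply sum_eq_zero
        intro c _
        rw [if_neg (by omega)]; simp
    simp only [this]
    rw [Fin.sum_univ_eq_sum_range (fun b => if b < q - 1 - a.1 + 1 then x ^ a.1 * ((-2 * y) ^ b * z ^ (q - 1 - a.1 - b) * ((q - 1 - a.1).choose b : ZMod q)) * ((q-1).choose a.1 : ZMod q) else 0), ← sum_filter]
    refine sum_congr ?_ fun _ _ => rfl
    ext b; simp; omega

lemma km_coef {q : ℕ} [Fact q.Prime] : ∃ co : Fin q × Fin q × Fin q → ZMod q,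
    (∀ t, co t ≠ 0 → t.1.1 + t.2.1.1 + t.2.2.1 ≤ q - 1) ∧
    ∀ x y z : ZMod q, (if x + z = 2 * y then (1 : ZMod q) else 0) =
      ∑ t, co t * x ^ t.1.1 * y ^ t.2.1.1 * z ^ t.2.2.1 := by
  refine ⟨_, ?_, km_one⟩
  intro t ht
  by_contra hcon
  apply ht
  rw [if_neg, if_neg (by omega), sub_self]
  rintro rfl
  simp at hcon

open Classical in
lemma km_count (q m : ℕ) (hq : 2 ≤ q) :
    (Fintype.card {u : Fin m → Fin q // 3 * ∑ i, (u i).1 ≤ (q - 1) * m} : ℝ) ≤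
      (q : ℝ) ^ m * Real.exp (-(m : ℝ) / 18) := by
  have hq1 : (0 : ℝ) < ((q - 1 : ℕ) : ℝ) := by exact_mod_cast (by omega : 0 < q - 1)
  set Q : ℝ := ((q - 1 : ℕ) : ℝ) with hQ
  have one : ∑ j : Fin q, Real.exp (2 / 9 - 2 / 3 * (j.1 / Q)) ≤ q * Real.exp (-1 / 18) := by
    have r : ∑ j : Fin q, Real.exp (2 / 9 - 2 / 3 * (j.1 / Q)) =
        ∑ j : Fin q, Real.exp (2 / 9 - 2 / 3 * ((j.rev).1 / Q)) :=
      (Equiv.sum_comp Fin.revPerm (fun j : Fin q => Real.exp (2 / 9 - 2 / 3 * (j.1 / Q)))).symm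
    have b : ∀ j : Fin q, Real.exp (2 / 9 - 2 / 3 * (j.1 / Q)) +
        Real.exp (2 / 9 - 2 / 3 * ((j.rev).1 / Q)) ≤ 2 * Real.exp (-1 / 18) := by
      intro j
      set s : ℝ := (j.1 : ℝ) / Q with hs
      have hj : (j.1 : ℝ) ≤ Q := by rw [hQ]; exact_mod_cast (by have := j.2; omega)
      have s0 : 0 ≤ s := by positivity
      have s1 : s ≤ 1 := (div_le_one hq1).2 hj
      have hr : ((j.rev).1 : ℝ) / Q = 1 - s := by
        have : ((j.rev).1 : ℝ) = Q - j.1 := by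
          rw [eq_sub_iff_add_eq, hQ]
          rw [Fin.val_rev]
          exact_mod_cast (by have := j.2; omega)
        rw [this, hs]; field_simp
      rw [hr]
      have e : Real.exp (2 / 9 - 2 / 3 * s) + Real.exp (2 / 9 - 2 / 3 * (1 - s)) =
          Real.exp (-1/9) * (2 * Real.cosh (2 / 3 * (1 / 2 - s))) := by
        rw [Real.cosh_eq, mul_div_cancel₀ _ two_ne_zero, mul_add, ← Real.exp_add, ← Real.exp_add]
        congr 2 <;> ring
      rw [e]
      have c := Real.cosh_le_exp_half_sq (2 / 3 * (1 / 2 - s))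
      have c2 : Real.exp ((2 / 3 * (1 / 2 - s)) ^ 2 / 2) ≤ Real.exp (1 / 18) := by
        apply Real.exp_le_exp.2; nlinarith
      have c3 : Real.exp (-1/18) = Real.exp (-1/9) * Real.exp (1/18) := by
        rw [← Real.exp_add]; norm_num
      rw [c3]
      have := Real.exp_pos (-1/9)
      nlinarith
    have := sum_le_sum fun j (_ : j ∈ (univ : Finset (Fin q))) => b j
    rw [sum_add_distrib, ← r] at this
    simp at this
    simp only [neg_div, one_div] at this ⊢
    linarith
  rw [Fintype.card_subtype]
  calc (((univ.filter fun u : Fin m → Fin q => 3 * ∑ i, (u i).1 ≤ (q - 1) * m).card : ℕ) : ℝ)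
      = ∑ u ∈ univ.filter fun u : Fin m → Fin q => 3 * ∑ i, (u i).1 ≤ (q - 1) * m, (1:ℝ) := by simp
    _ ≤ ∑ u ∈ univ.filter fun u : Fin m → Fin q => 3 * ∑ i, (u i).1 ≤ (q - 1) * m,
          ∏ i, Real.exp (2 / 9 - 2 / 3 * ((u i).1 / Q)) := by
        apply sum_le_sum
        intro u hu
        rw [mem_filter] at hu
        have h2 : 3 * ∑ i, ((u i).1 : ℝ) ≤ Q * m := by rw [hQ]; exact_mod_cast hu.2
        rw [← Real.exp_sum]
        apply Real.one_le_exp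
        rw [sum_sub_distrib, ← mul_sum, ← sum_div]
        simp only [sum_const, card_univ, Fintype.card_fin, nsmul_eq_mul]
        have : (∑ i, ((u i).1 : ℝ)) / Q ≤ m / 3 := by
          rw [div_le_iff₀ hq1]; linarith
        rw [sum_div] at this
        linarith
    _ ≤ ∑ u : Fin m → Fin q, ∏ i, Real.exp (2 / 9 - 2 / 3 * ((u i).1 / Q)) :=
        sum_le_sum_of_subset_of_nonneg (filter_subset _ _) fun _ _ _ =>
          prod_nonneg fun _ _ => (Real.exp_pos _).le
    _ = (∑ j : Fin q, Real.exp (2 / 9 - 2 / 3 * (j.1 / Q))) ^ m := by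
        rw [Finset.sum_pow']; simp
    _ ≤ (q * Real.exp (-1 / 18)) ^ m :=
        pow_le_pow_left₀ (sum_nonneg fun _ _ => (Real.exp_pos _).le) one _
    _ = _ := by
        rw [mul_pow, ← Real.exp_nat_mul]; congr 2; ring

open Classical in
lemma km_EG {q : ℕ} [Fact q.Prime] (m : ℕ) (A : Finset (Fin m → ZMod q))
    (hA : ∀ a ∈ A, ∀ b ∈ A, ∀ c ∈ A, a + c = 2 • b → a = b ∧ b = c) :
    (A.card : ℝ) ≤ 3 * ((q : ℝ) ^ m * Real.exp (-(m : ℝ) / 18)) := by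
  obtain ⟨co, co1, co2⟩ := km_coef (q := q)
  have hq := (Fact.out : q.Prime).two_le
  have key := km_slice' (F := ZMod q) (α := {a // a ∈ A}) (I := Fin m → Fin q)
    (P := Fin m → Fin q × Fin q × Fin q)
    (fun u => 3 * ∑ i, (u i).1 ≤ (q - 1) * m) (fun u a => ∏ i, a.1 i ^ (u i).1)
    (fun p i => (p i).1) (fun p i => (p i).2.1) (fun p i => (p i).2.2)
    (fun p => ∏ i, co (p i)) ?_ ?_
  · rw [Fintype.card_coe] at key
    have k2 := km_count q m hq
    have k3 : (A.card : ℝ) ≤ 3 *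
      (Fintype.card {u : Fin m → Fin q // 3 * ∑ i, (u i).1 ≤ (q - 1) * m} : ℝ) := by
      have key2 : A.card ≤ 3 *
          Fintype.card {u : Fin m → Fin q // 3 * ∑ i, (u i).1 ≤ (q - 1) * m} := by
        convert key
      exact_mod_cast key2
    linarith
  · intro p hp
    have h1 : ∀ i, (p i).1.1 + (p i).2.1.1 + (p i).2.2.1 ≤ q - 1 := fun i =>
      co1 _ (Finset.prod_ne_zero_iff.1 hp i (mem_univ _))
    have h2 := sum_le_sum fun i (_ : i ∈ (univ : Finset (Fin m))) => h1 i
    rw [sum_add_distrib, sum_add_distrib] at h2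
    simp only [sum_const, card_univ, Fintype.card_fin, smul_eq_mul] at h2
    rw [mul_comm] at h2
    omega
  · intro x y z
    have h1 : (if x = y ∧ y = z then (1 : ZMod q) else 0) =
        ∏ i, (if x.1 i + z.1 i = 2 * y.1 i then (1 : ZMod q) else 0) := by
      by_cases h : x.1 + z.1 = 2 • y.1
      · obtain ⟨e1, e2⟩ := hA _ x.2 _ y.2 _ z.2 h
        rw [if_pos ⟨Subtype.ext e1, Subtype.ext e2⟩]
        symm
        apply prod_eq_one
        intro i _
        have := congrFun h i
        rw [if_pos (by simpa using this)]
      · rw [if_neg]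
        · obtain ⟨i, hi⟩ := Function.ne_iff.1 h
          symm
          apply prod_eq_zero (mem_univ i)
          rw [if_neg]
          simpa using hi
        · rintro ⟨rfl, rfl⟩
          exact h (two_nsmul _).symm
    refine Eq.trans (by congr!) (h1.trans ?_)
    simp_rw [co2]
    rw [Fintype.prod_sum]
    refine sum_congr rfl fun p _ => ?_
    simp only [prod_mul_distrib]

/-- affine map -/
def kmPhi {q n m : ℕ} (L : Fin m → Fin n → ZMod q) (v : Fin n → ZMod q)
    (x : Fin m → ZMod q) : Fin n → ZMod q := v + ∑ i, x i • L i

lemma kmPhi_add {q n m : ℕ} (L : Fin m → Fin n → ZMod q) (v : Fin n → ZMod q)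
    (x d : Fin m → ZMod q) : kmPhi L v (x + d) = kmPhi L v x + ∑ i, d i • L i := by
  simp [kmPhi, add_smul, sum_add_distrib, add_assoc]

open Classical in
/-- For fixed `x` and `d ≠ 0`, few affine maps send the progression into `A`. -/
lemma km_fix {q n m : ℕ} [Fact q.Prime] (A : Finset (Fin n → ZMod q))
    (x d : Fin m → ZMod q) (hd : d ≠ 0) :
    (univ.filter fun w : (Fin m → Fin n → ZMod q) × (Fin n → ZMod q) =>
      kmPhi w.1 w.2 x ∈ A ∧ kmPhi w.1 w.2 (x + d) ∈ A ∧ kmPhi w.1 w.2 (x + d + d) ∈ A).card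
      * q ^ n ≤
    ((A ×ˢ A ×ˢ A).filter fun t => t.1 + t.2.2 = 2 • t.2.1).card * q ^ (n * m) := by
  obtain ⟨j, hj⟩ := Function.ne_iff.1 hd
  simp only [Pi.zero_apply] at hj
  have h1 : (univ.filter fun w : (Fin m → Fin n → ZMod q) × (Fin n → ZMod q) =>
      kmPhi w.1 w.2 x ∈ A ∧ kmPhi w.1 w.2 (x + d) ∈ A ∧ kmPhi w.1 w.2 (x + d + d) ∈ A).card ≤
      (((A ×ˢ A ×ˢ A).filter fun t => t.1 + t.2.2 = 2 • t.2.1) ×ˢ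
        (univ : Finset ({i : Fin m // i ≠ j} → Fin n → ZMod q))).card := by
    apply card_le_card_of_injOn (fun w => ((kmPhi w.1 w.2 x, kmPhi w.1 w.2 (x + d),
      kmPhi w.1 w.2 (x + d + d)), fun i => w.1 i.1))
    · intro w hw
      simp only [coe_filter, mem_univ, true_and, Set.mem_ofPred_eq] at hw
      simp only [coe_product, coe_univ, Set.mem_prod, Set.mem_univ, and_true, mem_coe, mem_filter,
        mem_product]
      refine ⟨hw, ?_⟩
      rw [kmPhi_add, kmPhi_add, two_nsmul]
      abel
    · rintro ⟨L, v⟩ _ ⟨L', v'⟩ _ h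
      simp only [Prod.mk.injEq] at h
      obtain ⟨⟨h1, h2, -⟩, h3⟩ := h
      have h3' : ∀ i, i ≠ j → L i = L' i := fun i hi => congrFun h3 ⟨i, hi⟩
      rw [kmPhi_add, kmPhi_add, h1] at h2
      have h4 := add_left_cancel h2
      rw [← add_sum_erase _ _ (mem_univ j), ← add_sum_erase _ _ (mem_univ j)] at h4
      have h5 : ∑ i ∈ univ.erase j, d i • L i = ∑ i ∈ univ.erase j, d i • L' i :=
        sum_congr rfl fun i hi => by rw [h3' i (ne_of_mem_erase hi)]
      rw [h5] at h4
      have h6 := add_right_cancel h4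
      have h7 : L j = L' j := by
        have := congrArg (fun u => (d j)⁻¹ • u) h6
        simpa [smul_smul, inv_mul_cancel₀ hj] using this
      have h8 : L = L' := by
        funext i
        by_cases hi : i = j
        · rw [hi, h7]
        · exact h3' i hi
      subst h8
      simp only [kmPhi] at h1
      rw [add_right_cancel h1]
  rw [card_product] at h1
  have h2 : (univ : Finset ({i : Fin m // i ≠ j} → Fin n → ZMod q)).card * q ^ n
      = q ^ (n * m) := by
    have hm : 0 < m := j.pos
    simp only [card_univ, Fintype.card_pi, ZMod.card, prod_const, Fintype.card_fin]
    simp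
    rw [← pow_mul, ← pow_add]
    congr 1
    obtain ⟨k, rfl⟩ : ∃ k, m = k + 1 := ⟨m - 1, by omega⟩
    simp; ring
  calc _ ≤ _ := Nat.mul_le_mul_right (q ^ n) h1
    _ = _ := by rw [mul_assoc, h2]

open Classical in
lemma km_super {q n m : ℕ} [Fact q.Prime] (hq : Odd q) (A : Finset (Fin n → ZMod q))
    (hm : 6 * Real.exp (-(m : ℝ) / 18) * (q : ℝ) ^ n ≤ A.card) :
    (A.card : ℝ) / 2 * (q : ℝ) ^ n ≤
    (((A ×ˢ A ×ˢ A).filter fun t => t.1 + t.2.2 = 2 • t.2.1).card : ℝ) * (q : ℝ) ^ (2 * m) := by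
  set T := ((A ×ˢ A ×ˢ A).filter fun t => t.1 + t.2.2 = 2 • t.2.1).card with hT
  have hq0 : (0 : ℝ) < q := by exact_mod_cast (Fact.out : q.Prime).pos
  have cX : Fintype.card (Fin m → ZMod q) = q ^ m := by simp
  have cW : Fintype.card ((Fin m → Fin n → ZMod q) × (Fin n → ZMod q)) = q ^ (n * m) * q ^ n := by
    simp [← pow_mul]
  let R : ((Fin m → Fin n → ZMod q) × (Fin n → ZMod q)) → (Fin m → ZMod q) × (Fin m → ZMod q) → Prop := fun w p => p.2 ≠ 0 ∧
    kmPhi w.1 w.2 p.1 ∈ A ∧ kmPhi w.1 w.2 (p.1 + p.2) ∈ A ∧ kmPhi w.1 w.2 (p.1 + p.2 + p.2) ∈ A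
  let N : ((Fin m → Fin n → ZMod q) × (Fin n → ZMod q)) → ℕ := fun w => (univ.filter fun p => R w p).card
  let B : ((Fin m → Fin n → ZMod q) × (Fin n → ZMod q)) → Finset (Fin m → ZMod q) := fun w => univ.filter fun x => kmPhi w.1 w.2 x ∈ A
  let r : ℝ := 3 * ((q : ℝ) ^ m * Real.exp (-(m : ℝ) / 18))
  have hr : 0 ≤ r := by positivity
  have step1 : ∀ w, ((B w).card : ℝ) - r ≤ N w * (q : ℝ) ^ m := by
    intro w
    by_cases h0 : N w = 0
    · rw [h0]
      have := km_EG m (B w) ?_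
      · simp; linarith
      · intro a ha b hb c hc habc
        by_contra hne
        rw [card_eq_zero, filter_eq_empty_iff] at h0
        have hc' : c = a + (b - a) + (b - a) := by
          rw [two_nsmul] at habc
          rw [eq_sub_of_add_eq' habc]; abel
        refine h0 (mem_univ (a, b - a)) ⟨?_, ?_, ?_, ?_⟩
        · intro h
          have hab : b = a := sub_eq_zero.1 h
          apply hne
          refine ⟨hab.symm, ?_⟩
          rw [hc', hab]; simp
        · exact (mem_filter.1 ha).2
        · have := (mem_filter.1 hb).2
          simpa using this
        · have := (mem_filter.1 hc).2
          rw [hc'] at this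
          exact this
    · have h1 : (1 : ℝ) ≤ N w := by exact_mod_cast Nat.one_le_iff_ne_zero.2 h0
      have h2 : ((B w).card : ℝ) ≤ (q : ℝ) ^ m := by
        exact_mod_cast (card_le_univ (B w)).trans cX.le
      have h3 : (0 : ℝ) < (q : ℝ) ^ m := by positivity
      nlinarith
  have sB : ∑ w, (B w).card = q ^ m * (q ^ (n * m) * A.card) := by
    have : ∀ w, (B w).card = ∑ x, if kmPhi w.1 w.2 x ∈ A then 1 else 0 := fun w => by
      simp [B]
    simp_rw [this]
    rw [sum_comm]
    have h2 : ∀ x : (Fin m → ZMod q), ∑ w : ((Fin m → Fin n → ZMod q) × (Fin n → ZMod q)), (if kmPhi w.1 w.2 x ∈ A then 1 else 0) =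
        q ^ (n * m) * A.card := by
      intro x
      rw [Fintype.sum_prod_type]
      have h3 : ∀ L : Fin m → Fin n → ZMod q,
          ∑ v : Fin n → ZMod q, (if kmPhi L v x ∈ A then 1 else 0) = A.card := by
        intro L
        have := Equiv.sum_comp (Equiv.addRight (∑ i, x i • L i))
          (fun u : Fin n → ZMod q => if u ∈ A then 1 else 0)
        simp only [Equiv.coe_addRight] at this
        refine Eq.trans ?_ (this.trans (by simp))
        exact sum_congr rfl fun v _ => by simp only [kmPhi]; congr!
      rw [sum_congr rfl fun L _ => h3 L]
      simp [← pow_mul]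
    rw [sum_congr rfl fun x _ => h2 x]
    simp
  have sN : (∑ w, N w) * q ^ n ≤ q ^ (2 * m) * (T * q ^ (n * m)) := by
    have : ∀ w, N w = ∑ p, if R w p then 1 else 0 := fun w => by
      simp only [N]; rw [card_filter]
    simp_rw [this]
    rw [sum_comm, sum_mul]
    have h2 : ∀ p : (Fin m → ZMod q) × (Fin m → ZMod q), (∑ w, if R w p then 1 else 0) * q ^ n ≤ T * q ^ (n * m) := by
      intro p
      by_cases hp : p.2 = 0
      · simp [R, hp]
      · have := km_fix (m := m) A p.1 p.2 hp
        refine le_trans (le_of_eq ?_) this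
        simp [R, hp]
    refine (sum_le_sum fun p _ => h2 p).trans ?_
    rw [sum_const, card_univ, Fintype.card_prod, cX, smul_eq_mul, two_mul, pow_add]
  have s1 := sum_le_sum fun w (_ : w ∈ (univ : Finset ((Fin m → Fin n → ZMod q) × (Fin n → ZMod q)))) => step1 w
  rw [sum_sub_distrib, sum_const, card_univ, cW, nsmul_eq_mul, ← sum_mul] at s1
  have sB' : ∑ w, ((B w).card : ℝ) = (q : ℝ) ^ m * ((q : ℝ) ^ (n * m) * A.card) := by
    exact_mod_cast sB
  have sN' : (∑ w, (N w : ℝ)) * (q : ℝ) ^ n ≤ (q : ℝ) ^ (2 * m) * (T * (q : ℝ) ^ (n * m)) := by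
    exact_mod_cast sN
  rw [sB'] at s1
  push_cast at s1
  have p1 : (0 : ℝ) < (q : ℝ) ^ m := by positivity
  have p2 : (0 : ℝ) < (q : ℝ) ^ n := by positivity
  have p3 : (0 : ℝ) < (q : ℝ) ^ (n * m) := by positivity
  have s2 : (q : ℝ) ^ m * ((q : ℝ) ^ (n * m) * (A.card / 2)) ≤
      (∑ w, (N w : ℝ)) * (q : ℝ) ^ m := by
    refine le_trans ?_ s1
    have := mul_le_mul_of_nonneg_left hm (mul_pos p1 p3).le
    simp only [r]
    nlinarith
  have s3 : (q : ℝ) ^ (n * m) * (A.card / 2) ≤ ∑ w, (N w : ℝ) := by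
    rw [mul_comm] at s2
    exact le_of_mul_le_mul_right s2 p1
  have s4 := (mul_le_mul_of_nonneg_right s3 p2.le).trans sN'
  refine le_of_mul_le_mul_left ?_ p3
  linarith

/-- **Kelley–Meka, finite field case (counting version).** There are constants `c, C > 0` such
that for every odd prime `q`, every `n ≥ 1` and every nonempty `A ⊆ 𝔽_q^n` of density `α`,
the number of triples `(a,b,c) ∈ A × A × A` with `a + c = 2b` is at least
`c·q^{2n - C·(log(2/α))^9}`. -/
theorem statement2 :
    ∃ c > (0 : ℝ), ∃ C > (0 : ℝ), ∀ q n : ℕ, q.Prime → Odd q → 1 ≤ n →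
      ∀ A : Finset (Fin n → ZMod q), A.Nonempty →
        c * (q : ℝ) ^ (2 * (n : ℝ) -
            C * Real.log (2 / ((A.card : ℝ) / (q : ℝ) ^ n)) ^ 9) ≤
          (((A ×ˢ A ×ˢ A).filter fun t => t.1 + t.2.2 = 2 • t.2.1).card : ℝ) := by
  refine ⟨1, one_pos, 3000, by norm_num, ?_⟩
  intro q n hq hodd _ A hA
  have : Fact q.Prime := ⟨hq⟩
  have hq3 : 3 ≤ q := by
    have := hq.two_le
    rcases hodd with ⟨k, hk⟩
    omega
  have hq3' : (3 : ℝ) ≤ q := by exact_mod_cast hq3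
  have hq0 : (0 : ℝ) < q := by linarith
  have p2 : (0 : ℝ) < (q : ℝ) ^ n := by positivity
  have hA0 : (0 : ℝ) < A.card := by exact_mod_cast hA.card_pos
  set a : ℝ := (A.card : ℝ) / (q : ℝ) ^ n with ha
  have a0 : 0 < a := by positivity
  have hAa : (A.card : ℝ) = a * (q : ℝ) ^ n := by rw [ha]; field_simp
  have a1 : a ≤ 1 := by
    rw [ha, div_le_one p2]
    have := card_le_univ A
    simp at this
    exact_mod_cast this
  set l : ℝ := Real.log (2 / a) with hl
  have el : Real.exp (-l) = a / 2 := by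
    rw [Real.exp_neg, hl, Real.exp_log (div_pos two_pos a0), inv_div]
  have l0 : 0.693 ≤ l := by
    have h1 : Real.log 2 ≤ l := by
      apply Real.log_le_log (by norm_num)
      rw [le_div_iff₀ a0]; linarith
    have := Real.log_two_gt_d9
    linarith
  set m : ℕ := ⌈18 * (l + 2)⌉₊ with hmdef
  have m1 : 18 * (l + 2) ≤ m := Nat.le_ceil _
  have m2 : (m : ℝ) ≤ 72 * l := by
    have := Nat.ceil_lt_add_one (show 0 ≤ 18 * (l + 2) by linarith)
    rw [← hmdef] at this
    linarith
  have hm : 6 * Real.exp (-(m : ℝ) / 18) * (q : ℝ) ^ n ≤ A.card := by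
    rw [hAa]
    apply mul_le_mul_of_nonneg_right _ p2.le
    have h1 : Real.exp (-(m : ℝ) / 18) ≤ Real.exp (-l) * Real.exp (-2) := by
      rw [← Real.exp_add]; apply Real.exp_le_exp.2; linarith
    have h2 : Real.exp (-2) ≤ 1 / 3 := by
      rw [Real.exp_neg, ← one_div]
      apply one_div_le_one_div_of_le (by norm_num)
      have := Real.add_one_le_exp 2
      linarith
    rw [el] at h1
    nlinarith
  have key := km_super (m := m) hodd A hm
  have key' : a / 2 * (q : ℝ) ^ (2 * n) ≤
      (((A ×ˢ A ×ˢ A).filter fun t => t.1 + t.2.2 = 2 • t.2.1).card : ℝ) * (q : ℝ) ^ (2 * m) := by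
    refine le_trans (le_of_eq ?_) (key.trans (le_of_eq ?_))
    · rw [hAa, two_mul, pow_add]; ring
    · congr!
  have h3 : (q : ℝ) ^ (-l) ≤ a / 2 := by
    rw [← el, Real.rpow_def_of_pos hq0]
    apply Real.exp_le_exp.2
    have : 1 ≤ Real.log q := by
      rw [Real.le_log_iff_exp_le hq0]
      have := Real.exp_one_lt_d9
      linarith
    nlinarith
  have h4 : l * 145 ≤ 3000 * l ^ 9 := by
    have : (0.693 : ℝ) ^ 8 ≤ l ^ 8 := pow_le_pow_left₀ (by norm_num) l0 8
    have h5 : (145 : ℝ) ≤ 3000 * l ^ 8 := by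
      refine le_trans ?_ (mul_le_mul_of_nonneg_left this (by norm_num))
      norm_num
    have := mul_le_mul_of_nonneg_left h5 (by linarith : 0 ≤ l)
    calc _ ≤ _ := this
      _ = _ := by ring
  rw [one_mul]
  have p4 : (0 : ℝ) < (q : ℝ) ^ (2 * m) := by positivity
  refine le_of_mul_le_mul_right (le_trans ?_ key') p4
  calc (q : ℝ) ^ (2 * (n : ℝ) - 3000 * l ^ 9) * (q : ℝ) ^ (2 * m)
      = (q : ℝ) ^ (2 * (n : ℝ) - 3000 * l ^ 9 + 2 * m) := by
        rw [Real.rpow_add hq0, ← Real.rpow_natCast _ (2 * m)]; push_cast; rfl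
    _ ≤ (q : ℝ) ^ (-l + 2 * n) := by
        apply Real.rpow_le_rpow_of_exponent_le (by linarith)
        linarith
    _ = (q : ℝ) ^ (-l) * (q : ℝ) ^ (2 * n) := by
        rw [Real.rpow_add hq0, ← Real.rpow_natCast _ (2 * n)]; push_cast; rfl
    _ ≤ _ := mul_le_mul_of_nonneg_right h3 (by positivity)
end

section
/- There are constants C, c > 0 such that the following holds. For every positive integer N and every nonempty set A ⊆ {1,…,N} with |A| = αN, the sumset A + A + A = {a₁ + a₂ + a₃ : a₁, a₂, a₃ ∈ A} contains an arithmetic progression of length L for some integer L ≥ exp(−C·(log(2/α))²)·N^{c/(log(2/α))^9}; that is, there exist integers x and y with y ≠ 0 such that {x + jy : j = 0, 1, …, L−1} ⊆ A + A + A. -/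
namespace KM
open Finset

variable {G : Type} [AddCommGroup G] [Fintype G] [DecidableEq G]

noncomputable def ball (l : List (AddChar G ℂ × ℝ)) (r : ℝ) : Finset G :=
  letI := Classical.decPred (fun x : G => ∀ p ∈ l, p.2 * ‖1 - p.1 x‖ ≤ r)
  Finset.univ.filter (fun x : G => ∀ p ∈ l, p.2 * ‖1 - p.1 x‖ ≤ r)

lemma mem_ball {l : List (AddChar G ℂ × ℝ)} {r : ℝ} {x : G} :
    x ∈ ball l r ↔ ∀ p ∈ l, p.2 * ‖1 - p.1 x‖ ≤ r := by
  simp [ball]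

lemma char_add_le (χ : AddChar G ℂ) (x y : G) :
    ‖1 - χ (x + y)‖ ≤ ‖1 - χ x‖ + ‖1 - χ y‖ := by
  have : 1 - χ (x + y) = (1 - χ x) + χ x * (1 - χ y) := by
    rw [AddChar.map_add_eq_mul]; ring
  rw [this]
  refine (norm_add_le _ _).trans ?_
  simp

lemma char_neg_eq (χ : AddChar G ℂ) (x : G) : ‖1 - χ (-x)‖ = ‖1 - χ x‖ := by
  have h : χ (-x) * χ x = 1 := by rw [← AddChar.map_add_eq_mul]; simp
  have : 1 - χ (-x) = - (χ (-x) * (1 - χ x)) := by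
    rw [mul_sub, h]; ring
  rw [this]; simp

lemma char_sub_eq (χ : AddChar G ℂ) (x y : G) : ‖1 - χ (x - y)‖ = ‖χ y - χ x‖ := by
  have h : χ (x - y) * χ y = χ x := by rw [← AddChar.map_add_eq_mul]; simp
  have : χ y - χ x = (1 - χ (x - y)) * χ y := by
    rw [sub_mul, h]; ring
  rw [this]; simp

lemma zero_mem_ball (l : List (AddChar G ℂ × ℝ)) {r : ℝ} (hr : 0 ≤ r) : (0 : G) ∈ ball l r := by
  rw [mem_ball]; intro p _; simpa using hr

lemma ball_mono (l : List (AddChar G ℂ × ℝ)) {r s : ℝ} (h : r ≤ s) : ball l r ⊆ ball l s := by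
  intro x hx; rw [mem_ball] at *; exact fun p hp => (hx p hp).trans h

lemma neg_mem_ball {l : List (AddChar G ℂ × ℝ)} {r : ℝ} {x : G} (hx : x ∈ ball l r) :
    -x ∈ ball l r := by
  rw [mem_ball] at *; intro p hp; rw [char_neg_eq]; exact hx p hp

lemma add_mem_ball {l : List (AddChar G ℂ × ℝ)} (hl : ∀ p ∈ l, 0 ≤ p.2) {r s : ℝ} {x y : G}
    (hx : x ∈ ball l r) (hy : y ∈ ball l s) : x + y ∈ ball l (r + s) := by
  rw [mem_ball] at *; intro p hp
  have := mul_le_mul_of_nonneg_left (char_add_le p.1 x y) (hl p hp)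
  linarith [hx p hp, hy p hp]

lemma sub_mem_ball {l : List (AddChar G ℂ × ℝ)} (hl : ∀ p ∈ l, 0 ≤ p.2) {r s : ℝ} {x y : G}
    (hx : x ∈ ball l r) (hy : y ∈ ball l s) : x - y ∈ ball l (r + s) := by
  rw [sub_eq_add_neg]; exact add_mem_ball hl hx (neg_mem_ball hy)

lemma nsmul_mem_ball {l : List (AddChar G ℂ × ℝ)} (hl : ∀ p ∈ l, 0 ≤ p.2) {r : ℝ} {x : G}
    (hx : x ∈ ball l r) (j : ℕ) : j • x ∈ ball l (j * r) := by
  induction j with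
  | zero => simpa using zero_mem_ball l le_rfl
  | succ j ih =>
    rw [succ_nsmul]; push_cast; rw [add_mul, one_mul]
    exact add_mem_ball hl ih hx

lemma sum_mem_ball {l : List (AddChar G ℂ × ℝ)} (hl : ∀ p ∈ l, 0 ≤ p.2) {r : ℝ} {n : ℕ}
    (u : Fin n → G) (hu : ∀ i, u i ∈ ball l r) : ∑ i, u i ∈ ball l (n * r) := by
  induction n with
  | zero => simpa using zero_mem_ball l le_rfl
  | succ n ih =>
    rw [Fin.sum_univ_castSucc]; push_cast; rw [add_mul, one_mul]
    exact add_mem_ball hl (ih _ (fun i => hu _)) (hu _)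

lemma cell_pigeon (l : List (AddChar G ℂ × ℝ)) (hl : ∀ p ∈ l, 0 ≤ p.2) (X : Finset G)
    {R s : ℝ} (hs : 0 < s) (n : ℕ) (hn : R ≤ n * (s / 2))
    (hX : ∀ x ∈ X, ∀ p ∈ l, p.2 * ‖1 - p.1 x‖ ≤ R) :
    ∃ Y ⊆ X, X.card ≤ ((2 * n + 1) ^ 2) ^ l.length * Y.card ∧
      ∀ y ∈ Y, ∀ y' ∈ Y, ∀ p ∈ l, p.2 * ‖1 - p.1 (y - y')‖ ≤ s := by
  induction l with
  | nil => exact ⟨X, subset_rfl, by simp, by simp⟩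
  | cons p l ih =>
    obtain ⟨Y, hYX, hc, hY⟩ := ih (fun q hq => hl q (by simp [hq]))
      (fun x hx q hq => hX x hx q (by simp [hq]))
    let f : G → ℤ × ℤ := fun x =>
      (⌊p.2 * (1 - p.1 x).re / (s / 2)⌋, ⌊p.2 * (1 - p.1 x).im / (s / 2)⌋)
    let I : Finset (ℤ × ℤ) := (Finset.Icc (-(n:ℤ)) n) ×ˢ (Finset.Icc (-(n:ℤ)) n)
    have hp0 := hl p (by simp)
    have hbd : ∀ a : ℝ, |a| ≤ R → ⌊a / (s / 2)⌋ ∈ Finset.Icc (-(n:ℤ)) n := by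
      intro a ha
      rw [abs_le] at ha
      rw [Finset.mem_Icc]
      constructor
      · rw [Int.le_floor]; push_cast
        rw [le_div_iff₀ (by positivity)]; linarith
      · have : (⌊a / (s / 2)⌋ : ℝ) ≤ n := by
          refine (Int.floor_le _).trans ?_
          rw [div_le_iff₀ (by positivity)]; linarith
        exact_mod_cast this
    have hf : ∀ y ∈ Y, f y ∈ I := by
      intro y hy
      have h1 := hX y (hYX hy) p (by simp)
      simp only [f, I, Finset.mem_product]
      refine ⟨hbd _ ?_, hbd _ ?_⟩
      · rw [abs_mul, abs_of_nonneg hp0]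
        exact (mul_le_mul_of_nonneg_left (Complex.abs_re_le_norm _) hp0).trans h1
      · rw [abs_mul, abs_of_nonneg hp0]
        exact (mul_le_mul_of_nonneg_left (Complex.abs_im_le_norm _) hp0).trans h1
    have hIc : I.card = (2 * n + 1) ^ 2 := by
      simp only [I, Finset.card_product, Int.card_Icc]
      have : ((n:ℤ) + 1 - -(n:ℤ)).toNat = 2 * n + 1 := by omega
      rw [this]; ring
    have hIn : I.Nonempty := by
      rw [← Finset.card_pos, hIc]; positivity
    have : ∃ c ∈ I, Y.card ≤ I.card * (Y.filter (fun y => f y = c)).card := by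
      by_contra hcon
      push Not at hcon
      have h1 := Finset.card_eq_sum_card_fiberwise hf
      have h2 : I.card * Y.card = ∑ c ∈ I, I.card * (Y.filter (fun y => f y = c)).card := by
        rw [← Finset.mul_sum, ← h1]
      have h3 : ∑ c ∈ I, I.card * (Y.filter (fun y => f y = c)).card < ∑ c ∈ I, Y.card :=
        Finset.sum_lt_sum_of_nonempty hIn hcon
      rw [← h2] at h3; simp at h3
    obtain ⟨c, hc1, hc2⟩ := this
    refine ⟨Y.filter (fun y => f y = c), (Finset.filter_subset _ _).trans hYX, ?_, ?_⟩
    · rw [List.length_cons, pow_succ, mul_assoc]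
      refine hc.trans (Nat.mul_le_mul_left _ ?_)
      rw [← hIc]; exact hc2
    · intro y hy y' hy' q hq
      rw [Finset.mem_filter] at hy hy'
      rcases List.mem_cons.1 hq with rfl | hq
      · have hfe : f y = f y' := hy.2.trans hy'.2.symm
        simp only [f, Prod.mk.injEq] at hfe
        have h1 := Int.abs_sub_lt_one_of_floor_eq_floor hfe.1
        have h2 := Int.abs_sub_lt_one_of_floor_eq_floor hfe.2
        rw [← sub_div, abs_div, abs_of_pos (half_pos hs), div_lt_one (half_pos hs), ← mul_sub, abs_mul,
          abs_of_nonneg hp0] at h1 h2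
        rw [char_sub_eq]
        have h3 := Complex.norm_le_abs_re_add_abs_im (q.1 y' - q.1 y)
        have e1 : (q.1 y' - q.1 y).re = (1 - q.1 y).re - (1 - q.1 y').re := by simp
        have e2 : (q.1 y' - q.1 y).im = (1 - q.1 y).im - (1 - q.1 y').im := by simp; ring
        rw [e1, e2] at h3
        have := mul_le_mul_of_nonneg_left h3 hp0
        linarith
      · exact hY y hy.1 y' hy'.1 q hq

lemma ball_doubling (l : List (AddChar G ℂ × ℝ)) (hl : ∀ p ∈ l, 0 ≤ p.2) {r : ℝ} (hr : 0 < r) :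
    (ball l r).card ≤ 81 ^ l.length * (ball l (r / 2)).card := by
  obtain ⟨Y, hY, hc, hd⟩ := cell_pigeon l hl (ball l r) (R := r) (s := r / 2) (by positivity) 4
    (by push_cast; linarith) (fun x hx => mem_ball.1 hx)
  refine hc.trans ?_
  norm_num
  rcases Y.eq_empty_or_nonempty with rfl | ⟨y0, hy0⟩
  · simp
  · refine Finset.card_le_card_of_injOn (fun y => y - y0) ?_ ?_
    · intro y hy
      simp only [Finset.mem_coe]
      rw [mem_ball]; exact hd y hy y0 hy0
    · intro a _ b _ h; simpa using h

lemma exists_small (l : List (AddChar G ℂ × ℝ)) (hl : ∀ p ∈ l, 0 ≤ p.2) {W s : ℝ}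
    (hW : ∀ p ∈ l, p.2 ≤ W) (hs : 0 < s) (n : ℕ) (hn : 2 * W ≤ n * (s / 2))
    (hG : ((2 * n + 1) ^ 2) ^ l.length < Fintype.card G) :
    ∃ y ∈ ball l s, y ≠ 0 := by
  obtain ⟨Y, hY, hc, hd⟩ := cell_pigeon l hl (Finset.univ : Finset G) (R := 2 * W) hs n
    hn (by
      intro x _ p hp
      have h1 : ‖1 - p.1 x‖ ≤ 2 := by
        refine (norm_sub_le _ _).trans ?_
        simp; norm_num
      have h0 := hl p hp
      have h2 := hW p hp
      nlinarith [norm_nonneg (1 - p.1 x)])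
  have h1 : 1 < Y.card := by
    by_contra hcon
    have : Y.card ≤ 1 := by omega
    have h2 := hc.trans (Nat.mul_le_mul_left _ this)
    rw [Finset.card_univ] at h2
    omega
  obtain ⟨a, ha, b, hb, hab⟩ := Finset.one_lt_card.1 h1
  exact ⟨a - b, mem_ball.2 (hd a ha b hb), sub_ne_zero.2 hab⟩

lemma exists_regular (l : List (AddChar G ℂ × ℝ)) (hl : ∀ p ∈ l, 0 ≤ p.2) {ε ρ : ℝ} (hε : 0 < ε)
    (hρ : 0 < ρ) (n : ℕ) (hn0 : 0 < n) (hn : (81:ℝ) ^ l.length ≤ (1 + ε) ^ n) :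
    ∃ r, ρ / 2 ≤ r ∧ r ≤ ρ ∧
      ((ball l (r + ρ / (2 * n))).card : ℝ) ≤ (1 + ε) * (ball l r).card := by
  by_contra hcon
  push Not at hcon
  have hn1 : (0:ℝ) < n := by exact_mod_cast hn0
  have key : ∀ i : ℕ, i ≤ n → 
      (1 + ε) ^ i * (ball l (ρ / 2)).card ≤ ((ball l (ρ / 2 + i * (ρ / (2 * n)))).card : ℝ) ∧
      (0 < i → (1 + ε) ^ i * (ball l (ρ / 2)).card < ((ball l (ρ / 2 + i * (ρ / (2 * n)))).card : ℝ)) := by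
    intro i hi
    induction i with
    | zero => simp
    | succ i ih =>
      have h1 := (ih (by omega)).1
      have hin : (i:ℝ) ≤ n := by exact_mod_cast (by omega : i ≤ n)
      have h2 := hcon (ρ / 2 + i * (ρ / (2 * n))) (by have : 0 ≤ i * (ρ / (2 * n)) := by positivity
                                                      linarith) (by
        have : (i:ℝ) * (ρ / (2 * n)) ≤ n * (ρ / (2 * n)) := by gcongr
        have h3 : n * (ρ / (2 * n)) = ρ / 2 := by field_simp
        linarith)
      have h4 : ρ / 2 + i * (ρ / (2 * n)) + ρ / (2 * n) = ρ / 2 + ((i + 1 : ℕ):ℝ) * (ρ / (2 * n)) := by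
        push_cast; ring
      rw [h4] at h2
      have h5 : (1 + ε) ^ (i + 1) * (ball l (ρ / 2)).card < ((ball l (ρ / 2 + ((i + 1 : ℕ):ℝ) * (ρ / (2 * n)))).card : ℝ) := by
        refine lt_of_le_of_lt ?_ h2
        rw [pow_succ, mul_comm _ (1 + ε), mul_assoc]
        gcongr
      exact ⟨h5.le, fun _ => h5⟩
  have h1 := (key n le_rfl).2 hn0
  have h3 : ρ / 2 + n * (ρ / (2 * n)) = ρ := by field_simp; norm_num
  rw [h3] at h1
  have h2 : ((ball l ρ).card : ℝ) ≤ 81 ^ l.length * (ball l (ρ / 2)).card := by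
    exact_mod_cast ball_doubling l hl hρ
  have h4 : (81:ℝ) ^ l.length * (ball l (ρ / 2)).card ≤ (1 + ε) ^ n * (ball l (ρ / 2)).card := by
    gcongr
  linarith

lemma regular_shift {l : List (AddChar G ℂ × ℝ)} (hl : ∀ p ∈ l, 0 ≤ p.2) {r h ε : ℝ}
    (hreg : ((ball l (r + h)).card : ℝ) ≤ (1 + ε) * (ball l r).card) {x : G} (hx : x ∈ ball l h)
    (hh : 0 ≤ h) :
    (((ball l r).filter (fun y => y - x ∉ ball l r)).card : ℝ) ≤ ε * (ball l r).card := by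
  have hdis : Disjoint ((ball l r).filter (fun y => y - x ∉ ball l r))
      ((ball l r).image (fun y => y + x)) := by
    rw [Finset.disjoint_left]
    intro y hy hy'
    rw [Finset.mem_filter] at hy
    rw [Finset.mem_image] at hy'
    obtain ⟨z, hz, rfl⟩ := hy'
    exact hy.2 (by simpa using hz)
  have hsub : ((ball l r).filter (fun y => y - x ∉ ball l r)) ∪
      ((ball l r).image (fun y => y + x)) ⊆ ball l (r + h) := by
    intro y hy
    rcases Finset.mem_union.1 hy with hy | hy
    · exact ball_mono l (by linarith) (Finset.mem_filter.1 hy).1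
    · obtain ⟨z, hz, rfl⟩ := Finset.mem_image.1 hy
      exact add_mem_ball hl hz hx
  have h1 := Finset.card_le_card hsub
  rw [Finset.card_union_of_disjoint hdis, Finset.card_image_of_injective _ (add_left_injective x)] at h1
  have h2 : (((ball l r).filter (fun y => y - x ∉ ball l r)).card : ℝ) + (ball l r).card ≤
    (ball l (r + h)).card := by exact_mod_cast h1
  linarith

end KM


namespace KM
open Finset

variable {G : Type} [AddCommGroup G] [Fintype G] [DecidableEq G]

lemma char_neg_conj (χ : AddChar G ℂ) (x : G) : χ (-x) = (starRingEnd ℂ) (χ x) := by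
  rw [AddChar.map_neg_eq_inv, Complex.inv_eq_conj (by simp)]

def Rep (g h : G → ℂ) : Prop :=
  ∃ (ι : Type) (_ : Fintype ι) (χ : ι → AddChar G ℂ) (a : ι → ℂ) (b : ι → ℝ),
    (∀ i, ‖a i‖ ≤ b i) ∧ (∀ x, g x = ∑ i, a i * χ i x) ∧ (∀ x, h x = ∑ i, (b i : ℂ) * χ i x)

lemma Rep.mul {g h g' h' : G → ℂ} (H : Rep g h) (H' : Rep g' h') :
    Rep (fun x => g x * g' x) (fun x => h x * h' x) := by
  obtain ⟨ι, _, χ, a, b, h1, h2, h3⟩ := H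
  obtain ⟨ι', _, χ', a', b', h1', h2', h3'⟩ := H'
  refine ⟨ι × ι', inferInstance, fun i => χ i.1 + χ' i.2, fun i => a i.1 * a' i.2,
    fun i => b i.1 * b' i.2, ?_, ?_, ?_⟩
  · intro i; rw [norm_mul]
    exact mul_le_mul (h1 _) (h1' _) (norm_nonneg _) ((norm_nonneg _).trans (h1 _))
  · intro x
    beta_reduce
    rw [h2, h2', Finset.sum_mul_sum, Fintype.sum_prod_type]
    refine Finset.sum_congr rfl fun i _ => Finset.sum_congr rfl fun j _ => ?_
    simp only [AddChar.add_apply]; ring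
  · intro x
    beta_reduce
    rw [h3, h3', Finset.sum_mul_sum, Fintype.sum_prod_type]
    refine Finset.sum_congr rfl fun i _ => Finset.sum_congr rfl fun j _ => ?_
    simp only [AddChar.add_apply]; push_cast; ring

lemma Rep.one : Rep (fun _ : G => 1) (fun _ => 1) := by
  refine ⟨Unit, inferInstance, fun _ => 0, fun _ => 1, fun _ => 1, ?_, ?_, ?_⟩ <;> simp

lemma Rep.pow {g h : G → ℂ} (H : Rep g h) (n : ℕ) :
    Rep (fun x => g x ^ n) (fun x => h x ^ n) := by
  induction n with
  | zero => simpa using Rep.one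
  | succ n ih => simpa only [pow_succ] using ih.mul H

lemma Rep.self {g h : G → ℂ} (H : Rep g h) : Rep h h := by
  obtain ⟨ι, _, χ, a, b, h1, h2, h3⟩ := H
  refine ⟨ι, inferInstance, χ, fun i => b i, b, ?_, h3, h3⟩
  intro i
  have := (norm_nonneg _).trans (h1 i)
  simp [abs_of_nonneg this]

lemma sum_sub_char (B : Finset G) (χ : AddChar G ℂ) :
    ∑ b ∈ B, ∑ b' ∈ B, χ (b - b') = ((‖∑ b ∈ B, χ b‖ ^ 2 : ℝ) : ℂ) := by
  have h : ∑ b ∈ B, ∑ b' ∈ B, χ (b - b') = (∑ b ∈ B, χ b) * (starRingEnd ℂ) (∑ b ∈ B, χ b) := by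
    rw [map_sum, Finset.sum_mul_sum]
    refine Finset.sum_congr rfl fun i _ => Finset.sum_congr rfl fun j _ => ?_
    rw [sub_eq_add_neg, AddChar.map_add_eq_mul, char_neg_conj]
  rw [h, Complex.mul_conj, Complex.normSq_eq_norm_sq]

lemma Rep.sum_le {g h : G → ℂ} (H : Rep g h) (B : Finset G) :
    ‖∑ b ∈ B, ∑ b' ∈ B, g (b - b')‖ ≤ (∑ b ∈ B, ∑ b' ∈ B, h (b - b')).re := by
  obtain ⟨ι, _, χ, a, b, h1, h2, h3⟩ := H
  have e1 : ∑ x ∈ B, ∑ y ∈ B, g (x - y) = ∑ i, a i * ((‖∑ x ∈ B, χ i x‖ ^ 2 : ℝ) : ℂ) := by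
    simp_rw [h2]
    simp_rw [← sum_sub_char, Finset.mul_sum]
    exact (Finset.sum_congr rfl fun x _ => Finset.sum_comm).trans Finset.sum_comm
  have e2 : ∑ x ∈ B, ∑ y ∈ B, h (x - y) = ∑ i, (b i : ℂ) * ((‖∑ x ∈ B, χ i x‖ ^ 2 : ℝ) : ℂ) := by
    simp_rw [h3]
    simp_rw [← sum_sub_char, Finset.mul_sum]
    exact (Finset.sum_congr rfl fun x _ => Finset.sum_comm).trans Finset.sum_comm
  rw [e1, e2]
  refine (norm_sum_le _ _).trans ?_
  rw [Complex.re_sum]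
  refine Finset.sum_le_sum fun i _ => ?_
  rw [← Complex.ofReal_mul, Complex.ofReal_re, norm_mul, Complex.norm_real, Real.norm_of_nonneg (by positivity)]
  exact mul_le_mul_of_nonneg_right (h1 i) (by positivity)

noncomputable def ft (f : G → ℝ) (ψ : AddChar G ℂ) : ℂ := ∑ y, (f y : ℂ) * ψ (-y)

lemma inversion_conv (f : G → ℝ) (x : G) :
    ((∑ y, f y * f (x - y) : ℝ) : ℂ) =
      ∑ ψ : AddChar G ℂ, (ft f ψ ^ 2 / (Fintype.card G : ℂ)) * ψ x := by
  have hG : (Fintype.card G : ℂ) ≠ 0 := by simp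
  have e : ∀ ψ : AddChar G ℂ, ft f ψ ^ 2 * ψ x = ∑ y, ∑ z, (f y : ℂ) * f z * ψ (x - y - z) := by
    intro ψ
    rw [sq, ft, Finset.sum_mul_sum, Finset.sum_mul]
    refine Finset.sum_congr rfl fun y _ => ?_
    rw [Finset.sum_mul]
    refine Finset.sum_congr rfl fun z _ => ?_
    rw [sub_eq_add_neg, sub_eq_add_neg, AddChar.map_add_eq_mul, AddChar.map_add_eq_mul]; ring
  simp_rw [div_mul_eq_mul_div, e]
  rw [← Finset.sum_div, eq_div_iff hG, Finset.sum_comm]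
  simp_rw [Finset.sum_comm (s := (univ : Finset (AddChar G ℂ))) (t := (univ : Finset G))]
  simp_rw [← Finset.mul_sum, AddChar.sum_apply_eq_ite]
  push_cast
  rw [Finset.sum_mul]
  refine Finset.sum_congr rfl fun y _ => ?_
  rw [Finset.sum_eq_single (x - y)]
  · simp
  · intro z _ hz; rw [if_neg]; · simp
    intro h; exact hz (sub_eq_zero.1 h).symm
  · simp

lemma inversion_corr (f : G → ℝ) (x : G) :
    ((∑ y, f y * f (y + x) : ℝ) : ℂ) =
      ∑ ψ : AddChar G ℂ, ((‖ft f ψ‖ ^ 2 / (Fintype.card G) : ℝ) : ℂ) * ψ x := by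
  have hG : (Fintype.card G : ℂ) ≠ 0 := by simp
  have e : ∀ ψ : AddChar G ℂ, ((‖ft f ψ‖ ^ 2 : ℝ) : ℂ) * ψ x = ∑ y, ∑ z, (f y : ℂ) * f z * ψ (y + x - z) := by
    intro ψ
    rw [← Complex.normSq_eq_norm_sq, ← Complex.mul_conj, mul_comm (ft f ψ), ft, map_sum, Finset.sum_mul_sum, Finset.sum_mul]
    refine Finset.sum_congr rfl fun y _ => ?_
    rw [Finset.sum_mul]
    refine Finset.sum_congr rfl fun z _ => ?_
    rw [sub_eq_add_neg, AddChar.map_add_eq_mul, AddChar.map_add_eq_mul, map_mul, ← char_neg_conj, Complex.conj_ofReal, neg_neg]; ring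
  push_cast at e ⊢
  simp_rw [div_mul_eq_mul_div, e]
  rw [← Finset.sum_div, eq_div_iff hG, Finset.sum_comm]
  simp_rw [Finset.sum_comm (s := (univ : Finset (AddChar G ℂ))) (t := (univ : Finset G))]
  simp_rw [← Finset.mul_sum, AddChar.sum_apply_eq_ite]
  rw [Finset.sum_mul]
  refine Finset.sum_congr rfl fun y _ => ?_
  rw [Finset.sum_eq_single (y + x)]
  · simp
  · intro z _ hz; rw [if_neg]; · simp
    intro h; exact hz (sub_eq_zero.1 h).symm
  · simp

lemma rep_conv (f : G → ℝ) :
    Rep (fun x => ((∑ y, f y * f (x - y) : ℝ) : ℂ)) (fun x => ((∑ y, f y * f (y + x) : ℝ) : ℂ)) := by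
  refine ⟨AddChar G ℂ, inferInstance, fun ψ => ψ, fun ψ => ft f ψ ^ 2 / (Fintype.card G : ℂ),
    fun ψ => ‖ft f ψ‖ ^ 2 / (Fintype.card G), ?_, inversion_conv f, inversion_corr f⟩
  intro ψ; simp

lemma corr_pow_nonneg (f : G → ℝ) (B : Finset G) (n : ℕ) :
    0 ≤ ∑ b ∈ B, ∑ b' ∈ B, (∑ y, f y * f (y + (b - b'))) ^ n := by
  have h := (((rep_conv f).self).pow n).sum_le B
  have h2 := (norm_nonneg _).trans h
  have : (∑ b ∈ B, ∑ b' ∈ B, ((∑ y, f y * f (y + (b - b')) : ℝ) : ℂ) ^ n) =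
    ((∑ b ∈ B, ∑ b' ∈ B, (∑ y, f y * f (y + (b - b'))) ^ n : ℝ) : ℂ) := by push_cast; rfl
  rw [this, Complex.ofReal_re] at h2
  exact h2

lemma conv_pow_le (f : G → ℝ) (B : Finset G) (n : ℕ) :
    ∑ b ∈ B, ∑ b' ∈ B, (∑ y, f y * f (b - b' - y)) ^ n ≤
    ∑ b ∈ B, ∑ b' ∈ B, (∑ y, f y * f (y + (b - b'))) ^ n := by
  have h := (((rep_conv f)).pow n).sum_le B
  have e1 : (∑ b ∈ B, ∑ b' ∈ B, ((∑ y, f y * f (y + (b - b')) : ℝ) : ℂ) ^ n) =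
    ((∑ b ∈ B, ∑ b' ∈ B, (∑ y, f y * f (y + (b - b'))) ^ n : ℝ) : ℂ) := by push_cast; rfl
  have e2 : (∑ b ∈ B, ∑ b' ∈ B, ((∑ y, f y * f (b - b' - y) : ℝ) : ℂ) ^ n) =
    ((∑ b ∈ B, ∑ b' ∈ B, (∑ y, f y * f (b - b' - y)) ^ n : ℝ) : ℂ) := by push_cast; rfl
  rw [e1, e2, Complex.ofReal_re, Complex.norm_real] at h
  exact (le_abs_self _).trans h

lemma unbalance (f : G → ℝ) (B : Finset G) (p q : ℕ) (hpq : p ≤ q) {c : ℝ} (hc : 0 ≤ c) :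
    (q.choose p : ℝ) * ∑ b ∈ B, ∑ b' ∈ B, (c * ∑ y, f y * f (b - b' - y)) ^ p ≤
    ∑ b ∈ B, ∑ b' ∈ B, (1 + c * ∑ y, f y * f (y + (b - b'))) ^ q := by
  have e : ∑ b ∈ B, ∑ b' ∈ B, (1 + c * ∑ y, f y * f (y + (b - b'))) ^ q =
      ∑ j ∈ range (q + 1), (q.choose j : ℝ) *
        (c ^ j * ∑ b ∈ B, ∑ b' ∈ B, (∑ y, f y * f (y + (b - b'))) ^ j) := by
    simp_rw [add_comm (1:ℝ), add_pow, one_pow, mul_one, Finset.mul_sum (s := B)]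
    refine ((Finset.sum_congr rfl fun x _ => Finset.sum_comm).trans Finset.sum_comm).trans ?_
    refine Finset.sum_congr rfl fun j _ => Finset.sum_congr rfl fun b _ =>
      Finset.sum_congr rfl fun b' _ => ?_
    rw [mul_pow]; ring
  rw [e]
  have hp : p ∈ range (q + 1) := by simp; omega
  refine le_trans ?_ (Finset.single_le_sum (f := fun j => (q.choose j : ℝ) *
        (c ^ j * ∑ b ∈ B, ∑ b' ∈ B, (∑ y, f y * f (y + (b - b'))) ^ j)) ?_ hp)
  · simp_rw [mul_pow, ← Finset.mul_sum]
    exact mul_le_mul_of_nonneg_left (mul_le_mul_of_nonneg_left (conv_pow_le f B p) (by positivity)) (by positivity)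
  · intro j _
    have := corr_pow_nonneg f B j
    positivity

lemma choose_lower (p K : ℕ) : K ^ p ≤ (K * p).choose p := by
  induction p with
  | zero => simp
  | succ p ih =>
    rcases Nat.eq_zero_or_pos K with rfl | hK
    · simp
    obtain ⟨n, hn⟩ : ∃ n, K * (p + 1) = n + 1 := ⟨K * (p + 1) - 1, by
      have : 0 < K * (p + 1) := by positivity
      omega⟩
    have h1 := Nat.add_one_mul_choose_eq n p
    have h2 : K * n.choose p = (n + 1).choose (p + 1) := by
      apply Nat.eq_of_mul_eq_mul_right (Nat.succ_pos p)
      rw [Nat.succ_eq_add_one, ← h1, ← hn]; ring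
    rw [hn, ← h2, pow_succ, mul_comm]
    have h3 : K * p ≤ n := by nlinarith
    exact Nat.mul_le_mul_left K (ih.trans (Nat.choose_le_choose p h3))

end KM


namespace KM
open Finset

variable {G : Type} [AddCommGroup G] [Fintype G] [DecidableEq G]

def R (A : Finset G) (x : G) : ℕ := (A.filter (fun y => y + x ∈ A)).card

lemma card_fun_filter (q : ℕ) (P : G → Prop) [DecidablePred P] :
    ((univ : Finset (Fin q → G)).filter (fun s => ∀ i, P (s i))).card
      = ((univ : Finset G).filter P).card ^ q := by
  have : (univ : Finset (Fin q → G)).filter (fun s => ∀ i, P (s i)) =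
      Fintype.piFinset (fun _ : Fin q => (univ : Finset G).filter P) := by
    ext s; simp
  rw [this, Fintype.card_piFinset_const]

lemma R_eq (A : Finset G) (b b' : G) :
    ((univ : Finset G).filter (fun g => b + g ∈ A ∧ b' + g ∈ A)).card = R A (b - b') := by
  unfold R
  refine Finset.card_bij' (fun g _ => b' + g) (fun y _ => y - b') ?_ ?_ ?_ ?_
  · intro g hg; simp only [mem_filter, mem_univ, true_and] at hg ⊢
    refine ⟨hg.2, ?_⟩; convert hg.1 using 1; abel
  · intro y hy; simp only [mem_filter, mem_univ, true_and] at hy ⊢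
    refine ⟨?_, ?_⟩
    · convert hy.2 using 1; abel
    · convert hy.1 using 1; abel
  · intro g _; simp
  · intro g _; simp

def sft (A B : Finset G) {q : ℕ} (s : Fin q → G) : Finset G := B.filter (fun b => ∀ i, b + s i ∈ A)

lemma sft_sum (A B : Finset G) (q : ℕ) (w : G → G → ℝ) :
    ∑ s : Fin q → G, ∑ b ∈ sft A B s, ∑ b' ∈ sft A B s, w b b' =
      ∑ b ∈ B, ∑ b' ∈ B, w b b' * (R A (b - b') : ℝ) ^ q := by
  have h1 : ∀ s : Fin q → G, ∑ b ∈ sft A B s, ∑ b' ∈ sft A B s, w b b' =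
      ∑ b ∈ B, ∑ b' ∈ B, if (∀ i, b + s i ∈ A ∧ b' + s i ∈ A) then w b b' else 0 := by
    intro s
    unfold sft
    rw [Finset.sum_filter]
    refine Finset.sum_congr rfl fun b _ => ?_
    split_ifs with hb
    · rw [Finset.sum_filter]
      refine Finset.sum_congr rfl fun b' _ => ?_
      by_cases hb' : ∀ i, b' + s i ∈ A
      · rw [if_pos hb', if_pos (fun i => ⟨hb i, hb' i⟩)]
      · rw [if_neg hb', if_neg (fun h => hb' fun i => (h i).2)]
    · symm; apply Finset.sum_eq_zero; intro b' _
      rw [if_neg (fun h => hb fun i => (h i).1)]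
  simp_rw [h1]
  rw [Finset.sum_comm]
  refine Finset.sum_congr rfl fun b _ => ?_
  rw [Finset.sum_comm]
  refine Finset.sum_congr rfl fun b' _ => ?_
  rw [← Finset.sum_filter, Finset.sum_const, nsmul_eq_mul, mul_comm,
    card_fun_filter q (fun g => b + g ∈ A ∧ b' + g ∈ A), R_eq]
  push_cast; rfl

lemma sft_card (A B : Finset G) (q : ℕ) :
    ∑ s : Fin q → G, ((sft A B s).card : ℝ) = B.card * (A.card : ℝ) ^ q := by
  have h1 : ∀ s : Fin q → G, ((sft A B s).card : ℝ) =
      ∑ b ∈ B, if (∀ i, b + s i ∈ A) then (1:ℝ) else 0 := by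
    intro s; unfold sft; rw [← Finset.sum_filter]; simp
  simp_rw [h1]
  rw [Finset.sum_comm, Finset.card_eq_sum_ones, Nat.cast_sum, Finset.sum_mul]
  refine Finset.sum_congr rfl fun b _ => ?_
  rw [← Finset.sum_filter, Finset.sum_const, nsmul_eq_mul,
    card_fun_filter q (fun g => b + g ∈ A)]
  have : ((univ : Finset G).filter (fun g => b + g ∈ A)).card = A.card := by
    refine Finset.card_bij' (fun g _ => b + g) (fun y _ => y - b) ?_ ?_ ?_ ?_ <;> simp
  rw [this]; push_cast; ring

lemma sift (A B S : Finset G) (q : ℕ) {δ κ : ℝ} (hδ : 0 < δ) (hδ2 : δ ≤ 1 / 2) (hκ : 0 < κ)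
    (hpos : 0 < ∑ b ∈ B, ∑ b' ∈ B, (R A (b - b') : ℝ) ^ q)
    (hbad : ∑ b ∈ B, ∑ b' ∈ B, (if b - b' ∈ S then 0 else (R A (b - b') : ℝ) ^ q) ≤
      δ * ∑ b ∈ B, ∑ b' ∈ B, (R A (b - b') : ℝ) ^ q)
    (hsm : κ * (B.card : ℝ) ^ 2 * (A.card : ℝ) ^ q ≤ δ * ∑ b ∈ B, ∑ b' ∈ B, (R A (b - b') : ℝ) ^ q) :
    ∃ A' ⊆ B, A'.Nonempty ∧ κ * B.card ≤ A'.card ∧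
      ∑ a ∈ A', ∑ a' ∈ A', (if a - a' ∈ S then (0:ℝ) else 1) ≤ 4 * δ * (A'.card : ℝ) ^ 2 := by
  set Tot := ∑ b ∈ B, ∑ b' ∈ B, (R A (b - b') : ℝ) ^ q with hTot
  by_contra hcon
  push Not at hcon
  have hBne : B.Nonempty := by
    rw [Finset.nonempty_iff_ne_empty]; rintro rfl; simp [hTot] at hpos
  have hBpos : (0:ℝ) < B.card := by exact_mod_cast hBne.card_pos
  have key : ∀ s : Fin q → G, 4 * δ * ((sft A B s).card : ℝ) ^ 2 ≤
      ∑ a ∈ sft A B s, ∑ a' ∈ sft A B s, (if a - a' ∈ S then (0:ℝ) else 1) +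
        4 * δ * (κ * B.card) * (sft A B s).card := by
    intro s
    have hb : 0 ≤ ∑ a ∈ sft A B s, ∑ a' ∈ sft A B s, (if a - a' ∈ S then (0:ℝ) else 1) :=
      Finset.sum_nonneg fun _ _ => Finset.sum_nonneg fun _ _ => by split_ifs <;> simp
    rcases le_or_gt (κ * B.card) (sft A B s).card with h | h
    · have hne : (sft A B s).Nonempty := by
        rw [← Finset.card_pos]
        have : (0:ℝ) < (sft A B s).card := lt_of_lt_of_le (by positivity) h
        exact_mod_cast this
      have := hcon (sft A B s) (Finset.filter_subset _ _) hne h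
      have h2 : 0 ≤ 4 * δ * (κ * B.card) * (sft A B s).card := by positivity
      linarith
    · have : ((sft A B s).card : ℝ) ^ 2 ≤ (κ * B.card) * (sft A B s).card := by
        rw [sq]; exact mul_le_mul_of_nonneg_right h.le (by positivity)
      nlinarith
  have hsum := Finset.sum_le_sum fun (s : Fin q → G) (_ : s ∈ univ) => key s
  rw [Finset.sum_add_distrib, ← Finset.mul_sum, ← Finset.mul_sum, sft_card, sft_sum] at hsum
  have e1 : ∑ s : Fin q → G, ((sft A B s).card : ℝ) ^ 2 = Tot := by
    have := sft_sum A B q (fun _ _ => 1)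
    simp only [one_mul] at this
    rw [hTot, ← this]
    refine Finset.sum_congr rfl fun s _ => ?_
    simp [sq]
  have e2 : ∑ b ∈ B, ∑ b' ∈ B, (if b - b' ∈ S then (0:ℝ) else 1) * (R A (b - b') : ℝ) ^ q =
      ∑ b ∈ B, ∑ b' ∈ B, (if b - b' ∈ S then 0 else (R A (b - b') : ℝ) ^ q) := by
    refine Finset.sum_congr rfl fun b _ => Finset.sum_congr rfl fun b' _ => ?_
    split_ifs <;> simp
  rw [e1, e2] at hsum
  have h3 : 4 * δ * (κ * B.card) * (B.card * (A.card : ℝ) ^ q) ≤ 4 * δ * (δ * Tot) := by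
    have : 4 * δ * (κ * B.card) * (B.card * (A.card : ℝ) ^ q) = 4 * δ * (κ * (B.card : ℝ) ^ 2 * (A.card : ℝ) ^ q) := by ring
    rw [this]; exact mul_le_mul_of_nonneg_left hsm (by positivity)
  have h4 : 4 * δ * Tot ≤ δ * Tot + 4 * δ * (δ * Tot) := by linarith
  have h5 : 0 < δ * Tot := by positivity
  nlinarith

end KM


namespace KM
open Finset

variable {G : Type} [AddCommGroup G] [Fintype G] [DecidableEq G]

lemma hoeff_one (A : Finset G) (Z : G → ℝ) (hZ : ∀ a ∈ A, |Z a| ≤ 1) (h0 : ∑ a ∈ A, Z a = 0)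
    {ε : ℝ} (hε : 0 < ε) (hε1 : ε ≤ 1) (m : ℕ) :
    (((Fintype.piFinset (fun _ : Fin m => A)).filter (fun a => m * ε < ∑ i, Z (a i))).card : ℝ) ≤
      Real.exp (-(m * ε ^ 2 / 4)) * (A.card : ℝ) ^ m := by
  set lam := ε / 2 with hlam
  have h1 : ∑ a ∈ Fintype.piFinset (fun _ : Fin m => A), Real.exp (lam * ∑ i, Z (a i)) =
      (∑ a ∈ A, Real.exp (lam * Z a)) ^ m := by
    rw [← Fin.prod_const, Finset.prod_univ_sum]
    refine Finset.sum_congr rfl fun a _ => ?_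
    rw [Finset.mul_sum, Real.exp_sum]
  have h2 : ∑ a ∈ A, Real.exp (lam * Z a) ≤ A.card * Real.exp (lam ^ 2) := by
    calc ∑ a ∈ A, Real.exp (lam * Z a) ≤ ∑ a ∈ A, (1 + lam * Z a + lam ^ 2) := by
          refine Finset.sum_le_sum fun a ha => ?_
          have hz : |lam * Z a| ≤ lam := by
            rw [abs_mul, abs_of_pos (by positivity)]
            exact mul_le_of_le_one_right (by positivity) (hZ a ha)
          have h := Real.abs_exp_sub_one_sub_id_le (x := lam * Z a) (hz.trans (by linarith))
          have h' := (abs_le.1 h).2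
          have h3 : (lam * Z a) ^ 2 ≤ lam ^ 2 := sq_le_sq.2 (by rwa [abs_of_pos (show 0 < lam by positivity)])
          linarith
      _ = A.card * (1 + lam ^ 2) := by
          rw [Finset.sum_add_distrib, Finset.sum_add_distrib, ← Finset.mul_sum, h0]; simp; ring
      _ ≤ _ := by
          gcongr
          linarith [Real.add_one_le_exp (lam ^ 2)]
  have h3 : (((Fintype.piFinset (fun _ : Fin m => A)).filter (fun a => m * ε < ∑ i, Z (a i))).card : ℝ)
      * Real.exp (lam * (m * ε)) ≤ ∑ a ∈ Fintype.piFinset (fun _ : Fin m => A), Real.exp (lam * ∑ i, Z (a i)) := by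
    rw [← nsmul_eq_mul, ← Finset.sum_const]
    refine le_trans ?_ (Finset.sum_le_sum_of_subset_of_nonneg (Finset.filter_subset (fun a => m * ε < ∑ i, Z (a i)) _) (fun _ _ _ => (Real.exp_pos _).le))
    refine Finset.sum_le_sum fun a ha => ?_
    rw [Real.exp_le_exp]
    exact mul_le_mul_of_nonneg_left (Finset.mem_filter.1 ha).2.le (by positivity)
  have h4 : (∑ a ∈ A, Real.exp (lam * Z a)) ^ m ≤ (A.card * Real.exp (lam ^ 2)) ^ m :=
    pow_le_pow_left₀ (Finset.sum_nonneg fun _ _ => (Real.exp_pos _).le) h2 m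
  rw [mul_pow, ← Real.exp_nat_mul] at h4
  rw [h1] at h3
  have h5 := h3.trans h4
  rw [← le_div_iff₀ (Real.exp_pos _), mul_div_assoc, ← Real.exp_sub] at h5
  refine h5.trans (le_of_eq ?_)
  rw [mul_comm]; congr 2; rw [hlam]; ring

lemma hoeff (A : Finset G) (Z : G → ℝ) (hZ : ∀ a ∈ A, |Z a| ≤ 1) (h0 : ∑ a ∈ A, Z a = 0)
    {ε : ℝ} (hε : 0 < ε) (hε1 : ε ≤ 1) (m : ℕ) :
    (((Fintype.piFinset (fun _ : Fin m => A)).filter (fun a => m * ε < |∑ i, Z (a i)|)).card : ℝ) ≤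
      2 * Real.exp (-(m * ε ^ 2 / 4)) * (A.card : ℝ) ^ m := by
  have h1 := hoeff_one A Z hZ h0 hε hε1 m
  have h2 := hoeff_one A (fun a => - Z a) (by simpa using hZ) (by simpa using h0) hε hε1 m
  have hsub : (Fintype.piFinset (fun _ : Fin m => A)).filter (fun a => m * ε < |∑ i, Z (a i)|) ⊆
      (Fintype.piFinset (fun _ : Fin m => A)).filter (fun a => m * ε < ∑ i, Z (a i)) ∪
      (Fintype.piFinset (fun _ : Fin m => A)).filter (fun a => m * ε < ∑ i, - Z (a i)) := by
    intro a ha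
    rw [Finset.mem_filter] at ha
    rw [Finset.mem_union, Finset.mem_filter, Finset.mem_filter, Finset.sum_neg_distrib]
    rcases lt_abs.1 ha.2 with h | h
    · exact Or.inl ⟨ha.1, h⟩
    · exact Or.inr ⟨ha.1, h⟩
  have h3 := (Finset.card_le_card hsub).trans (Finset.card_union_le _ _)
  have h4 := (Nat.cast_le (α := ℝ)).2 h3
  push_cast at h4
  linarith

noncomputable def gg (A S : Finset G) (v : G) : ℝ := (∑ a ∈ A, if v - a ∈ S then (1:ℝ) else 0) / A.card

noncomputable def PP (A S : Finset G) (u : G) : ℝ :=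
  ∑ a ∈ A, ∑ a' ∈ A, if a + u - a' ∈ S then (1:ℝ) else 0

lemma gg_nonneg (A S : Finset G) (v : G) : 0 ≤ gg A S v := by
  unfold gg
  exact div_nonneg (Finset.sum_nonneg fun _ _ => by split_ifs <;> simp) (by positivity)

lemma gg_le_one (A S : Finset G) (v : G) : gg A S v ≤ 1 := by
  unfold gg
  apply div_le_one_of_le₀ _ (by positivity)
  refine (Finset.sum_le_sum (g := fun _ => (1:ℝ)) fun _ _ => by split_ifs <;> simp).trans (by simp)

lemma PP_eq (A S : Finset G) (hA : A.Nonempty) (u : G) :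
    PP A S u = A.card * ∑ a ∈ A, gg A S (a + u) := by
  have : (A.card : ℝ) ≠ 0 := by exact_mod_cast hA.card_pos.ne'
  unfold PP gg
  rw [← Finset.sum_div]; field_simp

lemma croot_sisask (A S X B : Finset G) (hA : A.Nonempty) {ε θ : ℝ} (hε : 0 < ε) (hε1 : ε ≤ 1)
    (hθ : 0 < θ) (m : ℕ) (hm : 0 < m)
    (hX : 4 * Real.exp (-(m * ε ^ 2 / 4)) * X.card ≤ θ * A.card)
    (hAB : ∀ a ∈ A, ∀ t ∈ B, a + t ∈ X) :
    ∃ T ⊆ B, (A.card : ℝ) ^ m * B.card ≤ 2 * (X.card : ℝ) ^ m * T.card ∧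
      ∀ t ∈ T, ∀ t' ∈ T, ∀ u, (∀ a ∈ A, a + u ∈ X) → (∀ a ∈ A, a + (u + (t - t')) ∈ X) →
        PP A S u - 2 * (ε + θ) * (A.card : ℝ) ^ 2 ≤ PP A S (u + (t - t')) := by
  have hApos : (0:ℝ) < A.card := by exact_mod_cast hA.card_pos
  have hmpos : (0:ℝ) < m := by exact_mod_cast hm
  let Z : G → G → ℝ := fun v a => (if v - a ∈ S then (1:ℝ) else 0) - gg A S v
  have hZ1 : ∀ v a, |Z v a| ≤ 1 := by
    intro v a
    have h1 := gg_nonneg A S v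
    have h2 := gg_le_one A S v
    simp only [Z]
    rw [abs_le]; split_ifs <;> constructor <;> linarith
  have hZ0 : ∀ v, ∑ a ∈ A, Z v a = 0 := by
    intro v
    simp only [Z]
    rw [Finset.sum_sub_distrib, Finset.sum_const, nsmul_eq_mul]
    unfold gg
    rw [mul_div_cancel₀ _ hApos.ne', sub_self]
  let Bad : (Fin m → G) → Finset G := fun a => X.filter (fun v => m * ε < |∑ i, Z v (a i)|)
  let Om := Fintype.piFinset (fun _ : Fin m => A)
  have hOm : (Om.card : ℝ) = (A.card : ℝ) ^ m := by simp [Om]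
  let Gd := Om.filter (fun a => ((Bad a).card : ℝ) ≤ θ * A.card)
  have hsumbad : ∑ a ∈ Om, ((Bad a).card : ℝ) ≤ X.card * (2 * Real.exp (-(m * ε ^ 2 / 4)) * (A.card : ℝ) ^ m) := by
    have e : ∀ a, ((Bad a).card : ℝ) = ∑ v ∈ X, if m * ε < |∑ i, Z v (a i)| then (1:ℝ) else 0 := by
      intro a; simp only [Bad]; rw [← Finset.sum_filter]; simp
    simp_rw [e]
    rw [Finset.sum_comm, ← nsmul_eq_mul (X.card), ← Finset.sum_const]
    refine Finset.sum_le_sum fun v _ => ?_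
    rw [← Finset.sum_filter]
    simpa using hoeff A (Z v) (fun a _ => hZ1 v a) (hZ0 v) hε hε1 m
  have hGd : (A.card : ℝ) ^ m ≤ 2 * Gd.card := by
    have h1 : ∑ a ∈ Om, θ * A.card ≤ ∑ a ∈ Om, ((Bad a).card : ℝ) + ∑ a ∈ Gd, θ * A.card := by
      rw [Finset.sum_filter, ← Finset.sum_add_distrib]
      refine Finset.sum_le_sum fun a _ => ?_
      split_ifs with h
      · have : (0:ℝ) ≤ (Bad a).card := by positivity
        linarith
      · push Not at h; linarith
    simp only [Finset.sum_const, nsmul_eq_mul] at h1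
    rw [hOm] at h1
    have h2 : (X.card : ℝ) * (2 * Real.exp (-(m * ε ^ 2 / 4)) * (A.card : ℝ) ^ m) ≤ (θ * A.card / 2) * (A.card : ℝ) ^ m := by
      have := mul_le_mul_of_nonneg_right hX (show 0 ≤ (A.card : ℝ) ^ m / 2 by positivity)
      nlinarith
    have h3 : (A.card : ℝ) ^ m * (θ * A.card) ≤ (2 * Gd.card) * (θ * A.card) := by nlinarith
    exact le_of_mul_le_mul_right h3 (by positivity)
  let Y := Fintype.piFinset (fun _ : Fin m => X)
  have hY : (Y.card : ℝ) = (X.card : ℝ) ^ m := by simp [Y]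
  let Ty : (Fin m → G) → Finset G := fun y => B.filter (fun t => (fun i => y i - t) ∈ Gd)
  have hcount : (Gd.card : ℝ) * B.card ≤ ∑ y ∈ Y, ((Ty y).card : ℝ) := by
    have hmap : ∀ z ∈ Gd ×ˢ B, (fun i => z.1 i + z.2) ∈ Y := by
      intro z hz
      rw [Finset.mem_product] at hz
      rw [Fintype.mem_piFinset]
      intro i
      exact hAB _ (Fintype.mem_piFinset.1 (Finset.mem_filter.1 hz.1).1 i) _ hz.2
    have h1 := Finset.card_eq_sum_card_fiberwise hmap
    rw [Finset.card_product] at h1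
    have h2 : (Gd.card : ℝ) * B.card = ∑ y ∈ Y, (((Gd ×ˢ B).filter (fun z => (fun i => z.1 i + z.2) = y)).card : ℝ) := by
      exact_mod_cast h1
    rw [h2]
    refine Finset.sum_le_sum fun y _ => ?_
    norm_cast
    refine Finset.card_le_card_of_injOn (fun z => z.2) ?_ ?_
    · intro z hz
      simp only [Finset.coe_filter, Finset.mem_product, Set.mem_setOf_eq] at hz
      simp only [Ty, Finset.coe_filter, Set.mem_setOf_eq]
      refine ⟨hz.1.2, ?_⟩
      have : (fun i => y i - z.2) = z.1 := by rw [← hz.2]; ext i; simp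
      rw [this]; exact hz.1.1
    · intro z hz z' hz' h
      simp only [Finset.coe_filter, Finset.mem_product, Set.mem_setOf_eq] at hz hz'
      have h' : z.2 = z'.2 := h
      refine Prod.ext ?_ h'
      ext i
      have := congrFun (hz.2.trans hz'.2.symm) i
      simp only [h'] at this
      exact add_right_cancel this
  have hex : ∃ y, (A.card : ℝ) ^ m * B.card ≤ 2 * (X.card : ℝ) ^ m * (Ty y).card := by
    by_contra hcon
    push Not at hcon
    by_cases hYe : Y = ∅
    · rw [hYe, Finset.sum_empty] at hcount
      have h0 := hcon (fun _ => 0)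
      have : (0:ℝ) ≤ 2 * (X.card : ℝ) ^ m * (Ty (fun _ => 0)).card := by positivity
      have h5 : (A.card : ℝ) ^ m * B.card ≤ 2 * Gd.card * B.card := mul_le_mul_of_nonneg_right hGd (by positivity)
      nlinarith
    · have hYne := Finset.nonempty_iff_ne_empty.2 hYe
      have h1 := Finset.sum_lt_sum_of_nonempty hYne (fun y _ => hcon y)
      rw [← Finset.mul_sum, Finset.sum_const, nsmul_eq_mul, hY] at h1
      have h5 : (A.card : ℝ) ^ m * B.card ≤ 2 * Gd.card * B.card := mul_le_mul_of_nonneg_right hGd (by positivity)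
      have hYp : (0:ℝ) < (X.card : ℝ) ^ m := by rw [← hY]; exact_mod_cast hYne.card_pos
      have h6 : 2 * (X.card : ℝ) ^ m * ∑ y ∈ Y, ((Ty y).card : ℝ) ≥ 2 * (X.card : ℝ) ^ m * (Gd.card * B.card) := 
        mul_le_mul_of_nonneg_left hcount (by positivity)
      nlinarith
  obtain ⟨y, hy⟩ := hex
  refine ⟨Ty y, Finset.filter_subset _ _, hy, ?_⟩
  have happ : ∀ t ∈ Ty y, ∀ v ∈ X, v ∉ Bad (fun i => y i - t) →
      |(∑ i, if (v + t) - y i ∈ S then (1:ℝ) else 0) - m * gg A S v| ≤ m * ε := by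
    intro t ht v hv hb
    simp only [Bad, Finset.mem_filter, not_and, not_lt] at hb
    have := hb hv
    simp only [Z] at this
    rw [Finset.sum_sub_distrib] at this
    simp only [Finset.sum_const, card_univ, Fintype.card_fin, nsmul_eq_mul] at this
    have e : ∀ i, v + t - y i = v - (y i - t) := fun i => by abel
    simp_rw [e]
    exact this
  have hbadc : ∀ t ∈ Ty y, ((Bad (fun i => y i - t)).card : ℝ) ≤ θ * A.card := by
    intro t ht
    exact (Finset.mem_filter.1 (Finset.mem_filter.1 ht).2).2
  intro t ht t' ht' u hu hu'
  rw [PP_eq A S hA, PP_eq A S hA]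
  have hmain : ∑ a ∈ A, gg A S (a + u) - 2 * (ε + θ) * A.card ≤ ∑ a ∈ A, gg A S (a + (u + (t - t'))) := by
    have hpt : ∀ a ∈ A, gg A S (a + u) ≤ gg A S (a + (u + (t - t'))) + 2 * ε +
        (if a + u ∈ Bad (fun i => y i - t) then 1 else 0) +
        (if a + (u + (t - t')) ∈ Bad (fun i => y i - t') then 1 else 0) := by
      intro a ha
      have g1 := gg_nonneg A S (a + (u + (t - t')))
      have g2 := gg_le_one A S (a + u)
      by_cases c1 : a + u ∈ Bad (fun i => y i - t)
      · rw [if_pos c1]; split_ifs <;> linarith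
      by_cases c2 : a + (u + (t - t')) ∈ Bad (fun i => y i - t')
      · rw [if_pos c2]; split_ifs; linarith
      rw [if_neg c1, if_neg c2]
      have e1 := happ t ht _ (hu a ha) c1
      have e2 := happ t' ht' _ (hu' a ha) c2
      have e3 : a + (u + (t - t')) + t' = a + u + t := by abel
      rw [e3] at e2
      have f1 := (abs_le.1 e1).1
      have f2 := (abs_le.1 e2).2
      have : m * gg A S (a + u) ≤ m * (gg A S (a + (u + (t - t'))) + 2 * ε) := by linarith
      have := le_of_mul_le_mul_left this hmpos
      linarith
    have hs := Finset.sum_le_sum hpt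
    rw [Finset.sum_add_distrib, Finset.sum_add_distrib, Finset.sum_add_distrib] at hs
    have cnt : ∀ w, ∀ t ∈ Ty y, ∑ a ∈ A, (if a + w ∈ Bad (fun i => y i - t) then (1:ℝ) else 0) ≤ θ * A.card := by
      intro w t ht
      refine le_trans ?_ (hbadc t ht)
      rw [← Finset.sum_filter]
      simp only [Finset.sum_const, nsmul_eq_mul, mul_one]
      norm_cast
      refine Finset.card_le_card_of_injOn (fun a => a + w) ?_ ?_
      · intro a ha; simp only [Finset.coe_filter, Set.mem_setOf_eq] at ha; exact ha.2
      · intro a _ b _ h; exact add_right_cancel h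
    have c1 := cnt u t ht
    have c2 := cnt (u + (t - t')) t' ht'
    simp only [Finset.sum_const, nsmul_eq_mul] at hs
    linarith
  nlinarith

end KM


namespace KM
open Finset

variable {G : Type} [AddCommGroup G] [Fintype G] [DecidableEq G]

def sg : Finset ℤ := {-1, 0, 1}

lemma char_sum (χ : AddChar G ℂ) {n : ℕ} (u : Fin n → G) : χ (∑ i, u i) = ∏ i, χ (u i) := by
  induction n with
  | zero => simp
  | succ n ih => rw [Fin.sum_univ_castSucc, Fin.prod_univ_castSucc, AddChar.map_add_eq_mul, ih]

noncomputable def cmb {m : ℕ} (lam : Fin m → AddChar G ℂ) (e : Fin m → ℤ) : AddChar G ℂ :=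
  ∑ i, e i • lam i

noncomputable def hat (D : Finset G) (χ : AddChar G ℂ) : ℂ := ∑ x ∈ D, χ x

lemma hat_norm_le (D : Finset G) (χ : AddChar G ℂ) : ‖hat D χ‖ ≤ D.card := by
  unfold hat
  refine (norm_sum_le _ _).trans ?_
  simp

lemma cmb_apply {m : ℕ} (lam : Fin m → AddChar G ℂ) (e : Fin m → ℤ) (x : G) :
    cmb lam e x = ∏ i, (e i • lam i) x := by
  unfold cmb
  rw [AddChar.sum_apply]

def Dis (D : Finset G) {m : ℕ} (lam : Fin m → AddChar G ℂ) : Prop :=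
  ∀ e : Fin m → ℤ, (∀ i, e i ∈ sg) → e ≠ 0 → ‖hat D (cmb lam e)‖ < D.card / 3

noncomputable def cf (c : ℂ) (s : ℝ) (e : ℤ) : ℂ :=
  if e = 0 then 1 else if e = 1 then (s / 2 : ℝ) * c else (s / 2 : ℝ) * (starRingEnd ℂ) c

lemma cf_norm {c : ℂ} (hc : ‖c‖ = 1) {s : ℝ} (hs : 0 ≤ s) (hs1 : s ≤ 1) (e : ℤ) : ‖cf c s e‖ ≤ 1 := by
  unfold cf
  split_ifs
  · simp
  · rw [norm_mul, hc, Complex.norm_real, Real.norm_of_nonneg (by positivity)]; linarith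
  · rw [norm_mul, RCLike.norm_conj, hc, Complex.norm_real, Real.norm_of_nonneg (by positivity)]; linarith

lemma cf_expand (c : ℂ) (s : ℝ) (χ : AddChar G ℂ) (x : G) :
    ((1 + s * (c * χ x).re : ℝ) : ℂ) = ∑ e ∈ sg, cf c s e * (e • χ) x := by
  have h1 : ((-1:ℤ) • χ) x = (starRingEnd ℂ) (χ x) := by
    rw [neg_one_smul, AddChar.neg_apply, char_neg_conj]
  have : (((c * χ x).re : ℝ) : ℂ) = (c * χ x + (starRingEnd ℂ) (c * χ x)) / 2 := by
    rw [Complex.re_eq_add_conj]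
  unfold sg
  rw [Finset.sum_insert (by decide), Finset.sum_insert (by decide), Finset.sum_singleton, h1]
  simp only [cf]
  push_cast
  rw [this, map_mul]
  norm_num
  ring

lemma riesz_sum_le (D X : Finset G) {m : ℕ} (lam : Fin m → AddChar G ℂ) (hdis : Dis D lam)
    (c : Fin m → ℂ) (hc : ∀ i, ‖c i‖ = 1) {s : ℝ} (hs : 0 ≤ s) (hs1 : s ≤ 1) (J : ℕ) (hJ : m ≤ J) :
    ∑ d ∈ Fintype.piFinset (fun _ : Fin J => D), ∑ x ∈ X,
      ∏ i, (1 + s * (c i * lam i (x + ∑ j, d j)).re) ≤ 2 * X.card * (D.card : ℝ) ^ J := by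
  have e1 : ((∑ d ∈ Fintype.piFinset (fun _ : Fin J => D), ∑ x ∈ X,
      ∏ i, (1 + s * (c i * lam i (x + ∑ j, d j)).re) : ℝ) : ℂ) =
      ∑ e ∈ Fintype.piFinset (fun _ : Fin m => sg), (∏ i, cf (c i) s (e i)) *
        (hat X (cmb lam e) * hat D (cmb lam e) ^ J) := by
    have hp : ∀ y : G, ((∏ i, (1 + s * (c i * lam i y).re) : ℝ) : ℂ) =
        ∑ e ∈ Fintype.piFinset (fun _ : Fin m => sg), (∏ i, cf (c i) s (e i)) * cmb lam e y := by
      intro y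
      rw [Complex.ofReal_prod]
      simp_rw [cf_expand]
      rw [Finset.prod_univ_sum]
      refine Finset.sum_congr rfl fun e _ => ?_
      rw [cmb_apply, Finset.prod_mul_distrib]
    rw [Complex.ofReal_sum]
    simp_rw [Complex.ofReal_sum, hp]
    refine ((Finset.sum_congr rfl fun d _ => Finset.sum_comm).trans Finset.sum_comm).trans ?_
    refine Finset.sum_congr rfl fun e _ => ?_
    simp_rw [← Finset.mul_sum]
    congr 1
    simp_rw [AddChar.map_add_eq_mul, ← Finset.sum_mul]
    rw [← Finset.mul_sum]
    congr 1
    rw [← Fin.prod_const]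
    unfold hat
    rw [Finset.prod_univ_sum]
    refine Finset.sum_congr rfl fun d _ => ?_
    rw [char_sum]
  have hb : ‖∑ e ∈ Fintype.piFinset (fun _ : Fin m => sg), (∏ i, cf (c i) s (e i)) *
        (hat X (cmb lam e) * hat D (cmb lam e) ^ J)‖ ≤
      ∑ e ∈ Fintype.piFinset (fun _ : Fin m => sg), ((if e = 0 then (X.card : ℝ) * (D.card:ℝ) ^ J else 0) +
        X.card * ((D.card : ℝ) / 3) ^ J) := by
    refine (norm_sum_le _ _).trans (Finset.sum_le_sum fun e he => ?_)
    have h1 : ‖∏ i, cf (c i) s (e i)‖ ≤ 1 := by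
      rw [norm_prod]
      exact Finset.prod_le_one (fun _ _ => norm_nonneg _) (fun i _ => cf_norm (hc i) hs hs1 _)
    rw [norm_mul, norm_mul, norm_pow]
    refine (mul_le_of_le_one_left (by positivity) h1).trans ?_
    have hX := hat_norm_le X (cmb lam e)
    split_ifs with h0
    · have hD := hat_norm_le D (cmb lam e)
      have : ‖hat X (cmb lam e)‖ * ‖hat D (cmb lam e)‖ ^ J ≤ X.card * (D.card : ℝ) ^ J := by gcongr
      have h2 : 0 ≤ X.card * ((D.card : ℝ) / 3) ^ J := by positivity
      linarith
    · have hD := (hdis e (fun i => Fintype.mem_piFinset.1 he i) h0).le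
      rw [zero_add]
      gcongr
  rw [Finset.sum_add_distrib, Finset.sum_const, Fintype.card_piFinset_const] at hb
  have hs3 : sg.card = 3 := by decide
  rw [Finset.sum_ite_eq' , if_pos (by rw [Fintype.mem_piFinset]; intro i; rw [Pi.zero_apply]; decide), hs3] at hb
  have h3 : (3:ℝ) ^ m * (X.card * ((D.card : ℝ) / 3) ^ J) ≤ X.card * (D.card : ℝ) ^ J := by
    have : (3:ℝ) ^ m ≤ 3 ^ J := pow_le_pow_right₀ (by norm_num) hJ
    calc (3:ℝ) ^ m * (X.card * ((D.card : ℝ) / 3) ^ J) ≤ 3 ^ J * (X.card * ((D.card : ℝ) / 3) ^ J) := by gcongr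
      _ = X.card * (D.card : ℝ) ^ J := by rw [div_pow]; field_simp
  rw [← e1, Complex.norm_real] at hb
  have := (le_abs_self _).trans hb
  simp only [nsmul_eq_mul] at this
  push_cast at this
  linarith

lemma dis_bound (D X T : Finset G) (hD : D.Nonempty) {m : ℕ} (lam : Fin m → AddChar G ℂ) (hdis : Dis D lam)
    (hT : T.Nonempty) (hspec : ∀ i, (T.card : ℝ) / 2 ≤ ‖hat T (lam i)‖)
    (hX : ∀ d : Fin m → G, (∀ j, d j ∈ D) → ∀ b ∈ T, b - ∑ j, d j ∈ X) :
    T.card * Real.exp (m / 16) ≤ 2 * X.card := by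
  have hTp : (0:ℝ) < T.card := by exact_mod_cast hT.card_pos
  have hDp : (0:ℝ) < D.card := by exact_mod_cast hD.card_pos
  let c : Fin m → ℂ := fun i => (starRingEnd ℂ) (hat T (lam i)) / ‖hat T (lam i)‖
  have hne : ∀ i, (0:ℝ) < ‖hat T (lam i)‖ := fun i => lt_of_lt_of_le (by positivity) (hspec i)
  have hc : ∀ i, ‖c i‖ = 1 := by
    intro i
    simp only [c]
    rw [norm_div, RCLike.norm_conj, Complex.norm_real, norm_norm, div_self (hne i).ne']
  have hc2 : ∀ i, ∑ t ∈ T, (c i * lam i t).re = ‖hat T (lam i)‖ := by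
    intro i
    rw [← Complex.re_sum, ← Finset.mul_sum]
    change (c i * hat T (lam i)).re = _
    have : c i * hat T (lam i) = ((‖hat T (lam i)‖ : ℝ) : ℂ) := by
      simp only [c]
      have h0 : ((‖hat T (lam i)‖ : ℝ) : ℂ) ≠ 0 := by exact_mod_cast (hne i).ne'
      rw [div_mul_eq_mul_div, mul_comm, Complex.mul_conj, Complex.normSq_eq_norm_sq, div_eq_iff h0]
      push_cast; ring
    rw [this, Complex.ofReal_re]
  set s : ℝ := (1/4) / (1 + (1/4)^2) with hs
  have hs0 : 0 ≤ s := by rw [hs]; norm_num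
  have hs1 : s ≤ 1 := by rw [hs]; norm_num
  have hre : ∀ i y, |(c i * lam i y).re| ≤ 1 := by
    intro i y
    refine (Complex.abs_re_le_norm _).trans ?_
    rw [norm_mul, hc]; simp
  have hfac : ∀ i y, 0 ≤ 1 + s * (c i * lam i y).re := by
    intro i y
    have := (abs_le.1 (hre i y)).1
    nlinarith
  have hR := riesz_sum_le D X lam hdis c hc hs0 hs1 m le_rfl
  let Rz : G → ℝ := fun y => ∏ i, (1 + s * (c i * lam i y).re)
  have hRz : ∀ y, 0 ≤ Rz y := fun y => Finset.prod_nonneg fun i _ => hfac i y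
  have h1 : (D.card : ℝ) ^ m * ∑ t ∈ T, Rz t ≤ 2 * X.card * (D.card : ℝ) ^ m := by
    refine le_trans ?_ hR
    have : (D.card : ℝ) ^ m = ((Fintype.piFinset (fun _ : Fin m => D)).card : ℝ) := by simp
    rw [this, ← nsmul_eq_mul, ← Finset.sum_const]
    refine Finset.sum_le_sum fun d hd => ?_
    have hd' := Fintype.mem_piFinset.1 hd
    have e : ∑ t ∈ T, Rz t = ∑ x ∈ T.image (fun b => b - ∑ j, d j), Rz (x + ∑ j, d j) := by
      rw [Finset.sum_image]
      · simp
      · intro a _ b _ h; exact sub_left_injective h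
    rw [e]
    refine Finset.sum_le_sum_of_subset_of_nonneg ?_ (fun y _ _ => hRz _)
    intro x hx
    obtain ⟨b, hb, rfl⟩ := Finset.mem_image.1 hx
    exact hX d hd' b hb
  have h2 : ∑ t ∈ T, Rz t ≤ 2 * X.card := by
    have hp : (0:ℝ) < (D.card : ℝ) ^ m := by positivity
    rw [mul_comm] at h1
    exact le_of_mul_le_mul_right h1 hp
  let Y : G → ℝ := fun y => ∑ i, (c i * lam i y).re
  have h3 : ∀ y, Real.exp (1/4 * Y y) ≤ Real.exp (m/16) * Rz y := by
    intro y
    have e1 : Real.exp (1/4 * Y y) = ∏ i, Real.exp (1/4 * (c i * lam i y).re) := by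
      simp only [Y]; rw [Finset.mul_sum, Real.exp_sum]
    have e2 : Real.exp (m/16) = ∏ i : Fin m, Real.exp (1/16) := by
      rw [Finset.prod_const, Finset.card_univ, Fintype.card_fin, ← Real.exp_nat_mul]; congr 1; ring
    simp only [Rz]
    rw [e1, e2, ← Finset.prod_mul_distrib]
    refine Finset.prod_le_prod (fun _ _ => (Real.exp_pos _).le) fun i _ => ?_
    set z := (c i * lam i y).re
    have hz := abs_le.1 (hre i y)
    have hz' : |1/4 * z| ≤ 1 := by rw [abs_le]; constructor <;> linarith [hz.1, hz.2]
    have := (abs_le.1 (Real.abs_exp_sub_one_sub_id_le hz')).2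
    have hz2 : (1/4*z)^2 ≤ 1/16 := by nlinarith [hz.1, hz.2]
    have h17 : (1:ℝ) + 1/16 ≤ Real.exp (1/16) := by linarith [Real.add_one_le_exp (1/16 : ℝ)]
    have e3 : (1 + 1/16) * (1 + s * z) = 1 + 1/16 + 1/4 * z := by rw [hs]; ring
    have := mul_le_mul_of_nonneg_right h17 (hfac i y)
    linarith
  have h4 : T.card * Real.exp (m/8) ≤ ∑ t ∈ T, Real.exp (1/4 * Y t) := by
    have h5 : ∀ t ∈ T, Real.exp (m/8) * (1 + (1/4 * Y t - m/8)) ≤ Real.exp (1/4 * Y t) := by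
      intro t _
      have := Real.add_one_le_exp (1/4 * Y t - m/8)
      have e : Real.exp (1/4 * Y t) = Real.exp (m/8) * Real.exp (1/4 * Y t - m/8) := by
        rw [← Real.exp_add]; congr 1; ring
      rw [e]
      exact mul_le_mul_of_nonneg_left (by linarith) (Real.exp_pos _).le
    have h6 := Finset.sum_le_sum h5
    rw [← Finset.mul_sum] at h6
    have h7 : (T.card : ℝ) * (m / 2) ≤ ∑ t ∈ T, Y t := by
      simp only [Y]
      rw [Finset.sum_comm]
      simp_rw [hc2]
      have := Finset.sum_le_sum fun (i : Fin m) (_ : i ∈ univ) => hspec i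
      simp only [Finset.sum_const, card_univ, Fintype.card_fin, nsmul_eq_mul] at this
      linarith
    refine le_trans ?_ h6
    rw [mul_comm]
    refine mul_le_mul_of_nonneg_left ?_ (Real.exp_pos _).le
    rw [Finset.sum_add_distrib, Finset.sum_sub_distrib, ← Finset.mul_sum]
    simp only [Finset.sum_const, nsmul_eq_mul]
    linarith
  have h8 : ∑ t ∈ T, Real.exp (1/4 * Y t) ≤ Real.exp (m/16) * (2 * X.card) := by
    refine (Finset.sum_le_sum fun t _ => h3 t).trans ?_
    rw [← Finset.mul_sum]
    exact mul_le_mul_of_nonneg_left h2 (Real.exp_pos _).le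
  have e9 : Real.exp ((m:ℝ)/8) = Real.exp (m/16) * Real.exp (m/16) := by
    rw [← Real.exp_add]; congr 1; ring
  rw [e9] at h4
  have h10 : Real.exp (m/16) * (T.card * Real.exp (m/16)) ≤ Real.exp (m/16) * (2 * X.card) := by linarith
  exact le_of_mul_le_mul_left h10 (Real.exp_pos _)

lemma chang (D X T : Finset G) (hD : D.Nonempty) (hT : T.Nonempty) (M : ℕ)
    (hX : ∀ d : Fin (M+1) → G, (∀ j, d j ∈ D) → ∀ b ∈ T, b - ∑ j, d j ∈ X)
    (hM : 2 * (X.card : ℝ) < T.card * Real.exp (((M + 1 : ℕ) : ℝ) / 16)) :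
    ∃ m ≤ M, ∃ lam : Fin m → AddChar G ℂ, ∀ γ : AddChar G ℂ, (T.card : ℝ) / 2 ≤ ‖hat T γ‖ →
      ∃ e : Fin m → ℤ, (∀ i, e i ∈ sg) ∧ ∃ χ : AddChar G ℂ, (D.card : ℝ) / 3 ≤ ‖hat D χ‖ ∧
        (γ = χ + cmb lam e ∨ -γ = χ + cmb lam e) := by
  let Q : ℕ → Prop := fun m => ∃ lam : Fin m → AddChar G ℂ, (∀ i, (T.card : ℝ) / 2 ≤ ‖hat T (lam i)‖) ∧ Dis D lam
  have hQ0 : Q 0 := ⟨fun i => i.elim0, fun i => i.elim0, fun e _ h => absurd (Subsingleton.elim _ _) h⟩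
  have hQM : ¬ Q (M + 1) := by
    rintro ⟨lam, h1, h2⟩
    exact absurd (dis_bound D X T hD lam h2 hT h1 hX) (not_le.2 hM)
  have hex : ∃ m ≤ M, Q m ∧ ¬ Q (m + 1) := by
    by_contra hcon
    push Not at hcon
    have : ∀ m, m ≤ M + 1 → Q m := by
      intro m
      induction m with
      | zero => intro _; exact hQ0
      | succ m ih => intro h; exact hcon m (by omega) (ih (by omega))
    exact hQM (this _ le_rfl)
  obtain ⟨m, hmM, ⟨lam, hl1, hl2⟩, hmax⟩ := hex
  refine ⟨m, hmM, lam, fun γ hγ => ?_⟩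
  have hnd : ¬ Dis D (Fin.snoc lam γ : Fin (m+1) → AddChar G ℂ) := by
    intro h
    apply hmax
    refine ⟨Fin.snoc lam γ, ?_, h⟩
    intro i
    refine Fin.lastCases ?_ (fun i => ?_) i
    · simpa using hγ
    · simpa using hl1 i
  unfold Dis at hnd
  push Not at hnd
  obtain ⟨e, he1, he0, he2⟩ := hnd
  have hcm : cmb (Fin.snoc lam γ : Fin (m+1) → AddChar G ℂ) e = cmb lam (fun i => e i.castSucc) + e (Fin.last m) • γ := by
    unfold cmb
    rw [Fin.sum_univ_castSucc]; simp
  set χ := cmb (Fin.snoc lam γ : Fin (m+1) → AddChar G ℂ) e with hχ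
  have hneg : cmb lam (fun i => - e i.castSucc) = - cmb lam (fun i => e i.castSucc) := by
    unfold cmb; simp
  have hsgneg : ∀ a ∈ sg, -a ∈ sg := by decide
  have hlast := he1 (Fin.last m)
  simp only [sg, Finset.mem_insert, Finset.mem_singleton] at hlast
  refine ⟨fun i => - e i.castSucc, fun i => hsgneg _ (he1 _), χ, he2, ?_⟩
  rcases hlast with h | h | h
  · right; rw [hneg, hcm, h]; simp
  · exfalso
    rw [h, zero_zsmul, add_zero] at hcm
    have := hl2 (fun i => e i.castSucc) (fun i => he1 _) ?_
    · rw [← hcm] at this; linarith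
    · intro h0
      apply he0
      ext i
      refine Fin.lastCases ?_ (fun i => ?_) i
      · simpa using h
      · simpa using congrFun h0 i
  · left; rw [hneg, hcm, h]; simp

end KM


namespace KM
open Finset

variable {G : Type} [AddCommGroup G] [Fintype G] [DecidableEq G]

lemma R_sum (A : Finset G) (x : G) :
    (R A x : ℝ) = ∑ y, (if y ∈ A then (1:ℝ) else 0) * (if y + x ∈ A then (1:ℝ) else 0) := by
  unfold R
  rw [Finset.card_filter, Nat.cast_sum, ← Finset.sum_subset (Finset.subset_univ A)]
  · refine Finset.sum_congr rfl fun y hy => ?_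
    rw [if_pos hy]; simp
  · intro y _ hy; rw [if_neg hy]; simp

lemma R_le (A : Finset G) (x : G) : R A x ≤ A.card := Finset.card_filter_le _ _

noncomputable def QQ (A A' : Finset G) (t : G) : ℝ := ∑ a ∈ A', ∑ a' ∈ A', (R A (a + t - a') : ℝ)

noncomputable def cc (A A' : Finset G) (ψ : AddChar G ℂ) : ℝ :=
  (‖ft (fun y => if y ∈ A then (1:ℝ) else 0) ψ‖ ^ 2 / Fintype.card G) * ‖hat A' ψ‖ ^ 2

lemma cc_nonneg (A A' : Finset G) (ψ : AddChar G ℂ) : 0 ≤ cc A A' ψ := by unfold cc; positivity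

lemma QQ_eq (A A' : Finset G) (t : G) : (QQ A A' t : ℂ) = ∑ ψ, (cc A A' ψ : ℂ) * ψ t := by
  unfold QQ
  rw [Complex.ofReal_sum]
  simp_rw [Complex.ofReal_sum, R_sum, inversion_corr]
  refine ((Finset.sum_congr rfl fun d _ => Finset.sum_comm).trans Finset.sum_comm).trans ?_
  refine Finset.sum_congr rfl fun ψ _ => ?_
  have h : ∀ a a', ψ (a + t - a') = ψ t * ψ (a - a') := by
    intro a a'; rw [← AddChar.map_add_eq_mul]; congr 1; abel
  simp_rw [h, ← Finset.mul_sum]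
  rw [sum_sub_char]
  unfold cc hat
  push_cast; ring

lemma QQ_zero_le (A A' : Finset G) : ∑ ψ, cc A A' ψ ≤ (A'.card : ℝ) ^ 2 * A.card := by
  have h := QQ_eq A A' 0
  simp only [AddChar.map_zero_eq_one, mul_one] at h
  have h2 : QQ A A' 0 = ∑ ψ, cc A A' ψ := by exact_mod_cast h
  rw [← h2]; unfold QQ
  calc _ ≤ ∑ a ∈ A', ∑ a' ∈ A', (A.card : ℝ) := by
        refine Finset.sum_le_sum fun _ _ => Finset.sum_le_sum fun _ _ => ?_
        exact_mod_cast R_le _ _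
    _ = _ := by simp; ring

lemma tuple_sum (T : Finset G) (k : ℕ) (ψ : AddChar G ℂ) :
    ∑ u ∈ Fintype.piFinset (fun _ : Fin k => T), ∑ u' ∈ Fintype.piFinset (fun _ : Fin k => T),
      ψ (∑ i, (u i - u' i)) = ((‖hat T ψ‖ ^ (2 * k) : ℝ) : ℂ) := by
  have h1 : ∀ u u' : Fin k → G, ψ (∑ i, (u i - u' i)) = (∏ i, ψ (u i)) * ∏ i, ψ (- u' i) := by
    intro u u'
    rw [char_sum, ← Finset.prod_mul_distrib]
    refine Finset.prod_congr rfl fun i _ => ?_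
    rw [← AddChar.map_add_eq_mul, sub_eq_add_neg]
  simp_rw [h1]
  rw [← Finset.sum_mul_sum, ← Finset.prod_univ_sum (fun _ => T) (fun _ x => ψ x),
    ← Finset.prod_univ_sum (fun _ => T) (fun _ x => ψ (-x)), Finset.prod_const,
    Finset.prod_const, card_univ, Fintype.card_fin, ← mul_pow]
  simp_rw [char_neg_conj]
  rw [← map_sum (starRingEnd ℂ), Complex.mul_conj, Complex.normSq_eq_norm_sq, pow_mul]
  push_cast; rfl

lemma spectral_inc (A A' T V : Finset G) (hA : A.Nonempty) (hA' : A'.Nonempty) (hT : T.Nonempty)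
    (hV : V.Nonempty) (k : ℕ)
    {β η : ℝ} (hη0 : 0 ≤ η) (hη : η ≤ 1)
    (hQ : ∀ u u' : Fin k → G, (∀ i, u i ∈ T) → (∀ i, u' i ∈ T) →
      β * ((A'.card : ℝ) ^ 2 * A.card) ≤ QQ A A' (∑ i, (u i - u' i)))
    (hβ : (1/4:ℝ) ^ k ≤ β)
    (hspec : ∀ ψ : AddChar G ℂ, (T.card : ℝ) / 2 ≤ ‖hat T ψ‖ → ∀ v ∈ V, ‖1 - ψ v‖ ≤ η) :
    ∃ z, (1 - η) ^ 2 * (β - (1/4:ℝ) ^ k) * V.card ≤ ((V.filter (fun v => z + v ∈ A)).card : ℝ) := by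
  have hTp : (0:ℝ) < T.card := by exact_mod_cast hT.card_pos
  have hVp : (0:ℝ) < V.card := by exact_mod_cast hV.card_pos
  have hAp : (0:ℝ) < A.card := by exact_mod_cast hA.card_pos
  have hA'p : (0:ℝ) < A'.card := by exact_mod_cast hA'.card_pos
  set K := (A'.card : ℝ) ^ 2 * A.card with hK
  have hKp : 0 < K := by positivity
  have h1 : (T.card : ℝ) ^ (2 * k) * (β * K) ≤ ∑ ψ, cc A A' ψ * ‖hat T ψ‖ ^ (2 * k) := by
    have e : ∑ u ∈ Fintype.piFinset (fun _ : Fin k => T), ∑ u' ∈ Fintype.piFinset (fun _ : Fin k => T),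
      QQ A A' (∑ i, (u i - u' i)) = ∑ ψ, cc A A' ψ * ‖hat T ψ‖ ^ (2 * k) := by
      apply Complex.ofReal_injective
      rw [Complex.ofReal_sum, Complex.ofReal_sum]
      simp_rw [Complex.ofReal_sum, QQ_eq]
      refine ((Finset.sum_congr rfl fun d _ => Finset.sum_comm).trans Finset.sum_comm).trans ?_
      refine Finset.sum_congr rfl fun ψ _ => ?_
      simp_rw [← Finset.mul_sum]
      rw [tuple_sum]; push_cast; rfl
    rw [← e]
    calc (T.card : ℝ) ^ (2 * k) * (β * K) = ∑ u ∈ Fintype.piFinset (fun _ : Fin k => T), ∑ u' ∈ Fintype.piFinset (fun _ : Fin k => T), β * K := by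
          simp [Fintype.card_piFinset_const]; ring
      _ ≤ _ := by
          refine Finset.sum_le_sum fun u hu => Finset.sum_le_sum fun u' hu' => ?_
          exact hQ u u' (Fintype.mem_piFinset.1 hu) (Fintype.mem_piFinset.1 hu')
  let Sp : Finset (AddChar G ℂ) := univ.filter (fun ψ => (T.card : ℝ) / 2 ≤ ‖hat T ψ‖)
  have h2 : (β - (1/4:ℝ)^k) * K ≤ ∑ ψ ∈ Sp, cc A A' ψ := by
    have h3 : ∑ ψ, cc A A' ψ * ‖hat T ψ‖ ^ (2 * k) ≤
        (T.card : ℝ) ^ (2 * k) * ∑ ψ ∈ Sp, cc A A' ψ + (T.card : ℝ) ^ (2*k) * ((1/4:ℝ)^k * ∑ ψ, cc A A' ψ) := by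
      rw [Finset.sum_filter, Finset.mul_sum, Finset.mul_sum, Finset.mul_sum, ← Finset.sum_add_distrib]
      refine Finset.sum_le_sum fun ψ _ => ?_
      have hc := cc_nonneg A A' ψ
      split_ifs with h
      · have : ‖hat T ψ‖ ^ (2 * k) ≤ (T.card : ℝ) ^ (2 * k) := by
          gcongr; exact hat_norm_le T ψ
        have h5 := mul_le_mul_of_nonneg_left this hc
        have h6 : 0 ≤ (T.card : ℝ) ^ (2*k) * ((1/4:ℝ)^k * cc A A' ψ) := by positivity
        linarith
      · push Not at h
        have : ‖hat T ψ‖ ^ (2 * k) ≤ ((T.card : ℝ) / 2) ^ (2 * k) := by gcongr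
        have h5 := mul_le_mul_of_nonneg_left this hc
        have e : ((T.card : ℝ) / 2) ^ (2 * k) = (T.card : ℝ) ^ (2*k) * (1/4:ℝ)^k := by
          rw [div_pow, pow_mul 2 2 k, div_pow]; norm_num; ring
        rw [e] at h5
        linarith
    have h4 := QQ_zero_le A A'
    rw [← hK] at h4
    have h5 : (T.card : ℝ) ^ (2*k) * ((1/4:ℝ)^k * ∑ ψ, cc A A' ψ) ≤ (T.card : ℝ) ^ (2*k) * ((1/4:ℝ)^k * K) := by gcongr
    have hTk : 0 < (T.card : ℝ) ^ (2*k) := by positivity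
    have h6 : (T.card : ℝ) ^ (2*k) * ((β - (1/4:ℝ)^k) * K) ≤ (T.card : ℝ) ^ (2*k) * ∑ ψ ∈ Sp, cc A A' ψ := by
      linarith
    exact le_of_mul_le_mul_left h6 hTk
  have h3 : (1 - η) ^ 2 * (V.card : ℝ) ^ 2 * ((β - (1/4:ℝ)^k) * K) ≤ ∑ v ∈ V, ∑ v' ∈ V, QQ A A' (v - v') := by
    have e : ∑ v ∈ V, ∑ v' ∈ V, QQ A A' (v - v') = ∑ ψ, cc A A' ψ * ‖hat V ψ‖ ^ 2 := by
      apply Complex.ofReal_injective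
      rw [Complex.ofReal_sum, Complex.ofReal_sum]
      simp_rw [Complex.ofReal_sum, QQ_eq]
      refine ((Finset.sum_congr rfl fun d _ => Finset.sum_comm).trans Finset.sum_comm).trans ?_
      refine Finset.sum_congr rfl fun ψ _ => ?_
      simp_rw [← Finset.mul_sum]
      rw [sum_sub_char]; push_cast; rfl
    rw [e]
    calc (1 - η) ^ 2 * (V.card : ℝ) ^ 2 * ((β - (1/4:ℝ)^k) * K) ≤ (1 - η) ^ 2 * (V.card : ℝ) ^ 2 * ∑ ψ ∈ Sp, cc A A' ψ := by gcongr
      _ = ∑ ψ ∈ Sp, cc A A' ψ * ((1 - η) * V.card) ^ 2 := by rw [← Finset.sum_mul]; ring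
      _ ≤ ∑ ψ ∈ Sp, cc A A' ψ * ‖hat V ψ‖ ^ 2 := by
          refine Finset.sum_le_sum fun ψ hψ => ?_
          have hs := hspec ψ (Finset.mem_filter.1 hψ).2
          have : (1 - η) * V.card ≤ ‖hat V ψ‖ := by
            have h7 : ‖(V.card : ℂ) - hat V ψ‖ ≤ V.card * η := by
              have : (V.card : ℂ) - hat V ψ = ∑ v ∈ V, (1 - ψ v) := by unfold hat; simp
              rw [this]
              refine (norm_sum_le _ _).trans ((Finset.sum_le_sum hs).trans ?_)
              simp
            have h8 := norm_sub_norm_le (V.card : ℂ) (hat V ψ)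
            rw [Complex.norm_natCast] at h8
            linarith
          have h0 : 0 ≤ (1 - η) * V.card := mul_nonneg (by linarith) hVp.le
          have := pow_le_pow_left₀ h0 this 2
          exact mul_le_mul_of_nonneg_left this (cc_nonneg _ _ _)
      _ ≤ _ := Finset.sum_le_sum_of_subset_of_nonneg (Finset.subset_univ _) (fun ψ _ _ => mul_nonneg (cc_nonneg _ _ _) (by positivity))
  by_contra hcon
  push Not at hcon
  have h4 : ∀ x, ∑ v ∈ V, (R A (x + v) : ℝ) < A.card * ((1 - η) ^ 2 * (β - (1/4:ℝ) ^ k) * V.card) := by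
    intro x
    have e : ∑ v ∈ V, (R A (x + v) : ℝ) = ∑ y ∈ A, ((V.filter (fun v => (y + x) + v ∈ A)).card : ℝ) := by
      unfold R
      simp_rw [Finset.card_filter]
      push_cast
      rw [Finset.sum_comm]
      simp_rw [add_assoc]
    rw [e, ← nsmul_eq_mul, ← Finset.sum_const]
    exact Finset.sum_lt_sum_of_nonempty hA (fun y _ => hcon _)
  have h5 : ∑ v ∈ V, ∑ v' ∈ V, QQ A A' (v - v') = ∑ a ∈ A', ∑ a' ∈ A', ∑ v' ∈ V, ∑ v ∈ V, (R A ((a - a' - v') + v) : ℝ) := by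
    rw [Finset.sum_comm]
    unfold QQ
    have e1 : ∀ v' ∈ V, ∑ v ∈ V, ∑ a ∈ A', ∑ a' ∈ A', (R A (a + (v - v') - a') : ℝ) =
       ∑ a ∈ A', ∑ a' ∈ A', ∑ v ∈ V, (R A (a - a' - v' + v) : ℝ) := by
      intro v' _
      refine Finset.sum_comm.trans (Finset.sum_congr rfl fun a _ => Finset.sum_comm.trans ?_)
      refine Finset.sum_congr rfl fun a' _ => Finset.sum_congr rfl fun v _ => ?_
      congr 2; abel
    rw [Finset.sum_congr rfl e1]
    refine Finset.sum_comm.trans (Finset.sum_congr rfl fun a _ => Finset.sum_comm)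
  rw [h5] at h3
  have h6 : ∑ a ∈ A', ∑ a' ∈ A', ∑ v' ∈ V, ∑ v ∈ V, (R A ((a - a' - v') + v) : ℝ) <
      ∑ a ∈ A', ∑ a' ∈ A', ∑ v' ∈ V, A.card * ((1 - η) ^ 2 * (β - (1/4:ℝ) ^ k) * V.card) :=
    Finset.sum_lt_sum_of_nonempty hA' fun _ _ => Finset.sum_lt_sum_of_nonempty hA' fun _ _ =>
      Finset.sum_lt_sum_of_nonempty hV fun _ _ => h4 _
  simp only [Finset.sum_const, nsmul_eq_mul] at h6
  rw [hK] at h3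
  nlinarith

lemma char_smul_sg (χ : AddChar G ℂ) {e : ℤ} (he : e ∈ sg) (v : G) : ‖1 - (e • χ) v‖ ≤ ‖1 - χ v‖ := by
  simp only [sg, Finset.mem_insert, Finset.mem_singleton] at he
  rcases he with rfl | rfl | rfl
  · rw [neg_one_smul, AddChar.neg_apply, char_neg_eq]
  · simp
  · simp

lemma char_add_apply_le (χ ψ : AddChar G ℂ) (v : G) : ‖1 - (χ + ψ) v‖ ≤ ‖1 - χ v‖ + ‖1 - ψ v‖ := by
  have : 1 - (χ + ψ) v = (1 - χ v) + χ v * (1 - ψ v) := by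
    rw [AddChar.add_apply]; ring
  rw [this]
  refine (norm_add_le _ _).trans ?_
  simp

lemma cmb_le {m : ℕ} (lam : Fin m → AddChar G ℂ) (e : Fin m → ℤ) (he : ∀ i, e i ∈ sg) (v : G) {w : ℝ}
    (hw : ∀ i, ‖1 - lam i v‖ ≤ w) : ‖1 - cmb lam e v‖ ≤ m * w := by
  unfold cmb
  induction m with
  | zero => simp
  | succ m ih =>
    rw [Fin.sum_univ_castSucc]
    refine (char_add_apply_le _ _ _).trans ?_
    have h1 := ih (fun i => lam i.castSucc) (fun i => e i.castSucc) (fun i => he _) (fun i => hw _)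
    have h2 := (char_smul_sg (lam (Fin.last m)) (he (Fin.last m)) v).trans (hw _)
    rw [Nat.cast_add, Nat.cast_one]; linarith

lemma large_char_le {l : List (AddChar G ℂ × ℝ)} (hl : ∀ p ∈ l, 0 ≤ p.2) {r h ε : ℝ} (hr : 0 ≤ r)
    (hreg : ((ball l (r + h)).card : ℝ) ≤ (1 + ε) * (ball l r).card) {v : G} (hv : v ∈ ball l h)
    (hh : 0 ≤ h) (χ : AddChar G ℂ) (hχ : ((ball l r).card : ℝ) / 3 ≤ ‖hat (ball l r) χ‖) :
    ‖1 - χ v‖ ≤ 6 * ε := by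
  set D := ball l r with hD
  have hDp : (0:ℝ) < D.card := by
    have : 0 < D.card := Finset.card_pos.2 ⟨0, zero_mem_ball l hr⟩
    exact_mod_cast this
  have h1 := regular_shift hl hreg hv hh
  have h2 := regular_shift hl hreg (neg_mem_ball hv) hh
  rw [← hD] at h1 h2
  have key : hat D χ - χ v * hat D χ = ∑ y ∈ D.filter (fun y => y - v ∉ D), χ y -
      ∑ y ∈ D.filter (fun y => y - -v ∉ D), χ (y + v) := by
    have e1 : hat D χ = ∑ y ∈ D.filter (fun y => y - v ∈ D), χ y + ∑ y ∈ D.filter (fun y => y - v ∉ D), χ y := by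
      unfold hat; rw [Finset.sum_filter_add_sum_filter_not]
    have e2 : χ v * hat D χ = ∑ y ∈ D.filter (fun y => y + v ∈ D), χ (y + v) + ∑ y ∈ D.filter (fun y => y - -v ∉ D), χ (y + v) := by
      simp_rw [sub_neg_eq_add]
      rw [Finset.sum_filter_add_sum_filter_not]
      unfold hat; rw [Finset.mul_sum]
      refine Finset.sum_congr rfl fun y _ => ?_
      rw [AddChar.map_add_eq_mul]; ring
    have e3 : ∑ y ∈ D.filter (fun y => y + v ∈ D), χ (y + v) = ∑ y ∈ D.filter (fun y => y - v ∈ D), χ y := by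
      refine Finset.sum_bij' (fun y _ => y + v) (fun y _ => y - v) ?_ ?_ ?_ ?_ ?_
      · intro y hy; rw [Finset.mem_filter] at *; simpa using ⟨hy.2, hy.1⟩
      · intro y hy; rw [Finset.mem_filter] at *; simpa using ⟨hy.2, hy.1⟩
      · intro y _; simp
      · intro y _; simp
      · intro y _; rfl
    rw [e2, e3]; nth_rewrite 1 [e1]; ring
  have h3 : ‖hat D χ - χ v * hat D χ‖ ≤ 2 * ε * D.card := by
    rw [key]
    refine (norm_sub_le _ _).trans ?_
    have n1 : ‖∑ y ∈ D.filter (fun y => y - v ∉ D), χ y‖ ≤ ε * D.card := by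
      refine (norm_sum_le _ _).trans ?_
      simpa using h1
    have n2 : ‖∑ y ∈ D.filter (fun y => y - -v ∉ D), χ (y + v)‖ ≤ ε * D.card := by
      refine (norm_sum_le _ _).trans ?_
      simpa using h2
    linarith
  have h4 : hat D χ - χ v * hat D χ = (1 - χ v) * hat D χ := by ring
  rw [h4, norm_mul] at h3
  have h5 : ‖1 - χ v‖ * (D.card / 3) ≤ 2 * ε * D.card :=
    (mul_le_mul_of_nonneg_left hχ (norm_nonneg _)).trans h3
  have h6 : ‖1 - χ v‖ * D.card ≤ (6 * ε) * D.card := by linarith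
  exact le_of_mul_le_mul_right h6 hDp

end KM


namespace KM
open Finset

variable {G : Type} [AddCommGroup G] [Fintype G] [DecidableEq G]

def ind (A : Finset G) (y : G) : ℝ := if y ∈ A then 1 else 0

noncomputable def bal (A B : Finset G) (y : G) : ℝ := ind A y / A.card - ind B y / B.card

lemma sum_ind_filter (A : Finset G) (P : G → Prop) [DecidablePred P] :
    ∑ y, ind A y * (if P y then (1:ℝ) else 0) = ((A.filter P).card : ℝ) := by
  rw [Finset.card_filter, Nat.cast_sum, ← Finset.sum_subset (Finset.subset_univ A)]
  · refine Finset.sum_congr rfl fun y hy => ?_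
    simp [ind, hy]
  · intro y _ hy; simp [ind, hy]

lemma filter_not_card (A : Finset G) (P : G → Prop) [DecidablePred P] :
    ((A.filter P).card : ℝ) = A.card - ((A.filter (fun x => ¬ P x)).card : ℝ) := by
  have := Finset.card_filter_add_card_filter_not (s := A) P
  have h : ((A.filter P).card : ℝ) + ((A.filter (fun x => ¬ P x)).card : ℝ) = A.card := by exact_mod_cast this
  linarith

lemma bal_conv {l : List (AddChar G ℂ × ℝ)} (hl : ∀ p ∈ l, 0 ≤ p.2) {r h ε : ℝ}
    (hreg : ((ball l (r + h)).card : ℝ) ≤ (1 + ε) * (ball l r).card) (hh : 0 ≤ h)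
    (A : Finset G) (hA : A.Nonempty) (hAB : A ⊆ ball l r) {x : G} (hx : x ∈ ball l h)
    (hx0 : ∀ a ∈ A, x - a ∉ A) :
    (ball l r).card * ∑ y, bal A (ball l r) y * bal A (ball l r) (x - y) ≤
      -1 + 2 * ε * ((ball l r).card / A.card) := by
  set B := ball l r with hB
  have hAp : (0:ℝ) < A.card := by exact_mod_cast hA.card_pos
  have hBp : (0:ℝ) < B.card := lt_of_lt_of_le hAp (by exact_mod_cast Finset.card_le_card hAB)
  have e : ∑ y, bal A B y * bal A B (x - y) =
      (∑ y, ind A y * (if x - y ∈ A then (1:ℝ) else 0)) / A.card ^ 2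
      - (∑ y, ind A y * (if x - y ∈ B then (1:ℝ) else 0)) / (A.card * B.card)
      - (∑ y, ind B y * (if x - y ∈ A then (1:ℝ) else 0)) / (A.card * B.card)
      + (∑ y, ind B y * (if x - y ∈ B then (1:ℝ) else 0)) / B.card ^ 2 := by
    simp_rw [Finset.sum_div]
    rw [← Finset.sum_sub_distrib, ← Finset.sum_sub_distrib, ← Finset.sum_add_distrib]
    refine Finset.sum_congr rfl fun y _ => ?_
    unfold bal
    simp only [ind]
    field_simp
    ring
  have hsym : ∀ z, z ∈ B ↔ -z ∈ B := fun z => ⟨fun h => neg_mem_ball h, fun h => by simpa using neg_mem_ball h⟩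
  have c1 : ∑ y, ind A y * (if x - y ∈ A then (1:ℝ) else 0) = 0 := by
    rw [sum_ind_filter]
    rw [Nat.cast_eq_zero, Finset.card_eq_zero, Finset.filter_eq_empty_iff]
    intro a ha; exact hx0 a ha
  have hsh := regular_shift hl hreg hx hh
  rw [← hB] at hsh
  have c2 : A.card - ε * B.card ≤ ∑ y, ind A y * (if x - y ∈ B then (1:ℝ) else 0) := by
    rw [sum_ind_filter, filter_not_card]
    have : ((A.filter (fun y => ¬ (x - y ∈ B))).card : ℝ) ≤ ε * B.card := by
      refine le_trans ?_ hsh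
      norm_cast
      refine Finset.card_le_card ?_
      intro y hy
      rw [Finset.mem_filter] at *
      refine ⟨hAB hy.1, ?_⟩
      rw [hsym, neg_sub]; exact hy.2
    linarith
  have c3 : ∑ y, ind B y * (if x - y ∈ A then (1:ℝ) else 0) = ∑ y, ind A y * (if x - y ∈ B then (1:ℝ) else 0) := by
    refine Finset.sum_bij' (fun y _ => x - y) (fun y _ => x - y) ?_ ?_ ?_ ?_ ?_
    · simp
    · simp
    · simp
    · simp
    · intro y _; simp only [ind, sub_sub_cancel]; ring
  have c4 : ∑ y, ind B y * (if x - y ∈ B then (1:ℝ) else 0) ≤ B.card := by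
    rw [sum_ind_filter]; exact_mod_cast Finset.card_filter_le _ _
  rw [e, c1, c3]
  set u := ∑ y, ind A y * (if x - y ∈ B then (1:ℝ) else 0)
  set w := ∑ y, ind B y * (if x - y ∈ B then (1:ℝ) else 0)
  have hAne : (A.card : ℝ) ≠ 0 := hAp.ne'
  have hBne : (B.card : ℝ) ≠ 0 := hBp.ne'
  clear_value u w
  clear hsym hsh c3 c1 e hx0
  have e2 : (B.card : ℝ) * (0 / A.card ^ 2 - u / (A.card * B.card) - u / (A.card * B.card) + w / B.card ^ 2) =
     -2 * (u / A.card) + w / B.card := by field_simp; ring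
  rw [e2]
  have h1 : 1 - ε * (B.card / A.card) ≤ u / A.card := by
    rw [le_div_iff₀ hAp]
    have : (1 - ε * (B.card / A.card)) * A.card = A.card - ε * B.card := by field_simp
    linarith
  have h2 : w / B.card ≤ 1 := div_le_one_of_le₀ c4 hBp.le
  linarith

lemma bal_corr {l : List (AddChar G ℂ × ℝ)} (hl : ∀ p ∈ l, 0 ≤ p.2) {r h ε : ℝ} (hε : 0 ≤ ε)
    (hreg : ((ball l (r + h)).card : ℝ) ≤ (1 + ε) * (ball l r).card) (hh : 0 ≤ h)
    (A : Finset G) (hA : A.Nonempty) (hAB : A ⊆ ball l r) {x : G} (hx : x ∈ ball l h) :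
    |1 + (ball l r).card * ∑ y, bal A (ball l r) y * bal A (ball l r) (y + x)| ≤
      (ball l r).card * R A x / A.card ^ 2 + 2 * ε * ((ball l r).card / A.card) := by
  set B := ball l r with hB
  have hAp : (0:ℝ) < A.card := by exact_mod_cast hA.card_pos
  have hABc : (A.card : ℝ) ≤ B.card := by exact_mod_cast Finset.card_le_card hAB
  have hBp : (0:ℝ) < B.card := lt_of_lt_of_le hAp hABc
  have e : ∑ y, bal A B y * bal A B (y + x) =
      (∑ y, ind A y * (if y + x ∈ A then (1:ℝ) else 0)) / A.card ^ 2
      - (∑ y, ind A y * (if y + x ∈ B then (1:ℝ) else 0)) / (A.card * B.card)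
      - (∑ y, ind B y * (if y + x ∈ A then (1:ℝ) else 0)) / (A.card * B.card)
      + (∑ y, ind B y * (if y + x ∈ B then (1:ℝ) else 0)) / B.card ^ 2 := by
    simp_rw [Finset.sum_div]
    rw [← Finset.sum_sub_distrib, ← Finset.sum_sub_distrib, ← Finset.sum_add_distrib]
    refine Finset.sum_congr rfl fun y _ => ?_
    unfold bal
    simp only [ind]
    field_simp
    ring
  have c1 : ∑ y, ind A y * (if y + x ∈ A then (1:ℝ) else 0) = R A x := by
    rw [sum_ind_filter]; rfl
  have hs1 := regular_shift hl hreg hx hh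
  have hs2 := regular_shift hl hreg (neg_mem_ball hx) hh
  rw [← hB] at hs1 hs2
  simp_rw [sub_neg_eq_add] at hs2
  have gen : ∀ (A' : Finset G), A' ⊆ B → (A'.card : ℝ) - ε * B.card ≤ ∑ y, ind A' y * (if y + x ∈ B then (1:ℝ) else 0)
      ∧ ∑ y, ind A' y * (if y + x ∈ B then (1:ℝ) else 0) ≤ A'.card := by
    intro A' hA'
    rw [sum_ind_filter]
    refine ⟨?_, by exact_mod_cast Finset.card_filter_le _ _⟩
    rw [filter_not_card]
    have : ((A'.filter (fun y => ¬ (y + x ∈ B))).card : ℝ) ≤ ε * B.card := by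
      refine le_trans ?_ hs2
      norm_cast
      refine Finset.card_le_card ?_
      intro y hy
      rw [Finset.mem_filter] at *
      exact ⟨hA' hy.1, hy.2⟩
    linarith
  have c3 : ∑ y, ind B y * (if y + x ∈ A then (1:ℝ) else 0) = ∑ y, ind A y * (if y - x ∈ B then (1:ℝ) else 0) := by
    refine Finset.sum_bij' (fun y _ => y + x) (fun y _ => y - x) ?_ ?_ ?_ ?_ ?_
    · simp
    · simp
    · simp
    · simp
    · intro y _; simp only [ind, add_sub_cancel_right]; ring
  have c3' : (A.card : ℝ) - ε * B.card ≤ ∑ y, ind A y * (if y - x ∈ B then (1:ℝ) else 0)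
      ∧ ∑ y, ind A y * (if y - x ∈ B then (1:ℝ) else 0) ≤ A.card := by
    rw [sum_ind_filter]
    refine ⟨?_, by exact_mod_cast Finset.card_filter_le _ _⟩
    rw [filter_not_card]
    have : ((A.filter (fun y => ¬ (y - x ∈ B))).card : ℝ) ≤ ε * B.card := by
      refine le_trans ?_ hs1
      norm_cast
      refine Finset.card_le_card ?_
      intro y hy
      rw [Finset.mem_filter] at *
      exact ⟨hAB hy.1, hy.2⟩
    linarith
  obtain ⟨u1, u2⟩ := gen A hAB
  obtain ⟨w1, w2⟩ := gen B subset_rfl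
  obtain ⟨v1, v2⟩ := c3'
  rw [e, c1, c3]
  set u := ∑ y, ind A y * (if y + x ∈ B then (1:ℝ) else 0)
  set v := ∑ y, ind A y * (if y - x ∈ B then (1:ℝ) else 0)
  set w := ∑ y, ind B y * (if y + x ∈ B then (1:ℝ) else 0)
  have e2 : 1 + (B.card : ℝ) * ((R A x : ℝ) / A.card ^ 2 - u / (A.card * B.card) - v / (A.card * B.card) + w / B.card ^ 2) =
     B.card * R A x / A.card ^ 2 + (1 - u / A.card - v / A.card + w / B.card) := by field_simp; ring
  rw [e2]
  have hle : ∀ z : ℝ, A.card - ε * B.card ≤ z → 1 - ε * (B.card / A.card) ≤ z / A.card := by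
    intro z hz
    rw [le_div_iff₀ hAp]
    have : (1 - ε * (B.card / A.card)) * A.card = A.card - ε * B.card := by field_simp
    linarith
  have a1 := hle u u1
  have a2 := hle v v1
  have a3 : u / A.card ≤ 1 := div_le_one_of_le₀ u2 hAp.le
  have a4 : v / A.card ≤ 1 := div_le_one_of_le₀ v2 hAp.le
  have a5 : w / B.card ≤ 1 := div_le_one_of_le₀ w2 hBp.le
  have a6 : 1 - ε ≤ w / B.card := by rw [le_div_iff₀ hBp]; linarith
  have a7 : 1 ≤ (B.card : ℝ) / A.card := by rw [le_div_iff₀ hAp]; linarith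
  have a8 : ε ≤ ε * (B.card / A.card) := le_mul_of_one_le_right hε a7
  have hF : 0 ≤ (B.card : ℝ) * R A x / A.card ^ 2 := by positivity
  rw [abs_le]
  constructor <;> linarith

end KM


namespace KM
open Finset

variable {G : Type} [AddCommGroup G] [Fintype G] [DecidableEq G]

lemma num1 {p : ℕ} (hp : 40 ≤ p) : (2.8:ℝ) ^ p + 1 ≤ 2.9 ^ p := by
  induction p, hp using Nat.le_induction with
  | base => norm_num
  | succ n hn ih =>
    rw [pow_succ, pow_succ]
    have : (0:ℝ) ≤ 2.8 ^ n := by positivity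
    linarith

lemma num2 {p : ℕ} (hp : 40 ≤ p) : (2.02:ℝ) ^ p * 1000 ≤ 2.8 ^ p := by
  induction p, hp using Nat.le_induction with
  | base => norm_num
  | succ n hn ih =>
    rw [pow_succ, pow_succ]
    have : (0:ℝ) ≤ 2.8 ^ n := by positivity
    linarith

lemma pow_add_le {F d : ℝ} (hF : 0 ≤ F) (hd : 0 ≤ d) (q : ℕ) : (F + d) ^ q ≤ (1 + d) ^ q * (F ^ q + 1) := by
  rcases le_or_gt 1 F with h | h
  · have : F + d ≤ (1 + d) * F := by nlinarith
    have := pow_le_pow_left₀ (by positivity) this q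
    rw [mul_pow] at this
    have h0 : 0 ≤ (1 + d) ^ q := by positivity
    linarith
  · have := pow_le_pow_left₀ (by positivity) (show F + d ≤ 1 + d by linarith) q
    have h0 : 0 ≤ (1 + d) ^ q := by positivity
    have h1 : 0 ≤ F ^ q := by positivity
    nlinarith

set_option maxHeartbeats 2000000 in
lemma moment_sift {l : List (AddChar G ℂ × ℝ)} (hl : ∀ p ∈ l, 0 ≤ p.2) {r h ε : ℝ} (hε : 0 ≤ ε)
    (hreg : ((ball l (r + h)).card : ℝ) ≤ (1 + ε) * (ball l r).card) (hh : 0 ≤ h)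
    (A : Finset G) (hA : A.Nonempty) (hAB : A ⊆ ball l r) (L : ℕ) (hL : 1 ≤ L)
    (hAL : ((ball l r).card : ℝ) ≤ 2 ^ L * A.card) (hεL : ε * 2 ^ (L + 20) ≤ 1)
    (B' : Finset G) (hB' : B'.Nonempty) (hB'd : ∀ b ∈ B', ∀ b' ∈ B', b - b' ∈ ball l h)
    (C : Finset G) (hC : ∀ y ∈ C, ∀ a ∈ A, y - a ∉ A)
    (hCm : (A.card : ℝ) / (4 * (ball l r).card) * (B'.card : ℝ) ^ 2 ≤
      ∑ b ∈ B', ∑ b' ∈ B', if b - b' ∈ C then (1:ℝ) else 0) :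
    ∃ A' ⊆ B', A'.Nonempty ∧ (B'.card : ℝ) ≤ 2 ^ (480 * L ^ 2) * A'.card ∧
      ∑ a ∈ A', ∑ a' ∈ A', (if a - a' ∈ (univ.filter (fun x => 1.06 * (A.card : ℝ) ^ 2 ≤ (ball l r).card * R A x) : Finset G)
        then (0:ℝ) else 1) ≤ 0.004 * (A'.card : ℝ) ^ 2 := by
  set B := ball l r with hB
  have hAp : (0:ℝ) < A.card := by exact_mod_cast hA.card_pos
  have hABc : (A.card : ℝ) ≤ B.card := by exact_mod_cast Finset.card_le_card hAB
  have hBp : (0:ℝ) < B.card := lt_of_lt_of_le hAp hABc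
  have hB'p : (0:ℝ) < B'.card := by exact_mod_cast hB'.card_pos
  set p := 40 * L with hp
  set q := 12 * p with hq
  have hp40 : 40 ≤ p := by omega
  have hpe : Even p := ⟨20 * L, by omega⟩
  have hqe : Even q := ⟨6 * p, by omega⟩
  set dd := 2 * ε * (B.card / A.card) with hdd
  have hBA : (B.card : ℝ) / A.card ≤ 2 ^ L := by rw [div_le_iff₀ hAp]; exact hAL
  have hBA0 : 0 ≤ (B.card : ℝ) / A.card := by positivity
  have hdd0 : 0 ≤ dd := by positivity
  have hdd1 : dd ≤ 1 / 2 ^ 19 := by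
    have : ε * (B.card / A.card) ≤ ε * 2 ^ L := by gcongr
    rw [pow_add] at hεL
    rw [hdd, le_div_iff₀ (by positivity)]
    norm_num at hεL ⊢
    linarith
  let F : G → ℝ := fun x => B.card * R A x / A.card ^ 2
  have hF0 : ∀ x, 0 ≤ F x := fun x => by simp only [F]; positivity
  have hub := unbalance (bal A B) B' p q (by omega) hBp.le
  have hch : (12:ℝ) ^ p ≤ (q.choose p : ℝ) := by exact_mod_cast choose_lower p 12
  have hlow : (3:ℝ) ^ p * (B'.card : ℝ) ^ 2 ≤ (q.choose p : ℝ) * ∑ b ∈ B', ∑ b' ∈ B', (B.card * ∑ y, bal A B y * bal A B (b - b' - y)) ^ p := by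
    have h1 : (1/2:ℝ) ^ p * ∑ b ∈ B', ∑ b' ∈ B', (if b - b' ∈ C then (1:ℝ) else 0) ≤
        ∑ b ∈ B', ∑ b' ∈ B', (B.card * ∑ y, bal A B y * bal A B (b - b' - y)) ^ p := by
      rw [Finset.mul_sum]
      refine Finset.sum_le_sum fun b hb => ?_
      rw [Finset.mul_sum]
      refine Finset.sum_le_sum fun b' hb' => ?_
      split_ifs with hc
      · have := bal_conv hl hreg hh A hA hAB (hB'd b hb b' hb') (hC _ hc)
        rw [← hB, ← hdd] at this
        have h2 : 1/2 ≤ -(B.card * ∑ y, bal A B y * bal A B (b - b' - y)) := by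
          have : (1:ℝ) / 2 ^ 19 ≤ 1/2 := by norm_num
          linarith
        have h3 := pow_le_pow_left₀ (by norm_num) h2 p
        rw [hpe.neg_pow] at h3
        rw [mul_one]; exact h3
      · rw [mul_zero]; exact hpe.pow_nonneg _
    have h2 : (1/2:ℝ) ^ p ≤ (A.card : ℝ) / (4 * B.card) := by
      rw [one_div, inv_pow, inv_le_comm₀ (by positivity) (by positivity), inv_div, div_le_iff₀ hAp]
      have : (2:ℝ) ^ L * 4 ≤ 2 ^ p := by
        have : (2:ℝ) ^ L * 4 = 2 ^ (L + 2) := by rw [pow_add]; norm_num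
        rw [this]; exact pow_le_pow_right₀ (by norm_num) (by omega)
      nlinarith
    have h3 : (1/2:ℝ) ^ p * (B'.card : ℝ) ^ 2 ≤ ∑ b ∈ B', ∑ b' ∈ B', (if b - b' ∈ C then (1:ℝ) else 0) :=
      (mul_le_mul_of_nonneg_right h2 (by positivity)).trans hCm
    calc (3:ℝ) ^ p * (B'.card : ℝ) ^ 2 = 12 ^ p * ((1/2) ^ p * ((1/2) ^ p * (B'.card : ℝ) ^ 2)) := by
          rw [show (3:ℝ) = 12 * (1/2 * (1/2)) by norm_num, mul_pow, mul_pow]; ring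
      _ ≤ 12 ^ p * ∑ b ∈ B', ∑ b' ∈ B', (B.card * ∑ y, bal A B y * bal A B (b - b' - y)) ^ p :=
          mul_le_mul_of_nonneg_left ((mul_le_mul_of_nonneg_left h3 (by positivity)).trans h1) (by positivity)
      _ ≤ _ := mul_le_mul_of_nonneg_right hch (Finset.sum_nonneg fun _ _ => Finset.sum_nonneg fun _ _ => hpe.pow_nonneg _)
  have hup : ∑ b ∈ B', ∑ b' ∈ B', (1 + B.card * ∑ y, bal A B y * bal A B (y + (b - b'))) ^ q ≤
      1.001 ^ p * (∑ b ∈ B', ∑ b' ∈ B', F (b - b') ^ q + (B'.card : ℝ) ^ 2) := by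
    have hd : (1 + dd) ^ q ≤ 1.001 ^ p := by
      rw [hq, pow_mul]
      refine pow_le_pow_left₀ (by positivity) ?_ p
      calc (1 + dd) ^ 12 ≤ (1 + 1/2^19) ^ 12 := by gcongr
        _ ≤ 1.001 := by norm_num
    have e : (∑ b ∈ B', ∑ b' ∈ B', F (b - b') ^ q + (B'.card : ℝ) ^ 2) = ∑ b ∈ B', ∑ b' ∈ B', (F (b - b') ^ q + 1) := by
      simp_rw [Finset.sum_add_distrib]; simp; ring
    rw [e, Finset.mul_sum]
    refine Finset.sum_le_sum fun b hb => ?_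
    rw [Finset.mul_sum]
    refine Finset.sum_le_sum fun b' hb' => ?_
    have := bal_corr hl hε hreg hh A hA hAB (hB'd b hb b' hb')
    rw [← hB, ← hdd] at this
    rw [← hqe.pow_abs]
    refine (pow_le_pow_left₀ (abs_nonneg _) this q).trans ((pow_add_le (hF0 _) hdd0 q).trans ?_)
    refine mul_le_mul_of_nonneg_right hd ?_
    have := hF0 (b - b')
    positivity
  set FF := ∑ b ∈ B', ∑ b' ∈ B', F (b - b') ^ q with hFF
  have hmom : (2.8:ℝ) ^ p * (B'.card : ℝ) ^ 2 ≤ FF := by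
    have h1 := (hlow.trans hub).trans hup
    have h2 : (1.001:ℝ) ^ p * (2.9 ^ p * (B'.card : ℝ) ^ 2) ≤ 1.001 ^ p * (FF + (B'.card : ℝ) ^ 2) := by
      refine le_trans ?_ h1
      rw [← mul_assoc, ← mul_pow]
      refine mul_le_mul_of_nonneg_right (pow_le_pow_left₀ (by norm_num) (by norm_num) p) (sq_nonneg _)
    have h3 := le_of_mul_le_mul_left h2 (pow_pos (by norm_num) p)
    have h4 := mul_le_mul_of_nonneg_right (num1 hp40) (show 0 ≤ (B'.card : ℝ) ^ 2 by positivity)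
    linarith
  set rho := (A.card : ℝ) ^ 2 / B.card with hrho
  have hrho0 : 0 < rho := by positivity
  have hR : ∀ x, (R A x : ℝ) ^ q = rho ^ q * F x ^ q := by
    intro x; rw [← mul_pow]; congr 1; simp only [F, hrho]; field_simp
  have hTot : ∑ b ∈ B', ∑ b' ∈ B', (R A (b - b') : ℝ) ^ q = rho ^ q * FF := by
    simp_rw [hR, ← Finset.mul_sum]; rfl
  have hn2 := mul_le_mul_of_nonneg_right (num2 hp40) (show 0 ≤ (B'.card : ℝ) ^ 2 by positivity)
  have hone : (1:ℝ) ≤ 2.02 ^ p := one_le_pow₀ (by norm_num)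
  have hB2 : 0 < (B'.card : ℝ) ^ 2 := by positivity
  have hFFp : 0 < FF := lt_of_lt_of_le (by positivity) hmom
  set S := (univ.filter (fun x => 1.06 * (A.card : ℝ) ^ 2 ≤ B.card * R A x) : Finset G) with hS
  have hbad : ∑ b ∈ B', ∑ b' ∈ B', (if b - b' ∈ S then 0 else (R A (b - b') : ℝ) ^ q) ≤
      1/1000 * ∑ b ∈ B', ∑ b' ∈ B', (R A (b - b') : ℝ) ^ q := by
    rw [hTot]
    have h5 : ∑ b ∈ B', ∑ b' ∈ B', (if b - b' ∈ S then 0 else (R A (b - b') : ℝ) ^ q) ≤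
        ∑ b ∈ B', ∑ b' ∈ B', rho ^ q * 2.02 ^ p := by
      refine Finset.sum_le_sum fun b _ => Finset.sum_le_sum fun b' _ => ?_
      split_ifs with hs
      · positivity
      · rw [hR]
        rw [hS, Finset.mem_filter] at hs
        simp only [mem_univ, true_and, not_le] at hs
        have hF : F (b - b') ≤ 1.06 := by
          simp only [F]; rw [div_le_iff₀ (by positivity)]; exact hs.le
        have : F (b - b') ^ q ≤ 2.02 ^ p := by
          refine (pow_le_pow_left₀ (hF0 _) hF q).trans ?_
          rw [hq, pow_mul]
          exact pow_le_pow_left₀ (by norm_num) (by norm_num) p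
        exact mul_le_mul_of_nonneg_left this (by positivity)
    refine h5.trans ?_
    simp only [Finset.sum_const, nsmul_eq_mul]
    have h6 : (2.02:ℝ) ^ p * (B'.card : ℝ) ^ 2 ≤ 1/1000 * FF := by linarith
    have h7 := mul_le_mul_of_nonneg_left h6 (show 0 ≤ rho ^ q by positivity)
    linarith
  have hsm : ((A.card : ℝ) / B.card) ^ q * (B'.card : ℝ) ^ 2 * (A.card : ℝ) ^ q ≤ 1/1000 * ∑ b ∈ B', ∑ b' ∈ B', (R A (b - b') : ℝ) ^ q := by
    rw [hTot]
    have e : ((A.card : ℝ) / B.card) ^ q * (B'.card : ℝ) ^ 2 * (A.card : ℝ) ^ q = rho ^ q * (B'.card : ℝ) ^ 2 := by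
      have : rho = (A.card : ℝ) / B.card * A.card := by rw [hrho]; field_simp
      rw [this, mul_pow]; ring
    rw [e]
    have h6 : (B'.card : ℝ) ^ 2 ≤ 1/1000 * FF := by nlinarith
    have h7 := mul_le_mul_of_nonneg_left h6 (show 0 ≤ rho ^ q by positivity)
    linarith
  obtain ⟨A', h1, h2, h3, h4⟩ := sift A B' S q (δ := 1/1000) (κ := ((A.card : ℝ) / B.card) ^ q) (by norm_num) (by norm_num)
    (by positivity) (by rw [hTot]; positivity) hbad hsm
  · refine ⟨A', h1, h2, ?_, ?_⟩
    · have h5 : (1/2:ℝ) ^ (480 * L ^ 2) ≤ ((A.card : ℝ) / B.card) ^ q := by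
        have : (480 * L ^ 2) = L * q := by rw [hq, hp]; ring
        rw [this, pow_mul]
        refine pow_le_pow_left₀ (by positivity) ?_ q
        rw [le_div_iff₀ hBp, one_div, inv_pow, inv_mul_le_iff₀ (by positivity)]
        exact hAL
      have h6 := (mul_le_mul_of_nonneg_right h5 hB'p.le).trans h3
      rw [one_div, inv_pow, inv_mul_le_iff₀ (by positivity)] at h6
      exact h6
    · refine h4.trans (le_of_eq ?_)
      norm_num

end KM


namespace KM
open Finset

variable {G : Type} [AddCommGroup G] [Fintype G] [DecidableEq G]

lemma ball_nonempty (l : List (AddChar G ℂ × ℝ)) {r : ℝ} (hr : 0 ≤ r) : (ball l r).Nonempty :=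
  ⟨0, zero_mem_ball l hr⟩

lemma avg_translate {l : List (AddChar G ℂ × ℝ)} (hl : ∀ p ∈ l, 0 ≤ p.2) {r h ε : ℝ}
    (hreg : ((ball l (r + h)).card : ℝ) ≤ (1 + ε) * (ball l r).card) (hh : 0 ≤ h)
    (A : Finset G) (hAB : A ⊆ ball l r) (hB : (ball l r).Nonempty)
    (B' : Finset G) (hB'd : ∀ b ∈ B', ∀ b' ∈ B', b - b' ∈ ball l h) :
    ∃ x', ((A.card : ℝ) / (ball l r).card - ε) * (B'.card : ℝ) ^ 2 ≤
      ∑ b ∈ B', ∑ b' ∈ B', if x' - (b - b') ∈ A then (1:ℝ) else 0 := by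
  have hBp : (0:ℝ) < (ball l r).card := by exact_mod_cast hB.card_pos
  have key : ∀ b ∈ B', ∀ b' ∈ B', (A.card : ℝ) - ε * (ball l r).card ≤
      ∑ x ∈ ball l r, if x - (b - b') ∈ A then (1:ℝ) else 0 := by
    intro b hb b' hb'
    set d := b - b' with hd
    have h1 := regular_shift hl hreg (neg_mem_ball (hB'd b hb b' hb')) hh
    rw [Finset.sum_ite, Finset.sum_const_zero, add_zero, Finset.sum_const, nsmul_eq_mul, mul_one]
    have h2 : A.card ≤ ((ball l r).filter (fun y => y - -d ∉ ball l r)).card +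
        ((ball l r).filter (fun x => x - d ∈ A)).card := by
      have h3 : (A.filter (fun y => y + d ∈ ball l r)).card ≤ ((ball l r).filter (fun x => x - d ∈ A)).card := by
        refine Finset.card_le_card_of_injOn (fun y => y + d) ?_ (fun _ _ _ _ h => add_right_cancel h)
        intro y hy
        simp only [coe_filter, Set.mem_setOf_eq] at hy ⊢
        simpa using ⟨hy.2, hy.1⟩
      have h4 : (A.filter (fun y => ¬ (y + d ∈ ball l r))).card ≤ ((ball l r).filter (fun y => y - -d ∉ ball l r)).card := by
        refine Finset.card_le_card fun y hy => ?_
        simp only [mem_filter, sub_neg_eq_add] at hy ⊢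
        exact ⟨hAB hy.1, hy.2⟩
      have := Finset.card_filter_add_card_filter_not (s := A) (fun y => y + d ∈ ball l r)
      omega
    have h2' : (A.card : ℝ) ≤ ((ball l r).filter (fun y => y - -d ∉ ball l r)).card +
        ((ball l r).filter (fun x => x - d ∈ A)).card := by exact_mod_cast h2
    linarith
  have htot : ∑ x ∈ ball l r, ((A.card : ℝ) / (ball l r).card - ε) * (B'.card : ℝ) ^ 2 ≤
      ∑ x ∈ ball l r, ∑ b ∈ B', ∑ b' ∈ B', if x - (b - b') ∈ A then (1:ℝ) else 0 := by
    have e : ∑ x ∈ ball l r, ((A.card : ℝ) / (ball l r).card - ε) * (B'.card : ℝ) ^ 2 =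
        ∑ b ∈ B', ∑ b' ∈ B', ((A.card : ℝ) - ε * (ball l r).card) := by
      simp only [Finset.sum_const, nsmul_eq_mul]; field_simp
    rw [e]
    refine (Finset.sum_le_sum fun b hb => Finset.sum_le_sum fun b' hb' => key b hb b' hb').trans (le_of_eq ?_)
    rw [Finset.sum_comm (s := ball l r)]
    refine Finset.sum_congr rfl fun b _ => ?_
    rw [Finset.sum_comm]
  obtain ⟨x, _, hx⟩ := Finset.exists_le_of_sum_le hB htot
  exact ⟨x, hx⟩

lemma step_A {l : List (AddChar G ℂ × ℝ)} (hl : ∀ p ∈ l, 0 ≤ p.2) {r h r1 h1 ε : ℝ} (hε : 0 ≤ ε)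
    (hreg : ((ball l (r + h)).card : ℝ) ≤ (1 + ε) * (ball l r).card) (hh : 0 ≤ h)
    (A : Finset G) (hA : A.Nonempty) (hAB : A ⊆ ball l r) (L : ℕ) (hL : 1 ≤ L)
    (hAL : ((ball l r).card : ℝ) ≤ 2 ^ L * A.card) (hεL : ε * 2 ^ (L + 20) ≤ 1)
    (hr1 : 0 ≤ r1) (hr1h : 2 * r1 ≤ h) (hh1 : 0 ≤ h1)
    (hreg1 : ((ball l (r1 + h1)).card : ℝ) ≤ (1 + ε) * (ball l r1).card) :
    (∃ z, ∀ t ∈ ball l h1, ∃ a₁ ∈ A, ∃ a₂ ∈ A, ∃ a₃ ∈ A, z + t = a₁ + a₂ + a₃) ∨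
    ∃ A' ⊆ ball l r1, A'.Nonempty ∧ ((ball l r1).card : ℝ) ≤ 2 ^ (480 * L ^ 2) * A'.card ∧
      ∑ a ∈ A', ∑ a' ∈ A', (if a - a' ∈ (univ.filter (fun x => 1.06 * (A.card : ℝ) ^ 2 ≤ (ball l r).card * R A x) : Finset G)
        then (0:ℝ) else 1) ≤ 0.004 * (A'.card : ℝ) ^ 2 := by
  set B' := ball l r1 with hB'
  have hAp : (0:ℝ) < A.card := by exact_mod_cast hA.card_pos
  have hABc : (A.card : ℝ) ≤ (ball l r).card := by exact_mod_cast Finset.card_le_card hAB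
  have hBp : (0:ℝ) < (ball l r).card := lt_of_lt_of_le hAp hABc
  have hBne : (ball l r).Nonempty := hA.mono hAB
  have hB'ne : B'.Nonempty := ball_nonempty l hr1
  have hB'd : ∀ b ∈ B', ∀ b' ∈ B', b - b' ∈ ball l h := fun b hb b' hb' => 
    ball_mono l (by linarith) (sub_mem_ball hl hb hb')
  obtain ⟨x', hx'⟩ := avg_translate hl hreg hh A hAB hBne B' hB'd
  have hεa : 2 * ε ≤ A.card / (ball l r).card / 2 := by
    rw [le_div_iff₀ (by norm_num), le_div_iff₀ hBp]
    have h2 : 0 ≤ ε * (2 ^ L : ℝ) := by positivity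
    have h3 : ε * 2 ^ L * 4 ≤ 1 := by rw [pow_add] at hεL; norm_num at hεL; linarith
    have h4 := mul_le_mul_of_nonneg_left hAL (show 0 ≤ 4 * ε by positivity)
    have h5 := mul_le_mul_of_nonneg_right h3 hAp.le
    linarith
  by_cases hall : ∀ t ∈ ball l h1, ∃ a₁ ∈ A, ∃ a₂ ∈ A, ∃ a₃ ∈ A, x' + t = a₁ + a₂ + a₃
  · exact Or.inl ⟨x', hall⟩
  right
  push Not at hall
  obtain ⟨t, ht, hno⟩ := hall
  refine moment_sift hl hε hreg hh A hA hAB L hL hAL hεL B' hB'ne hB'd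
    (univ.filter (fun y => x' + t - y ∈ A)) ?_ ?_
  · intro y hy a ha hya
    rw [mem_filter] at hy
    exact hno _ hy.2 a ha _ hya (by abel)
  · have hsh := regular_shift hl hreg1 (neg_mem_ball ht) hh1
    rw [← hB'] at hsh
    have hB'p : (0:ℝ) < B'.card := by exact_mod_cast hB'ne.card_pos
    have hcmp : ∑ b ∈ B', ∑ b' ∈ B', (if x' - (b - b') ∈ A then (1:ℝ) else 0) ≤
        ∑ b ∈ B', ∑ b' ∈ B', (if b - b' ∈ (univ.filter (fun y => x' + t - y ∈ A) : Finset G) then (1:ℝ) else 0)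
        + ε * B'.card * B'.card := by
      rw [← Finset.sum_filter_add_sum_filter_not B' (fun b => b - -t ∈ B')]
      refine add_le_add ?_ ?_
      · have e : ∀ b b' : G, (if x' - (b - b') ∈ A then (1:ℝ) else 0) =
          (if (b - -t) - b' ∈ (univ.filter (fun y => x' + t - y ∈ A) : Finset G) then (1:ℝ) else 0) := by
          intro b b'
          simp only [mem_filter, mem_univ, true_and]
          have : x' + t - (b - -t - b') = x' - (b - b') := by abel
          rw [this]
        simp_rw [e]
        rw [← Finset.sum_image (s := B'.filter (fun b => b - -t ∈ B')) (g := fun b => b - -t)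
          (f := fun c => ∑ b' ∈ B', if c - b' ∈ (univ.filter (fun y => x' + t - y ∈ A) : Finset G) then (1:ℝ) else 0)
          (fun _ _ _ _ h => sub_left_injective h)]
        refine Finset.sum_le_sum_of_subset_of_nonneg ?_ (fun _ _ _ => Finset.sum_nonneg fun _ _ => by positivity)
        intro c hc
        rw [mem_image] at hc
        obtain ⟨b, hb, rfl⟩ := hc
        exact (mem_filter.1 hb).2
      · refine le_trans (b := ∑ b ∈ B' with ¬ (b - -t ∈ B'), (B'.card : ℝ)) ?_ ?_
        · refine Finset.sum_le_sum fun b _ => ?_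
          refine (Finset.sum_le_sum (g := fun _ => (1:ℝ)) fun b' _ => ?_).trans (by simp)
          split_ifs <;> norm_num
        · rw [Finset.sum_const, nsmul_eq_mul]
          exact mul_le_mul_of_nonneg_right hsh hB'p.le
    have e : (A.card : ℝ) / (4 * (ball l r).card) = A.card / (ball l r).card / 4 := by
      rw [div_div, mul_comm]
    rw [e]
    have hB2 : 0 ≤ (B'.card : ℝ) ^ 2 := by positivity
    have h6 : (A.card / (ball l r).card / 4 : ℝ) ≤ A.card / (ball l r).card - ε - ε := by
      have : 0 ≤ (A.card / (ball l r).card : ℝ) := by positivity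
      linarith
    have h7 := mul_le_mul_of_nonneg_right h6 hB2
    nlinarith

end KM


namespace KM
open Finset

variable {G : Type} [AddCommGroup G] [Fintype G] [DecidableEq G]

lemma two_pow_le_exp (w : ℕ) : (2:ℝ) ^ w ≤ Real.exp w := by
  have h := Real.add_one_le_exp (1:ℝ)
  have := pow_le_pow_left₀ (by norm_num) (show (2:ℝ) ≤ Real.exp 1 by linarith) w
  rwa [← Real.exp_nat_mul, mul_one] at this

lemma L_le_two_pow (L : ℕ) : (L:ℝ) ≤ 2 ^ L := by
  exact_mod_cast Nat.lt_two_pow_self.le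

lemma step_B {l : List (AddChar G ℂ × ℝ)} (hl : ∀ p ∈ l, 0 ≤ p.2) {r1 h1 r2 ε : ℝ}
    (hε1 : ε ≤ 1) (A' S : Finset G) (hA' : A'.Nonempty) (L : ℕ) (hL : 1 ≤ L)
    (hA'B : A' ⊆ ball l r1) (hA'c : ((ball l r1).card : ℝ) ≤ 2 ^ (480 * L ^ 2) * A'.card)
    (hreg1 : ((ball l (r1 + h1)).card : ℝ) ≤ (1 + ε) * (ball l r1).card)
    (hS : ∑ a ∈ A', ∑ a' ∈ A', (if a - a' ∈ S then (0:ℝ) else 1) ≤ 0.004 * (A'.card : ℝ) ^ 2)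
    (hr2 : 0 ≤ r2) (hr2h : (10 * L) * r2 ≤ h1) :
    ∃ T ⊆ ball l r2, T.Nonempty ∧
      ((ball l r2).card : ℝ) ≤ 2 ^ (481 * L ^ 2 * (12500000000 * L ^ 4) + 1) * T.card ∧
      ∀ u u' : Fin (5 * L) → G, (∀ i, u i ∈ T) → (∀ i, u' i ∈ T) →
        0.988 * (A'.card : ℝ) ^ 2 ≤ PP A' S (∑ i, (u i - u' i)) := by
  have hL1 : (1:ℝ) ≤ L := by exact_mod_cast hL
  have hA'p : (0:ℝ) < A'.card := by exact_mod_cast hA'.card_pos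
  set X := ball l (r1 + h1) with hX
  obtain ⟨m, hm⟩ : ∃ m, m = 12500000000 * L ^ 4 := ⟨_, rfl⟩
  rw [← hm]
  have hm0 : 0 < m := by rw [hm]; positivity
  have hXc : (X.card : ℝ) ≤ 2 ^ (481 * L ^ 2) * A'.card := by
    have h2 : (2:ℝ) ^ (481 * L ^ 2) = 2 ^ (480 * L^2) * 2 ^ (L^2) := by rw [← pow_add]; ring_nf
    have h3 : (2:ℝ) ≤ 2 ^ (L ^ 2) := by
      calc (2:ℝ) = 2 ^ 1 := by norm_num
        _ ≤ _ := pow_le_pow_right₀ (by norm_num) (Nat.one_le_pow _ _ hL)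
    have h4 : (X.card : ℝ) ≤ 2 * (ball l r1).card := by
      refine hreg1.trans (mul_le_mul_of_nonneg_right (by linarith) (by positivity))
    rw [h2]
    have h5 : 0 ≤ (2:ℝ) ^ (480 * L^2) * A'.card := by positivity
    nlinarith
  set δ : ℝ := 1 / (2500 * L) with hδ
  have hδ0 : 0 < δ := by positivity
  have hδ1 : δ ≤ 1 := by rw [hδ, div_le_one (by positivity)]; linarith
  have hr2h1 : r2 ≤ h1 := by nlinarith
  have hc1 : 4 * Real.exp (-(m * δ ^ 2 / 4)) * X.card ≤ δ * A'.card := by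
    have e : (m:ℝ) * δ ^ 2 / 4 = ((500 * L ^ 2 : ℕ) : ℝ) := by
      rw [hm, hδ]; push_cast; field_simp; norm_num
    rw [e, Real.exp_neg]
    have h1 := two_pow_le_exp (500 * L ^ 2)
    have h2 : 4 * (2:ℝ) ^ (481 * L ^ 2) * (2500 * L) ≤ 2 ^ (500 * L ^ 2) := by
      have h3 := L_le_two_pow L
      calc 4 * (2:ℝ) ^ (481 * L ^ 2) * (2500 * L) ≤ 4 * (2:ℝ) ^ (481 * L ^ 2) * (2 ^ 12 * 2 ^ L) := by
            gcongr; norm_num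
        _ = 2 ^ (2 + 481 * L ^ 2 + (12 + L)) := by rw [pow_add, pow_add, pow_add]; norm_num
        _ ≤ 2 ^ (500 * L ^ 2) := pow_le_pow_right₀ (by norm_num) (by nlinarith)
    have h4 := h2.trans h1
    have hE : 0 < Real.exp ((500 * L ^ 2 : ℕ) : ℝ) := Real.exp_pos _
    set E := Real.exp ((500 * L ^ 2 : ℕ) : ℝ)
    have h5 : 4 * (X.card : ℝ) * (2500 * L) ≤ E * A'.card := by
      have h6 := mul_le_mul_of_nonneg_right h4 hA'p.le
      have h7 := mul_le_mul_of_nonneg_right hXc (show (0:ℝ) ≤ 4 * (2500 * L) by positivity)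
      linarith
    rw [hδ, one_div, inv_mul_eq_div, le_div_iff₀ (by positivity)]
    rw [show 4 * E⁻¹ * (X.card : ℝ) * (2500 * L) = E⁻¹ * (4 * (X.card : ℝ) * (2500 * L)) by ring, inv_mul_le_iff₀ hE]
    exact h5
  have hc2 : ∀ a ∈ A', ∀ t ∈ ball l r2, a + t ∈ X := by
    intro a ha t ht
    exact ball_mono l (by linarith) (add_mem_ball hl (hA'B ha) ht)
  obtain ⟨T, hTB, hTc, hT⟩ := croot_sisask A' S X (ball l r2) hA' hδ0 hδ1 hδ0 m hm0 hc1 hc2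
  · have hBp : (0:ℝ) < (ball l r2).card := by exact_mod_cast (ball_nonempty l hr2).card_pos
    refine ⟨T, hTB, ?_, ?_, ?_⟩
    · rw [Finset.nonempty_iff_ne_empty]; rintro rfl
      simp only [card_empty, Nat.cast_zero, mul_zero] at hTc
      have : 0 < (A'.card : ℝ) ^ m * (ball l r2).card := by positivity
      linarith
    · have h1 := pow_le_pow_left₀ (by positivity) hXc m
      rw [mul_pow] at h1
      have hTn : (0:ℝ) ≤ T.card := by positivity
      have h2 : (A'.card : ℝ) ^ m * (ball l r2).card ≤ A'.card ^ m * (2 ^ (481 * L ^ 2 * m + 1) * T.card) := by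
        refine hTc.trans ?_
        rw [pow_succ, pow_mul]
        have := mul_le_mul_of_nonneg_right h1 hTn
        linarith
      exact le_of_mul_le_mul_left h2 (by positivity)
    · intro u u' hu hu'
      have h0 : 0.996 * (A'.card : ℝ) ^ 2 ≤ PP A' S 0 := by
        have e : PP A' S 0 + ∑ a ∈ A', ∑ a' ∈ A', (if a - a' ∈ S then (0:ℝ) else 1) = (A'.card : ℝ) ^ 2 := by
          unfold PP
          simp only [add_zero, ← Finset.sum_add_distrib]
          have : ∀ a a' : G, ((if a - a' ∈ S then (1:ℝ) else 0) + if a - a' ∈ S then (0:ℝ) else 1) = 1 := by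
            intro a a'; split_ifs <;> norm_num
          simp_rw [this]
          simp; ring
        linarith
      have hmem : ∀ (n : ℕ) (hn : n ≤ 5 * L) (a : G), a ∈ A' → 
          a + ∑ i : Fin n, (u (Fin.castLE hn i) - u' (Fin.castLE hn i)) ∈ X := by
        intro n hn a ha
        have h1 := sum_mem_ball hl (fun i : Fin n => u (Fin.castLE hn i) - u' (Fin.castLE hn i)) 
          (fun i => sub_mem_ball hl (hTB (hu (Fin.castLE hn i))) (hTB (hu' (Fin.castLE hn i))))
        refine ball_mono l ?_ (add_mem_ball hl (hA'B ha) h1)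
        have : (n:ℝ) ≤ 5 * L := by exact_mod_cast hn
        nlinarith
      have tele : ∀ (n : ℕ) (hn : n ≤ 5 * L), PP A' S 0 - n * (2 * (δ + δ) * (A'.card : ℝ) ^ 2) ≤
          PP A' S (∑ i : Fin n, (u (Fin.castLE hn i) - u' (Fin.castLE hn i))) := by
        intro n
        induction n with
        | zero => intro hn; simp
        | succ n ih =>
          intro hn
          have h1 := ih (by omega)
          have h2 := hT _ (hu (Fin.castLE hn (Fin.last n))) _ (hu' (Fin.castLE hn (Fin.last n)))
            (∑ i : Fin n, (u (Fin.castLE (by omega) i) - u' (Fin.castLE (by omega) i)))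
            (fun a ha => hmem n (by omega) a ha) (fun a ha => by
              have := hmem (n+1) hn a ha
              rw [Fin.sum_univ_castSucc] at this
              exact this)
          rw [Fin.sum_univ_castSucc]
          push_cast
          refine le_trans ?_ h2
          linarith
      have h3 := tele (5 * L) le_rfl
      refine le_trans ?_ h3
      have h4 : ((5 * L : ℕ) : ℝ) * (2 * (δ + δ) * (A'.card : ℝ) ^ 2) = 0.008 * (A'.card : ℝ) ^ 2 := by
        rw [hδ]; push_cast; field_simp; norm_num
      linarith

end KM


namespace KM
open Finset

variable {G : Type} [AddCommGroup G] [Fintype G] [DecidableEq G]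

lemma QQ_ge (A A' : Finset G) {b : ℝ} (hb : 0 < b) (t : G)
    (h : 0.988 * (A'.card : ℝ) ^ 2 ≤ PP A' (univ.filter (fun x => 1.06 * (A.card : ℝ) ^ 2 ≤ b * R A x) : Finset G) t) :
    1.047 * (A.card / b) * ((A'.card : ℝ) ^ 2 * A.card) ≤ QQ A A' t := by
  have h1 : 1.06 * (A.card : ℝ) ^ 2 / b * PP A' (univ.filter (fun x => 1.06 * (A.card : ℝ) ^ 2 ≤ b * R A x) : Finset G) t ≤ QQ A A' t := by
    unfold PP QQ
    rw [Finset.mul_sum]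
    refine Finset.sum_le_sum fun a _ => ?_
    rw [Finset.mul_sum]
    refine Finset.sum_le_sum fun a' _ => ?_
    split_ifs with hs
    · rw [mem_filter] at hs
      rw [mul_one, div_le_iff₀ hb, mul_comm]; rw [mul_comm (R A _ : ℝ)]; linarith [hs.2]
    · rw [mul_zero]; positivity
  refine le_trans ?_ h1
  have h2 := mul_le_mul_of_nonneg_left h (show 0 ≤ 1.06 * (A.card : ℝ) ^ 2 / b by positivity)
  refine le_trans ?_ h2
  have e1 : 1.047 * (A.card / b) * ((A'.card : ℝ) ^ 2 * A.card) = 1.047 * ((A.card : ℝ) ^ 2 / b * (A'.card : ℝ) ^ 2) := by ring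
  have e2 : 1.06 * (A.card : ℝ) ^ 2 / b * (0.988 * (A'.card : ℝ) ^ 2) = 1.06 * 0.988 * ((A.card : ℝ) ^ 2 / b * (A'.card : ℝ) ^ 2) := by ring
  rw [e1, e2]
  refine mul_le_mul_of_nonneg_right (by norm_num) (by positivity)

lemma step_C {l : List (AddChar G ℂ × ℝ)} (hl : ∀ p ∈ l, 0 ≤ p.2) {r2 h2 r3 h3 ε : ℝ}
    (hε0 : 0 ≤ ε) (hε1 : 6 * ε ≤ 0.001) (T : Finset G) (hT : T.Nonempty) (hTB : T ⊆ ball l r2) (K M : ℕ)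
    (hTc : ((ball l r2).card : ℝ) ≤ 2 ^ K * T.card) (hKM : 16 * (K + 2) ≤ M)
    (hreg2 : ((ball l (r2 + h2)).card : ℝ) ≤ (1 + ε) * (ball l r2).card)
    (hr3 : 0 ≤ r3) (hr3h : (M + 1) * r3 ≤ h2) (hh3 : 0 ≤ h3)
    (hreg3 : ((ball l (r3 + h3)).card : ℝ) ≤ (1 + ε) * (ball l r3).card) :
    ∃ m ≤ M, ∃ lam : Fin m → AddChar G ℂ, ∀ γ, (T.card : ℝ) / 2 ≤ ‖hat T γ‖ → ∀ v ∈ ball l h3,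
      ∀ w : ℝ, 0 ≤ w → M * w ≤ 0.001 → (∀ i, ‖1 - lam i v‖ ≤ w) → ‖1 - γ v‖ ≤ 0.005 := by
  have hTp : (0:ℝ) < T.card := by exact_mod_cast hT.card_pos
  have hc1 : ∀ d : Fin (M+1) → G, (∀ j, d j ∈ ball l r3) → ∀ b ∈ T, b - ∑ j, d j ∈ ball l (r2 + h2) := by
    intro d hd b hb
    refine ball_mono l ?_ (sub_mem_ball hl (hTB hb) (sum_mem_ball hl d hd))
    push_cast; linarith
  have hc2 : 2 * ((ball l (r2 + h2)).card : ℝ) < T.card * Real.exp (((M+1:ℕ):ℝ)/16) := by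
    have h1 : 2 * ((ball l (r2 + h2)).card : ℝ) ≤ 2 ^ (K + 2) * T.card := by
      rw [pow_add]
      have : (1 + ε) * ((ball l r2).card : ℝ) ≤ 2 * (ball l r2).card := 
        mul_le_mul_of_nonneg_right (by linarith) (by positivity)
      linarith
    have h3 : (2:ℝ) ^ (K + 2) < Real.exp (((M+1:ℕ):ℝ)/16) := by
      refine (two_pow_le_exp (K+2)).trans_lt (Real.exp_lt_exp.2 ?_)
      rw [lt_div_iff₀ (by norm_num)]
      have : (K + 2) * 16 < M + 1 := by omega
      exact_mod_cast this
    have := mul_lt_mul_of_pos_right h3 hTp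
    linarith
  obtain ⟨m, hm, lam, hlam⟩ := chang (ball l r3) (ball l (r2 + h2)) T (ball_nonempty l hr3) hT M hc1 hc2
  refine ⟨m, hm, lam, fun γ hγ v hv w hw0 hw hwl => ?_⟩
  obtain ⟨e, he, χ, hχ, hor⟩ := hlam γ hγ
  have h1 := large_char_le hl hr3 hreg3 hv hh3 χ hχ
  have h2 := cmb_le lam e he v hwl
  have h3 := char_add_apply_le χ (cmb lam e) v
  have h4 : (m:ℝ) * w ≤ M * w := mul_le_mul_of_nonneg_right (by exact_mod_cast hm) hw0
  have h5 : ‖1 - (χ + cmb lam e) v‖ ≤ 0.005 := by linarith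
  rcases hor with h | h
  · rw [h]; exact h5
  · rw [← h, AddChar.neg_apply, char_neg_eq] at h5
    exact h5

lemma exists_reg {l : List (AddChar G ℂ × ℝ)} (hl : ∀ p ∈ l, 0 ≤ p.2) (L Dm : ℕ) (hDm : 1 ≤ Dm) (hlen : l.length ≤ Dm)
    {ρ : ℝ} (hρ : 0 < ρ) : ∃ r, ρ / 2 ≤ r ∧ r ≤ ρ ∧
      ((ball l (r + 1 / (14 * 2 ^ (L + 20) * Dm) * ρ)).card : ℝ) ≤ (1 + 1 / 2 ^ (L + 20)) * (ball l r).card := by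
  have hn : (81:ℝ) ^ l.length ≤ (1 + 1 / 2 ^ (L + 20)) ^ (2 ^ (L + 20) * (7 * Dm)) := by
    have h2 : (2:ℝ) ≤ (1 + 1 / 2 ^ (L + 20)) ^ (2 ^ (L + 20)) := by
      have h0 : (0:ℝ) < 1 / 2 ^ (L + 20) := by positivity
      have := one_add_mul_le_pow (a := (1:ℝ) / 2 ^ (L + 20)) (by linarith) (2 ^ (L+20))
      push_cast at this
      rw [mul_one_div_cancel (by positivity)] at this
      linarith
    rw [pow_mul]
    calc (81:ℝ) ^ l.length ≤ (2 ^ 7) ^ l.length := by gcongr; norm_num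
      _ ≤ (2 ^ 7) ^ Dm := pow_le_pow_right₀ (by norm_num) hlen
      _ = 2 ^ (7 * Dm) := by rw [pow_mul]
      _ ≤ _ := pow_le_pow_left₀ (by norm_num) h2 _
  obtain ⟨r, h1, h2, h3⟩ := exists_regular l hl (show (0:ℝ) < 1 / 2 ^ (L + 20) by positivity) hρ 
    (2 ^ (L + 20) * (7 * Dm)) (by positivity) hn
  refine ⟨r, h1, h2, ?_⟩
  have e : ρ / (2 * ((2 ^ (L + 20) * (7 * Dm) : ℕ) : ℝ)) = 1 / (14 * 2 ^ (L + 20) * Dm) * ρ := by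
    push_cast; field_simp; norm_num
  rw [e] at h3
  exact h3

end KM


namespace KM
open Finset

variable {G : Type} [AddCommGroup G] [Fintype G] [DecidableEq G]

noncomputable def sig (L Dm : ℕ) : ℝ := 1 / (14 * 2 ^ (L + 20) * Dm)
def Mf (L : ℕ) : ℕ := 100000000000000 * L ^ 6
noncomputable def hf1 (L Dm : ℕ) : ℝ := sig L Dm * (sig L Dm / 2)
noncomputable def hf2 (L Dm : ℕ) : ℝ := sig L Dm * (hf1 L Dm / (10 * L))
noncomputable def hf3 (L Dm : ℕ) : ℝ := sig L Dm * (hf2 L Dm / (Mf L + 1))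

lemma sig_pos (L Dm : ℕ) (h : 1 ≤ Dm) : 0 < sig L Dm := by
  unfold sig; have : (0:ℝ) < Dm := by exact_mod_cast h
  positivity

lemma sig_le (L Dm : ℕ) (h : 1 ≤ Dm) : sig L Dm ≤ 1 / 1000 := by
  unfold sig
  have h1 : (1:ℝ) ≤ Dm := by exact_mod_cast h
  have h2 : (1000:ℝ) ≤ 2 ^ (L + 20) := by
    rw [pow_add]; have : (1:ℝ) ≤ 2 ^ L := one_le_pow₀ (by norm_num)
    norm_num; linarith
  apply one_div_le_one_div_of_le (by norm_num)
  nlinarith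

set_option maxHeartbeats 1000000 in
lemma full_step (l : List (AddChar G ℂ × ℝ)) (hl : ∀ p ∈ l, 0 ≤ p.2) (L Dm : ℕ) (hL : 1 ≤ L) (hDm : 1 ≤ Dm)
    (hlen : l.length ≤ Dm) (A : Finset G) {α : ℝ} (hα : 1 / 2 ^ L ≤ α)
    (hden : ∀ r : ℝ, 0 < r → r ≤ 1 → ∃ x, α * (ball l r).card ≤ ((ball l r).filter (fun v => x + v ∈ A)).card) :
    (∃ z, ∀ t ∈ ball l (hf1 L Dm), ∃ a₁ ∈ A, ∃ a₂ ∈ A, ∃ a₃ ∈ A, z + t = a₁ + a₂ + a₃) ∨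
    ∃ l' : List (AddChar G ℂ × ℝ), (∀ p ∈ l', 0 ≤ p.2) ∧ l'.length ≤ l.length + Mf L ∧
      (∀ W : ℝ, 1 ≤ W → (∀ p ∈ l, p.2 ≤ W) → ∀ p ∈ l', p.2 ≤ W * (1 / hf3 L Dm)) ∧
      ∀ r : ℝ, 0 < r → r ≤ 1 → ∃ x, 1.02 * α * (ball l' r).card ≤ ((ball l' r).filter (fun v => x + v ∈ A)).card := by
  have hL1 : (1:ℝ) ≤ L := by exact_mod_cast hL
  have hs0 := sig_pos L Dm hDm
  have hs1 := sig_le L Dm hDm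
  have hM1 : (1:ℝ) ≤ Mf L := by
    have : 1 ≤ Mf L := by unfold Mf; have := Nat.one_le_pow 6 L hL; omega
    exact_mod_cast this
  have hh1 : 0 < hf1 L Dm := by unfold hf1; positivity
  have hh2 : 0 < hf2 L Dm := by unfold hf2; positivity
  have hh3 : 0 < hf3 L Dm := by unfold hf3; positivity
  set ε : ℝ := 1 / 2 ^ (L + 20) with hε
  have hε0 : 0 ≤ ε := by positivity
  have hεL : ε * 2 ^ (L + 20) ≤ 1 := by rw [hε, one_div_mul_cancel (by positivity)]
  have hε1 : 6 * ε ≤ 0.001 := by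
    have : (1:ℝ) ≤ 2 ^ L := one_le_pow₀ (by norm_num)
    rw [pow_add] at hεL
    have h3 : ε * 1 ≤ ε * 2 ^ L := mul_le_mul_of_nonneg_left this hε0
    norm_num at hεL ⊢
    linarith
  have hα0 : 0 < α := lt_of_lt_of_le (by positivity) hα
  obtain ⟨r0, hr0, hr0', hreg0⟩ := exists_reg hl L Dm hDm hlen (show (0:ℝ) < 1 by norm_num)
  obtain ⟨r1, hr1, hr1', hreg1⟩ := exists_reg hl L Dm hDm hlen (show (0:ℝ) < sig L Dm / 2 by positivity)
  obtain ⟨r2, hr2, hr2', hreg2⟩ := exists_reg hl L Dm hDm hlen (show (0:ℝ) < hf1 L Dm / (10 * L) by positivity)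
  obtain ⟨r3, hr3, hr3', hreg3⟩ := exists_reg hl L Dm hDm hlen (show (0:ℝ) < hf2 L Dm / (Mf L + 1) by positivity)
  rw [mul_one] at hreg0
  rw [← hε] at hreg0 hreg1 hreg2 hreg3
  change ((ball l (r0 + sig L Dm)).card : ℝ) ≤ _ at hreg0
  change ((ball l (r1 + hf1 L Dm)).card : ℝ) ≤ _ at hreg1
  change ((ball l (r2 + hf2 L Dm)).card : ℝ) ≤ _ at hreg2
  change ((ball l (r3 + hf3 L Dm)).card : ℝ) ≤ _ at hreg3
  have hr1p : 0 ≤ r1 := by linarith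
  have hr2p : 0 ≤ r2 := le_trans (by positivity) hr2
  have hr3p : 0 ≤ r3 := le_trans (by positivity) hr3
  have hr2h : (10 * L) * r2 ≤ hf1 L Dm := by
    rw [le_div_iff₀ (by positivity)] at hr2'; linarith
  have hr3h : (Mf L + 1) * r3 ≤ hf2 L Dm := by
    rw [le_div_iff₀ (by positivity)] at hr3'; linarith
  obtain ⟨x, hx⟩ := hden r0 (by linarith) hr0'
  set A0 := (ball l r0).filter (fun v => x + v ∈ A) with hA0
  have hA0B : A0 ⊆ ball l r0 := Finset.filter_subset _ _
  have hBp : (0:ℝ) < (ball l r0).card := by exact_mod_cast (ball_nonempty l (by linarith)).card_pos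
  have hA0p : (0:ℝ) < A0.card := lt_of_lt_of_le (by positivity) hx
  have hA0ne : A0.Nonempty := by rw [← Finset.card_pos]; exact_mod_cast hA0p
  have hα2 : 1 ≤ α * 2 ^ L := by rwa [div_le_iff₀ (by positivity)] at hα
  have hA0L : ((ball l r0).card : ℝ) ≤ 2 ^ L * A0.card := by
    have h5 := mul_le_mul_of_nonneg_left hx (show (0:ℝ) ≤ 2 ^ L by positivity)
    have h6 := mul_le_mul_of_nonneg_right hα2 hBp.le
    linarith
  rcases step_A hl hε0 hreg0 hs0.le A0 hA0ne hA0B L hL hA0L hεL hr1p (by linarith) hh1.le hreg1 with hcase | hcase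
  · left
    obtain ⟨z, hz⟩ := hcase
    refine ⟨x + x + x + z, fun t ht => ?_⟩
    obtain ⟨a₁, h1, a₂, h2, a₃, h3, he⟩ := hz t ht
    refine ⟨x + a₁, (mem_filter.1 h1).2, x + a₂, (mem_filter.1 h2).2, x + a₃, (mem_filter.1 h3).2, ?_⟩
    rw [add_assoc, he]; abel
  right
  obtain ⟨A', hA'B, hA'ne, hA'c, hA'S⟩ := hcase
  obtain ⟨T, hTB, hTne, hTc, hTP⟩ := step_B hl (by linarith) A' _ hA'ne L hL hA'B hA'c hreg1 hA'S hr2p hr2h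
  have hKM : 16 * (481 * L ^ 2 * (12500000000 * L ^ 4) + 1 + 2) ≤ Mf L := by
    unfold Mf
    have h1 : 481 * L ^ 2 * (12500000000 * L ^ 4) = 6012500000000 * L ^ 6 := by ring
    have := Nat.one_le_pow 6 L hL
    rw [h1]; omega
  obtain ⟨m, hm, lam, hlam⟩ := step_C hl hε0 hε1 T hTne hTB _ (Mf L) hTc hKM hreg2 hr3p hr3h hh3.le hreg3
  have hh3M : 1000 * (Mf L : ℝ) ≤ 1 / hf3 L Dm := by
    rw [le_div_iff₀ hh3]
    have h1 : hf1 L Dm ≤ 1 := by unfold hf1; nlinarith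
    have h2 : hf2 L Dm ≤ 1 := by
      unfold hf2
      have : hf1 L Dm / (10 * L) ≤ 1 := by rw [div_le_one (by positivity)]; linarith
      have h0 : 0 ≤ hf1 L Dm / (10 * L) := by positivity
      nlinarith
    have h3 : hf2 L Dm / (Mf L + 1) * Mf L ≤ 1 := by
      rw [div_mul_eq_mul_div, div_le_one (by positivity)]; nlinarith
    have h4 : 0 ≤ hf2 L Dm / (Mf L + 1) * Mf L := by positivity
    unfold hf3; nlinarith
  have h3le : 1 ≤ 1 / hf3 L Dm := by linarith
  refine ⟨l.map (fun p => (p.1, p.2 / hf3 L Dm)) ++ (List.ofFn lam).map (fun χ => (χ, 1000 * (Mf L : ℝ))), ?_, ?_, ?_, ?_⟩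
  · intro p hp
    rw [List.mem_append, List.mem_map, List.mem_map] at hp
    rcases hp with ⟨q, hq, rfl⟩ | ⟨q, hq, rfl⟩
    · exact div_nonneg (hl q hq) hh3.le
    · simp only; positivity
  · simp; omega
  · intro W hW hlW p hp
    rw [List.mem_append, List.mem_map, List.mem_map] at hp
    rcases hp with ⟨q, hq, rfl⟩ | ⟨q, hq, rfl⟩
    · simp only [div_eq_mul_one_div (q.2)]
      exact mul_le_mul_of_nonneg_right (hlW q hq) (by positivity)
    · simp only; nlinarith
  · intro r hr hr'
    set l' := l.map (fun p => (p.1, p.2 / hf3 L Dm)) ++ (List.ofFn lam).map (fun χ => (χ, 1000 * (Mf L : ℝ))) with hl'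
    have hV : ∀ v ∈ ball l' r, v ∈ ball l (hf3 L Dm) ∧ ∀ i, ‖1 - lam i v‖ ≤ 1 / (1000 * Mf L) := by
      intro v hv
      rw [mem_ball] at hv
      constructor
      · rw [mem_ball]; intro p hp
        have := hv (p.1, p.2 / hf3 L Dm) (by rw [hl', List.mem_append]; left; exact List.mem_map.2 ⟨p, hp, rfl⟩)
        simp only at this
        rw [div_mul_eq_mul_div, div_le_iff₀ hh3] at this
        nlinarith
      · intro i
        have := hv (lam i, 1000 * (Mf L : ℝ)) (by rw [hl', List.mem_append]; right; exact List.mem_map.2 ⟨lam i, by simp, rfl⟩)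
        simp only at this
        rw [le_div_iff₀ (by positivity)]
        linarith
    set β0 := (A0.card : ℝ) / (ball l r0).card with hβ0
    have hβ0α : α ≤ β0 := by rw [hβ0, le_div_iff₀ hBp]; exact hx
    have h4k : (1/4:ℝ) ^ (5 * L) ≤ 0.01 * β0 := by
      have h5 : (1/4:ℝ) ^ (5 * L) ≤ 0.01 * (1 / 2 ^ L) := by
        have e1 : (1/4:ℝ) ^ (5 * L) = (1 / 2 ^ L) * (1/512) ^ L := by
          rw [pow_mul, show (1/4:ℝ) ^ 5 = 1/2 * (1/512) by norm_num, mul_pow, one_div_pow]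
        have e2 : (1/512:ℝ) ^ L ≤ 1/512 := by
          calc (1/512:ℝ) ^ L ≤ (1/512) ^ 1 := pow_le_pow_of_le_one (by norm_num) (by norm_num) hL
            _ = 1/512 := pow_one _
        rw [e1]
        have : (0:ℝ) ≤ 1 / 2 ^ L := by positivity
        nlinarith
      linarith
    have hVne : (ball l' r).Nonempty := ball_nonempty l' hr.le
    obtain ⟨z, hz⟩ := spectral_inc A0 A' T (ball l' r) hA0ne hA'ne hTne hVne (5 * L) (β := 1.047 * β0) (η := 0.005)
      (by norm_num) (by norm_num) (fun u u' hu hu' => QQ_ge A0 A' hBp _ (hTP u u' hu hu')) (by linarith)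
      (fun ψ hψ v hv => hlam ψ hψ v (hV v hv).1 (1 / (1000 * Mf L)) (by positivity)
        (by rw [mul_one_div, div_le_iff₀ (by positivity)]; linarith) (hV v hv).2)
    refine ⟨x + z, ?_⟩
    have h8 : ((ball l' r).filter (fun v => z + v ∈ A0)).card ≤ ((ball l' r).filter (fun v => x + z + v ∈ A)).card := by
      refine Finset.card_le_card fun v hv => ?_
      rw [mem_filter] at hv ⊢
      refine ⟨hv.1, ?_⟩
      have := (mem_filter.1 hv.2).2
      rwa [← add_assoc] at this
    have h9 : (((ball l' r).filter (fun v => z + v ∈ A0)).card : ℝ) ≤ ((ball l' r).filter (fun v => x + z + v ∈ A)).card := by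
      exact_mod_cast h8
    refine le_trans ?_ (hz.trans h9)
    refine mul_le_mul_of_nonneg_right ?_ (by positivity)
    norm_num at h4k ⊢
    linarith

end KM


namespace KM
open Finset

variable {G : Type} [AddCommGroup G] [Fintype G] [DecidableEq G]

lemma hf3_bounds (L Dm : ℕ) (hL : 1 ≤ L) (hDm : 1 ≤ Dm) : 0 < hf3 L Dm ∧ hf3 L Dm ≤ 1 ∧ 0 < hf1 L Dm := by
  have hL1 : (1:ℝ) ≤ L := by exact_mod_cast hL
  have hs0 := sig_pos L Dm hDm
  have hs1 := sig_le L Dm hDm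
  have hM0 : (0:ℝ) ≤ Mf L := Nat.cast_nonneg _
  have hh1 : 0 < hf1 L Dm := by unfold hf1; positivity
  have hh2 : 0 < hf2 L Dm := by unfold hf2; positivity
  have hh3 : 0 < hf3 L Dm := by unfold hf3; positivity
  refine ⟨hh3, ?_, hh1⟩
  have h1 : hf1 L Dm ≤ 1 := by unfold hf1; nlinarith
  have h2 : hf2 L Dm ≤ 1 := by
    unfold hf2
    have : hf1 L Dm / (10 * L) ≤ 1 := by rw [div_le_one (by positivity)]; linarith
    have h0 : 0 ≤ hf1 L Dm / (10 * L) := by positivity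
    nlinarith
  have h3 : hf2 L Dm / (Mf L + 1) ≤ 1 := by rw [div_le_one (by positivity)]; linarith
  have h4 : 0 ≤ hf2 L Dm / (Mf L + 1) := by positivity
  unfold hf3; nlinarith

def Df (L : ℕ) : ℕ := 40 * L * Mf L

lemma Df_pos (L : ℕ) (hL : 1 ≤ L) : 1 ≤ Df L := by
  unfold Df Mf
  have : 0 < L := hL
  exact Nat.succ_le_of_lt (by positivity)

lemma iterate_step (L : ℕ) (hL : 1 ≤ L) (A : Finset G) (hA : (Fintype.card G : ℝ) ≤ 2 ^ L * A.card) :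
    ∃ l : List (AddChar G ℂ × ℝ), (∀ p ∈ l, 0 ≤ p.2) ∧ l.length ≤ Df L ∧ (∀ p ∈ l, p.2 ≤ (1 / hf3 L (Df L)) ^ (40 * L)) ∧
      ∃ z, ∀ t ∈ ball l (hf1 L (Df L)), ∃ a₁ ∈ A, ∃ a₂ ∈ A, ∃ a₃ ∈ A, z + t = a₁ + a₂ + a₃ := by
  by_contra hcon
  obtain ⟨h30, h31, _⟩ := hf3_bounds L (Df L) hL (Df_pos L hL)
  set W := 1 / hf3 L (Df L) with hW
  have hW1 : 1 ≤ W := by rw [hW, le_div_iff₀ h30]; linarith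
  have key : ∀ n : ℕ, n ≤ 40 * L → ∃ l : List (AddChar G ℂ × ℝ), (∀ p ∈ l, 0 ≤ p.2) ∧ l.length ≤ n * Mf L ∧
      (∀ p ∈ l, p.2 ≤ W ^ n) ∧ 
      ∀ r : ℝ, 0 < r → r ≤ 1 → ∃ x, (1.02 ^ n * (1 / 2 ^ L)) * ((ball l r).card : ℝ) ≤ ((ball l r).filter (fun v => x + v ∈ A)).card := by
    intro n
    induction n with
    | zero =>
      intro _
      refine ⟨[], by simp, by simp, by simp, fun r hr _ => ⟨0, ?_⟩⟩
      have e : ball ([] : List (AddChar G ℂ × ℝ)) r = univ := by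
        ext x; simp [mem_ball]
      rw [e]
      have e2 : (univ.filter (fun v : G => 0 + v ∈ A)) = A := by ext; simp
      rw [e2, pow_zero, one_mul, card_univ, one_div, inv_mul_le_iff₀ (by positivity)]
      exact hA
    | succ n ih =>
      intro hn
      obtain ⟨l, hl, hlen, hlW, hd⟩ := ih (by omega)
      have hlenD : l.length ≤ Df L := hlen.trans (Nat.mul_le_mul_right _ (by omega))
      have h102 : (1:ℝ) ≤ 1.02 ^ n := one_le_pow₀ (by norm_num)
      have hp : (0:ℝ) < 1 / 2 ^ L := by positivity
      rcases full_step l hl L (Df L) hL (Df_pos L hL) hlenD A (α := 1.02 ^ n * (1 / 2 ^ L)) (by nlinarith) hd with h | h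
      · exfalso
        refine hcon ⟨l, hl, hlenD, fun p hp => (hlW p hp).trans (pow_le_pow_right₀ hW1 (by omega)), h⟩
      · obtain ⟨l', h1, h2, h3, h4⟩ := h
        refine ⟨l', h1, ?_, ?_, ?_⟩
        · rw [add_mul, one_mul]; omega
        · intro p hp
          rw [pow_succ]
          exact h3 (W ^ n) (one_le_pow₀ hW1) hlW p hp
        · intro r hr hr'
          obtain ⟨x, hx⟩ := h4 r hr hr'
          refine ⟨x, le_trans (le_of_eq ?_) hx⟩
          rw [pow_succ]; ring
  obtain ⟨l, hl, _, _, hd⟩ := key (36 * L + 1) (by omega)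
  obtain ⟨x, hx⟩ := hd 1 one_pos le_rfl
  have h1 : (((ball l 1).filter (fun v => x + v ∈ A)).card : ℝ) ≤ (ball l 1).card := by
    exact_mod_cast Finset.card_filter_le _ _
  have hp : (0:ℝ) < (ball l 1).card := by exact_mod_cast (ball_nonempty l zero_le_one).card_pos
  have h2 : (1:ℝ) < 1.02 ^ (36 * L + 1) * (1 / 2 ^ L) := by
    rw [mul_one_div, one_lt_div (by positivity), pow_succ, pow_mul]
    have : (2:ℝ) ^ L ≤ (1.02 ^ 36) ^ L := pow_le_pow_left₀ (by norm_num) (by norm_num) L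
    have h0 : (0:ℝ) < 2 ^ L := by positivity
    nlinarith
  nlinarith

end KM


namespace KM
open Finset

variable {G : Type} [AddCommGroup G] [Fintype G] [DecidableEq G]

lemma two_pow_mono {a b : ℕ} (h : a ≤ b) : (2:ℝ) ^ a ≤ 2 ^ b := pow_le_pow_right₀ (by norm_num) h

lemma Df_eq (L : ℕ) : (Df L : ℝ) = 4000000000000000 * (L:ℝ) ^ 7 := by
  unfold Df Mf; push_cast; ring

lemma Df_le (L : ℕ) (hL : 1 ≤ L) : (Df L : ℝ) ≤ 2 ^ (59 * L) := by
  rw [Df_eq]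
  have h1 := pow_le_pow_left₀ (Nat.cast_nonneg L) (L_le_two_pow L) 7
  calc 4000000000000000 * (L:ℝ) ^ 7 ≤ 2 ^ 52 * (2 ^ L) ^ 7 := by gcongr; norm_num
    _ = 2 ^ (52 + L * 7) := by rw [pow_add, pow_mul]
    _ ≤ _ := two_pow_mono (by omega)

lemma Mf_le (L : ℕ) (hL : 1 ≤ L) : (Mf L : ℝ) + 1 ≤ 2 ^ (54 * L) := by
  have h1 := pow_le_pow_left₀ (Nat.cast_nonneg L) (L_le_two_pow L) 6
  have e : (Mf L : ℝ) = 100000000000000 * (L:ℝ) ^ 6 := by unfold Mf; push_cast; ring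
  have h2 : (1:ℝ) ≤ (2 ^ L) ^ 6 := one_le_pow₀ (one_le_pow₀ (by norm_num))
  calc (Mf L : ℝ) + 1 ≤ 2 ^ 48 * (2 ^ L) ^ 6 := by rw [e]; norm_num; linarith
    _ = 2 ^ (48 + L * 6) := by rw [pow_add, pow_mul]
    _ ≤ _ := two_pow_mono (by omega)

lemma inv_sig_le (L : ℕ) (hL : 1 ≤ L) : 1 / sig L (Df L) ≤ 2 ^ (84 * L) := by
  unfold sig
  rw [one_div_one_div]
  calc 14 * 2 ^ (L + 20) * (Df L : ℝ) ≤ 2 ^ 4 * 2 ^ (L + 20) * 2 ^ (59 * L) := by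
        have := Df_le L hL
        gcongr; norm_num
    _ = 2 ^ (4 + (L + 20) + 59 * L) := by simp only [pow_add]
    _ ≤ _ := two_pow_mono (by omega)

lemma inv_hf1_le (L : ℕ) (hL : 1 ≤ L) : 1 / hf1 L (Df L) ≤ 2 ^ (169 * L) := by
  have h0 := sig_pos L (Df L) (Df_pos L hL)
  have h1 := inv_sig_le L hL
  have e : 1 / hf1 L (Df L) = 2 * (1 / sig L (Df L)) ^ 2 := by unfold hf1; field_simp
  rw [e]
  calc 2 * (1 / sig L (Df L)) ^ 2 ≤ 2 ^ 1 * (2 ^ (84 * L)) ^ 2 := by rw [pow_one]; gcongr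
    _ = 2 ^ (1 + 84 * L * 2) := by rw [pow_add, ← pow_mul]
    _ ≤ _ := two_pow_mono (by omega)

lemma inv_hf3_le (L : ℕ) (hL : 1 ≤ L) : 1 / hf3 L (Df L) ≤ 2 ^ (396 * L) := by
  have h0 := sig_pos L (Df L) (Df_pos L hL)
  obtain ⟨_, _, h10⟩ := hf3_bounds L (Df L) hL (Df_pos L hL)
  have h1 := inv_sig_le L hL
  have h2 := inv_hf1_le L hL
  have h3 := Mf_le L hL
  have h4 := L_le_two_pow L
  have hL0 : (0:ℝ) < L := by exact_mod_cast hL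
  have hM0 : (0:ℝ) ≤ Mf L := Nat.cast_nonneg _
  have e : 1 / hf3 L (Df L) = (1 / sig L (Df L)) * (1 / sig L (Df L)) * (1 / hf1 L (Df L)) * (10 * L) * (Mf L + 1) := by
    unfold hf3 hf2; field_simp
  rw [e]
  calc (1 / sig L (Df L)) * (1 / sig L (Df L)) * (1 / hf1 L (Df L)) * (10 * L) * (Mf L + 1) 
      ≤ 2 ^ (84 * L) * 2 ^ (84 * L) * 2 ^ (169 * L) * (2 ^ 4 * 2 ^ L) * 2 ^ (54 * L) := by gcongr; norm_num
    _ = 2 ^ (84 * L + 84 * L + 169 * L + (4 + L) + 54 * L) := by simp only [pow_add]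
    _ ≤ _ := two_pow_mono (by omega)

lemma group_ap (L : ℕ) (hL : 1 ≤ L) (A : Finset G) (hA : (Fintype.card G : ℝ) ≤ 2 ^ L * A.card) (len : ℕ)
    (hlen : 1 ≤ len) (hG : (2 ^ (16102 * L ^ 2) * len) ^ (2 * Df L) < Fintype.card G) :
    ∃ z y : G, y ≠ 0 ∧ ∀ j < len, ∃ a₁ ∈ A, ∃ a₂ ∈ A, ∃ a₃ ∈ A, z + j • y = a₁ + a₂ + a₃ := by
  obtain ⟨l, hl, hll, hlW, z, hz⟩ := iterate_step L hL A hA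
  obtain ⟨h30, _, h10⟩ := hf3_bounds L (Df L) hL (Df_pos L hL)
  have h3 := inv_hf3_le L hL
  have h1 := inv_hf1_le L hL
  set W := (1 / hf3 L (Df L)) ^ (40 * L) with hW
  set h := hf1 L (Df L) with hh
  have hlp : (0:ℝ) < len := by exact_mod_cast hlen
  have hW' : W ≤ 2 ^ (15840 * L ^ 2) := by
    calc W ≤ (2 ^ (396 * L)) ^ (40 * L) := pow_le_pow_left₀ (by positivity) h3 _
      _ = _ := by rw [← pow_mul]; ring_nf
  have hW0 : 0 ≤ W := by positivity
  obtain ⟨n, hn⟩ : ∃ n, n = 2 ^ (16100 * L ^ 2) * len := ⟨_, rfl⟩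
  have hn1 : 1 ≤ n := by rw [hn]; exact Nat.succ_le_of_lt (by positivity)
  have hnb : 2 * W ≤ n * (h / len / 2) := by
    have e : (n:ℝ) * (h / len / 2) = 2 ^ (16100 * L ^ 2) * h / 2 := by
      rw [hn]; push_cast; field_simp
    rw [e, le_div_iff₀ (by norm_num)]
    have h5 : 2 * W * 2 * (1 / h) ≤ 2 ^ (16100 * L ^ 2) := by
      calc 2 * W * 2 * (1 / h) ≤ 2 ^ 1 * 2 ^ (15840 * L ^ 2) * 2 ^ 1 * 2 ^ (169 * L) := by
            rw [pow_one]; gcongr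
        _ = 2 ^ (1 + 15840 * L ^ 2 + 1 + 169 * L) := by simp only [pow_add]
        _ ≤ _ := two_pow_mono (by nlinarith)
    rw [mul_one_div, div_le_iff₀ h10] at h5
    exact h5
  have hcard : ((2 * n + 1) ^ 2) ^ l.length < Fintype.card G := by
    refine lt_of_le_of_lt ?_ hG
    have h6 : 2 * n + 1 ≤ 2 ^ (16102 * L ^ 2) * len := by
      have : 2 ^ (16102 * L ^ 2) = 2 ^ (2 * L ^ 2) * 2 ^ (16100 * L ^ 2) := by rw [← pow_add]; ring_nf
      rw [this, mul_assoc, ← hn]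
      have h7 : 2 ^ 2 ≤ 2 ^ (2 * L ^ 2) := Nat.pow_le_pow_right (by norm_num) (by nlinarith)
      nlinarith
    rw [pow_mul]
    calc ((2 * n + 1) ^ 2) ^ l.length ≤ ((2 * n + 1) ^ 2) ^ (Df L) := Nat.pow_le_pow_right (by positivity) hll
      _ ≤ _ := Nat.pow_le_pow_left (Nat.pow_le_pow_left h6 2) _
  obtain ⟨y, hy, hy0⟩ := exists_small l hl hlW (show 0 < h / len by positivity) n hnb hcard
  refine ⟨z, y, hy0, fun j hj => hz _ (ball_mono l ?_ (nsmul_mem_ball hl hy j))⟩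
  have : (j:ℝ) ≤ len := by exact_mod_cast hj.le
  calc (j:ℝ) * (h / len) ≤ len * (h / len) := by gcongr
    _ = h := by field_simp

end KM


namespace KM
open Finset

lemma lift_ap (N : ℕ) (A : Finset ℕ) (hA : A ⊆ Finset.Icc 1 N) (len : ℕ)
    (z y : ZMod (6 * N + 1)) (hy : y ≠ 0)
    (h : ∀ j < len, ∃ a₁ ∈ A, ∃ a₂ ∈ A, ∃ a₃ ∈ A, z + j • y = ((a₁ + a₂ + a₃ : ℕ) : ZMod (6 * N + 1))) :
    ∃ x y : ℤ, y ≠ 0 ∧ ∀ j : ℕ, j < len →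
          ∃ a₁ ∈ A, ∃ a₂ ∈ A, ∃ a₃ ∈ A, x + (j : ℤ) * y = (a₁ : ℤ) + (a₂ : ℤ) + (a₃ : ℤ) := by
  have h' : ∀ j : ℕ, ∃ s : ℤ, j < len → (3 ≤ s ∧ s ≤ 3 * N ∧ z + j • y = (s : ZMod (6 * N + 1)) ∧
      ∃ a₁ ∈ A, ∃ a₂ ∈ A, ∃ a₃ ∈ A, s = (a₁ : ℤ) + (a₂ : ℤ) + (a₃ : ℤ)) := by
    intro j
    by_cases hj : j < len
    · obtain ⟨a₁, h1, a₂, h2, a₃, h3, he⟩ := h j hj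
      refine ⟨(a₁ : ℤ) + a₂ + a₃, fun _ => ?_⟩
      have b1 := Finset.mem_Icc.1 (hA h1)
      have b2 := Finset.mem_Icc.1 (hA h2)
      have b3 := Finset.mem_Icc.1 (hA h3)
      refine ⟨by omega, by omega, ?_, a₁, h1, a₂, h2, a₃, h3, rfl⟩
      rw [he]; push_cast; ring
    · exact ⟨0, fun h => absurd h hj⟩
  choose s hs using h'
  rcases lt_or_ge len 2 with hl | hl
  · refine ⟨s 0, 1, one_ne_zero, fun j hj => ?_⟩
    have : j = 0 := by omega
    subst this
    obtain ⟨_, _, _, hh⟩ := hs 0 hj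
    simpa using hh
  · have hs0 := hs 0 (by omega)
    have hs1 := hs 1 (by omega)
    have key : ∀ j : ℕ, j < len → s j = s 0 + j * (s 1 - s 0) := by
      intro j
      induction j with
      | zero => intro _; simp
      | succ j ih =>
        intro hj
        have i1 := ih (by omega)
        have a1 := hs j (by omega)
        have a2 := hs (j+1) hj
        have hz : (((s (j+1) - s j) - (s 1 - s 0) : ℤ) : ZMod (6 * N + 1)) = 0 := by
          push_cast
          rw [← a1.2.2.1, ← a2.2.2.1, ← hs0.2.2.1, ← hs1.2.2.1]
          simp only [add_smul, one_smul, zero_smul]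
          abel
        rw [ZMod.intCast_zmod_eq_zero_iff_dvd] at hz
        have hz0 : (s (j+1) - s j) - (s 1 - s 0) = 0 := by
          refine Int.eq_zero_of_abs_lt_dvd hz ?_
          rw [abs_lt]
          push_cast
          constructor <;> linarith [a1.1, a1.2.1, a2.1, a2.2.1, hs0.1, hs0.2.1, hs1.1, hs1.2.1]
        push_cast
        linarith
    refine ⟨s 0, s 1 - s 0, ?_, fun j hj => ?_⟩
    · intro h0
      apply hy
      have e : ((s 1 - s 0 : ℤ) : ZMod (6 * N + 1)) = y := by
        push_cast
        rw [← hs0.2.2.1, ← hs1.2.2.1]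
        simp
      rw [← e, h0]; simp
    · rw [← key j hj]
      exact (hs j hj).2.2.2

lemma int_ap (N : ℕ) (A : Finset ℕ) (hA : A ⊆ Finset.Icc 1 N) (L : ℕ) (hL : 1 ≤ L)
    (hAc : ((6 * N + 1 : ℕ) : ℝ) ≤ 2 ^ L * A.card) (len : ℕ) (hlen : 1 ≤ len)
    (hG : (2 ^ (16102 * L ^ 2) * len) ^ (2 * Df L) < 6 * N + 1) :
    ∃ x y : ℤ, y ≠ 0 ∧ ∀ j : ℕ, j < len →
          ∃ a₁ ∈ A, ∃ a₂ ∈ A, ∃ a₃ ∈ A, x + (j : ℤ) * y = (a₁ : ℤ) + (a₂ : ℤ) + (a₃ : ℤ) := by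
  haveI : NeZero (6 * N + 1) := ⟨by omega⟩
  have hinj : Set.InjOn (fun a : ℕ => (a : ZMod (6 * N + 1))) A := by
    intro a ha b hb hab
    have b1 := Finset.mem_Icc.1 (hA ha)
    have b2 := Finset.mem_Icc.1 (hA hb)
    simp only at hab
    rw [ZMod.natCast_eq_natCast_iff] at hab
    exact Nat.ModEq.eq_of_lt_of_lt hab (by omega) (by omega)
  have hc : (A.image (fun a : ℕ => (a : ZMod (6 * N + 1)))).card = A.card := Finset.card_image_of_injOn hinj
  obtain ⟨z, y, hy, h⟩ := group_ap L hL (A.image (fun a : ℕ => (a : ZMod (6 * N + 1)))) 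
    (by rw [hc, ZMod.card]; exact hAc) len hlen (by rw [ZMod.card]; exact hG)
  refine lift_ap N A hA len z y hy fun j hj => ?_
  obtain ⟨b₁, h1, b₂, h2, b₃, h3, he⟩ := h j hj
  obtain ⟨a₁, k1, rfl⟩ := Finset.mem_image.1 h1
  obtain ⟨a₂, k2, rfl⟩ := Finset.mem_image.1 h2
  obtain ⟨a₃, k3, rfl⟩ := Finset.mem_image.1 h3
  exact ⟨a₁, k1, a₂, k2, a₃, k3, by rw [he]; push_cast; rfl⟩

end KM

theorem statement4 :
    ∃ C > (0 : ℝ), ∃ c > (0 : ℝ), ∀ N : ℕ, 0 < N → ∀ A : Finset ℕ,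
      A ⊆ Finset.Icc 1 N → A.Nonempty →
      ∃ L : ℕ,
        Real.exp (-C * Real.log (2 / ((A.card : ℝ) / (N : ℝ))) ^ 2) *
            (N : ℝ) ^ (c / Real.log (2 / ((A.card : ℝ) / (N : ℝ))) ^ 9) ≤ (L : ℝ) ∧
        ∃ x y : ℤ, y ≠ 0 ∧ ∀ j : ℕ, j < L →
          ∃ a₁ ∈ A, ∃ a₂ ∈ A, ∃ a₃ ∈ A, x + (j : ℤ) * y = (a₁ : ℤ) + (a₂ : ℤ) + (a₃ : ℤ) := by
  refine ⟨1610300, by norm_num, 1 / 10 ^ 24, by positivity, fun N hN A hA hAne => ?_⟩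
  have hNp : (0:ℝ) < N := by exact_mod_cast hN
  have hN1 : (1:ℝ) ≤ N := by exact_mod_cast hN
  have hAp : (0:ℝ) < A.card := by exact_mod_cast hAne.card_pos
  have hAN : (A.card : ℝ) ≤ N := by
    have := Finset.card_le_card hA
    rw [Nat.card_Icc] at this
    exact_mod_cast (by omega : A.card ≤ N)
  set α := (A.card : ℝ) / N with hα
  have hα0 : 0 < α := by positivity
  have hα1 : α ≤ 1 := by rw [hα, div_le_one hNp]; exact hAN
  set g := Real.log (2 / α) with hg
  have h2α : 2 ≤ 2 / α := by rw [le_div_iff₀ hα0]; linarith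
  have hexpg : Real.exp g = 2 / α := Real.exp_log (by positivity)
  have hg69 : 0.69 ≤ g := by
    have h1 := Real.log_two_gt_d9
    have h2 := Real.log_le_log (by norm_num) h2α
    rw [← hg] at h2; linarith
  have hg0 : 0 < g := by linarith
  set Rb := Real.exp (-1610300 * g ^ 2) * (N : ℝ) ^ ((1 / 10 ^ 24) / g ^ 9) with hRb
  rcases le_or_gt Rb 1 with hR1 | hR1
  · obtain ⟨a, ha⟩ := hAne
    refine ⟨1, by simpa using hR1, (a:ℤ) + a + a, 1, one_ne_zero, fun j hj => ⟨a, ha, a, ha, a, ha, ?_⟩⟩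
    have : j = 0 := by omega
    subst this; simp
  · set len := ⌈Rb⌉₊ with hlen
    have hlen1 : 1 ≤ len := Nat.one_le_ceil_iff.2 (by linarith)
    have hlen2 : (len : ℝ) ≤ 2 * Rb := by
      have := (Nat.ceil_lt_add_one (show 0 ≤ Rb by linarith)).le
      linarith
    refine ⟨len, Nat.le_ceil _, ?_⟩
    set L := ⌈8 * g⌉₊ with hL
    have hLge : 8 * g ≤ L := Nat.le_ceil _
    have hLle : (L : ℝ) ≤ 10 * g := by
      have := (Nat.ceil_lt_add_one (show 0 ≤ 8 * g by linarith)).le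
      linarith
    have hL1 : 1 ≤ L := Nat.one_le_ceil_iff.2 (by linarith)
    clear_value L len
    refine KM.int_ap N A hA L hL1 ?_ len hlen1 ?_
    · have h1 : Real.exp (4 * g) ≤ 2 ^ L := by
        have h2 : Real.exp (1/2) ≤ 2 := by
          have h3 := Real.exp_one_lt_d9
          have h4 : Real.exp (1/2) ^ 2 = Real.exp 1 := by rw [← Real.exp_nat_mul]; norm_num
          have h5 := Real.exp_pos (1/2)
          nlinarith
        calc Real.exp (4 * g) ≤ Real.exp (L * (1/2)) := Real.exp_le_exp.2 (by linarith)
          _ = Real.exp (1/2) ^ L := by rw [Real.exp_nat_mul]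
          _ ≤ 2 ^ L := pow_le_pow_left₀ (Real.exp_pos _).le h2 L
      have h6 : Real.exp (4 * g) = (2 / α) ^ 4 := by
        rw [← hexpg, ← Real.exp_nat_mul]; norm_num
      have h7 : 7 / α ≤ 2 ^ L := by
        refine le_trans ?_ h1
        rw [h6]
        have h8 : (2:ℝ) ^ 3 ≤ (2 / α) ^ 3 := pow_le_pow_left₀ (by norm_num) h2α 3
        have h9 : 7 / α = 3.5 * (2 / α) := by ring
        rw [h9, pow_succ]
        refine mul_le_mul_of_nonneg_right ?_ (by linarith)
        linarith
      have h10 : 7 / α * A.card = 7 * N := by rw [hα]; field_simp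
      have h11 := mul_le_mul_of_nonneg_right h7 hAp.le
      push_cast
      linarith
    · have hR : (2:ℝ) ^ (16102 * L ^ 2) * len ≤ (N:ℝ) ^ ((1 / 10 ^ 24) / g ^ 9) := by
        have h1 : (2:ℝ) ^ (16102 * L ^ 2) * 2 ≤ Real.exp (1610300 * g ^ 2) := by
          calc (2:ℝ) ^ (16102 * L ^ 2) * 2 = 2 ^ (16102 * L ^ 2 + 1) := by rw [pow_succ 2 (16102 * L ^ 2)]
            _ ≤ 2 ^ (16103 * L ^ 2) := KM.two_pow_mono (by nlinarith)
            _ ≤ Real.exp ((16103 * L ^ 2 : ℕ) : ℝ) := KM.two_pow_le_exp _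
            _ ≤ _ := Real.exp_le_exp.2 (by
              push_cast
              have := pow_le_pow_left₀ (Nat.cast_nonneg L) hLle 2
              nlinarith)
        have h2 : Real.exp (1610300 * g ^ 2) * Rb = (N:ℝ) ^ ((1 / 10 ^ 24) / g ^ 9) := by
          rw [hRb, ← mul_assoc, ← Real.exp_add]
          rw [show 1610300 * g ^ 2 + -1610300 * g ^ 2 = 0 by ring, Real.exp_zero, one_mul]
        calc (2:ℝ) ^ (16102 * L ^ 2) * len ≤ 2 ^ (16102 * L ^ 2) * (2 * Rb) := mul_le_mul_of_nonneg_left hlen2 (by positivity)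
          _ = 2 ^ (16102 * L ^ 2) * 2 * Rb := by ring
          _ ≤ Real.exp (1610300 * g ^ 2) * Rb := mul_le_mul_of_nonneg_right h1 (by linarith)
          _ = _ := h2
      have hpow := pow_le_pow_left₀ (by positivity) hR (2 * KM.Df L)
      have hexp : (1 / 10 ^ 24) / g ^ 9 * ((2 * KM.Df L : ℕ) : ℝ) ≤ 1 := by
        push_cast
        rw [KM.Df_eq]
        have h1 := pow_le_pow_left₀ (Nat.cast_nonneg L) hLle 7
        have h2 : (0.4:ℝ) ≤ g ^ 2 := by nlinarith
        have h3 : (0:ℝ) < g ^ 7 := by positivity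
        have h4 : g ^ 9 = g ^ 2 * g ^ 7 := by ring
        rw [div_mul_eq_mul_div, div_le_one (by positivity), h4]
        rw [mul_pow] at h1
        have h5 := mul_le_mul_of_nonneg_right h2 h3.le
        norm_num at h1 ⊢
        linarith
      have hfin : ((N:ℝ) ^ ((1 / 10 ^ 24) / g ^ 9)) ^ (2 * KM.Df L) ≤ N := by
        rw [← Real.rpow_natCast, ← Real.rpow_mul hNp.le]
        calc (N:ℝ) ^ ((1 / 10 ^ 24) / g ^ 9 * ((2 * KM.Df L : ℕ) : ℝ)) ≤ (N:ℝ) ^ (1:ℝ) := Real.rpow_le_rpow_of_exponent_le hN1 hexp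
          _ = N := Real.rpow_one _
      have hle : (2 ^ (16102 * L ^ 2) * len) ^ (2 * KM.Df L) ≤ N := by
        exact_mod_cast hpow.trans hfin
      omega
end
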